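/- arXiv:1701.00858 — 9 statements merged into one kernel-verified Lean document; each statement's English description precedes it below -/
import Mathlib

section
/- Second-order expansion of the rank-one Bayes-optimal state-evolution map around the uniform fixed point: define F(y) = E over x₀ ~ P and W of [ x₀ · f_in( y, y·x₀ + √y·W ) ] for y ≥ 0. If ∫ x dP(x) = 0, then lim_{y→0⁺} ( F(y) − m₂²·y ) / y² = −( m₂³ − m₃²/2 ), where m₂ = ∫ x² dP(x) and m₃ = ∫ x³ dP(x). Equivalently, F(y) = m₂² y − ( m₂³ − m₃²/2 ) y² + o(y²) as y → 0⁺. -/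
open MeasureTheory ProbabilityTheory Filter

/-- `Z(A,B) = ∫ exp(B·x − A·x²/2) dP(x)`. -/
noncomputable def Zfun (P : Measure ℝ) (A B : ℝ) : ℝ :=
  ∫ x, Real.exp (B * x - A * x ^ 2 / 2) ∂P

/-- `f_in(A,B) = (∫ x·exp(B·x − A·x²/2) dP(x)) / Z(A,B)`. -/
noncomputable def fIn (P : Measure ℝ) (A B : ℝ) : ℝ :=
  (∫ x, x * Real.exp (B * x - A * x ^ 2 / 2) ∂P) / Zfun P A B

/-- `F(y) = E_{x₀ ∼ P, W ∼ N(0,1)} [ x₀ · f_in(y, y·x₀ + √y·W) ]`. -/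
noncomputable def Fse (P : Measure ℝ) (y : ℝ) : ℝ :=
  ∫ x₀, ∫ w, x₀ * fIn P y (y * x₀ + Real.sqrt y * w) ∂(gaussianReal 0 1) ∂P

/-- A continuous function is integrable against a finite measure carried by a compact set. -/
lemma integrable_of_continuous_of_ae_mem_compact {X : Type*} [TopologicalSpace X] [T2Space X]
    [MeasurableSpace X] [OpensMeasurableSpace X] {μ : Measure X} [IsFiniteMeasure μ] {K : Set X}
    (hK : IsCompact K) (hμK : ∀ᵐ x ∂μ, x ∈ K) {f : X → ℝ} (hf : Continuous f) :
    Integrable f μ := by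
  rw [← Measure.restrict_eq_self_of_ae_mem hμK]
  exact hf.continuousOn.integrableOn_compact' hK hK.measurableSet

lemma ae_pi_mem_pi_univ {ι : Type*} [Fintype ι] {P : Measure ℝ} [IsProbabilityMeasure P]
    {K : Set ℝ} (hPK : ∀ᵐ x ∂P, x ∈ K) :
    ∀ᵐ v ∂(Measure.pi fun _ : ι => P), v ∈ Set.univ.pi fun _ => K := by
  have h : ∀ᵐ v ∂(Measure.pi fun _ : ι => P), ∀ i, v i ∈ K :=
    eventually_all.2 fun i => (Measure.tendsto_eval_ae_ae (i := i)).eventually hPK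
  filter_upwards [h] with v hv i _ using hv i

lemma integrable_pi_of_continuous {ι : Type*} [Fintype ι] {P : Measure ℝ}
    [IsProbabilityMeasure P] {K : Set ℝ} (hK : IsCompact K) (hPK : ∀ᵐ x ∂P, x ∈ K)
    {f : (ι → ℝ) → ℝ} (hf : Continuous f) : Integrable f (Measure.pi fun _ => P) :=
  integrable_of_continuous_of_ae_mem_compact (isCompact_univ_pi fun _ => hK)
    (ae_pi_mem_pi_univ hPK) hf

lemma integral_pi_eq_integral_snoc {P : Measure ℝ} [IsProbabilityMeasure P] {n : ℕ}
    {f : (Fin (n + 1) → ℝ) → ℝ} (hf : Integrable f (Measure.pi fun _ => P)) :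
    ∫ v, f v ∂(Measure.pi fun _ => P) =
      ∫ v, ∫ x, f (Fin.snoc v x) ∂P ∂(Measure.pi fun _ : Fin n => P) := by
  have hmp := (measurePreserving_piFinSuccAbove (fun _ : Fin (n + 1) => P) (Fin.last n)).symm
  rw [← hmp.integral_comp', integral_prod_symm]
  · simp [MeasurableEquiv.piFinSuccAbove_symm_apply, Fin.insertNthEquiv, Fin.insertNth_last']
  · exact (hmp.integrable_comp_emb (MeasurableEquiv.measurableEmbedding _)).2 hf

/-- The second elementary symmetric function of a finite family of reals. -/
noncomputable def pairSum {n : ℕ} (v : Fin n → ℝ) : ℝ := ((∑ i, v i) ^ 2 - ∑ i, v i ^ 2) / 2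

lemma continuous_pairSum {n : ℕ} : Continuous (pairSum (n := n)) := by
  unfold pairSum
  fun_prop

lemma pairSum_snoc {n : ℕ} (v : Fin n → ℝ) (x : ℝ) :
    pairSum (Fin.snoc v x : Fin (n + 1) → ℝ) = pairSum v + x * ∑ i, v i := by
  simp only [pairSum, Fin.sum_univ_castSucc, Fin.snoc_castSucc, Fin.snoc_last]
  ring

lemma pairSum_two (v : Fin 2 → ℝ) : pairSum v = v 0 * v 1 := by
  simp only [pairSum, Fin.sum_univ_two]
  ring

lemma integral_quadratic {P : Measure ℝ} [IsProbabilityMeasure P] {K : Set ℝ} (hK : IsCompact K)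
    (hPK : ∀ᵐ x ∂P, x ∈ K) (hmean : ∫ x, x ∂P = 0) (a b c : ℝ) :
    ∫ x, (a + b * x + c * x ^ 2) ∂P = a + c * ∫ x, x ^ 2 ∂P := by
  have hint {f : ℝ → ℝ} (hf : Continuous f) : Integrable f P :=
    integrable_of_continuous_of_ae_mem_compact hK hPK hf
  rw [integral_add (hint (by fun_prop)) (hint (by fun_prop)),
    integral_add (hint (by fun_prop)) (hint (by fun_prop)), integral_const_mul,
    integral_const_mul, hmean]
  simp

lemma integral_pi_two_monomial {P : Measure ℝ} [IsProbabilityMeasure P] (i j : ℕ) :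
    ∫ v, v 0 ^ i * v 1 ^ j ∂(Measure.pi fun _ : Fin 2 => P) =
      (∫ x, x ^ i ∂P) * ∫ x, x ^ j ∂P := by
  have h := integral_fintype_prod_eq_prod (𝕜 := ℝ) (μ := fun _ : Fin 2 => P)
    (fun k x => x ^ (![i, j] k))
  simpa [Fin.prod_univ_two] using h

/-- The moments of the elementary symmetric functions that enter the expansion to second order. -/
lemma integral_pi_moments {P : Measure ℝ} [IsProbabilityMeasure P] {K : Set ℝ} (hK : IsCompact K)
    (hPK : ∀ᵐ x ∂P, x ∈ K) (hmean : ∫ x, x ∂P = 0) (n : ℕ) :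
    (∫ v, v 0 * v 1 ∂(Measure.pi fun _ : Fin (n + 2) => P) = 0) ∧
    (∫ v, v 0 * v 1 * (∑ i, v i) ^ 2 ∂(Measure.pi fun _ : Fin (n + 2) => P) =
      2 * (∫ x, x ^ 2 ∂P) ^ 2) ∧
    (∫ v, v 0 * v 1 * pairSum v ∂(Measure.pi fun _ : Fin (n + 2) => P) =
      (∫ x, x ^ 2 ∂P) ^ 2) ∧
    (∫ v, v 0 * v 1 * pairSum v ^ 2 ∂(Measure.pi fun _ : Fin (n + 2) => P) =
      (∫ x, x ^ 3 ∂P) ^ 2 + 2 * n * (∫ x, x ^ 2 ∂P) ^ 3) := by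
  have hint {k : ℕ} {f : (Fin k → ℝ) → ℝ} (hf : Continuous f) :
      Integrable f (Measure.pi fun _ => P) := integrable_pi_of_continuous hK hPK hf
  have hθ {k : ℕ} : Continuous (pairSum (n := k)) := continuous_pairSum
  induction n with
  | zero =>
    have hmon := integral_pi_two_monomial (P := P)
    have h11 := hmon 1 1
    have h22 := hmon 2 2
    have h33 := hmon 3 3
    have h31 := hmon 3 1
    have h13 := hmon 1 3
    simp only [pow_one, hmean, mul_zero, zero_mul] at h11 h31 h13
    refine ⟨h11, ?_, ?_, ?_⟩
    · have : ∀ v : Fin 2 → ℝ, v 0 * v 1 * (∑ i, v i) ^ 2 =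
          v 0 ^ 3 * v 1 + 2 * (v 0 ^ 2 * v 1 ^ 2) + v 0 * v 1 ^ 3 := fun v => by
        rw [Fin.sum_univ_two]; ring
      simp only [this]
      rw [integral_add (hint (by fun_prop)) (hint (by fun_prop)),
        integral_add (hint (by fun_prop)) (hint (by fun_prop)), integral_const_mul, h31, h13, h22]
      ring
    · have : ∀ v : Fin 2 → ℝ, v 0 * v 1 * pairSum v = v 0 ^ 2 * v 1 ^ 2 := fun v => by
        rw [pairSum_two]; ring
      simp only [this]
      rw [h22]; ring
    · have : ∀ v : Fin 2 → ℝ, v 0 * v 1 * pairSum v ^ 2 = v 0 ^ 3 * v 1 ^ 3 := fun v => by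
        rw [pairSum_two]; ring
      simp only [this]
      rw [h33]; push_cast; ring
  | succ n ih =>
    obtain ⟨h0, hS, h1, h2⟩ := ih
    have s0 (v : Fin (n + 2) → ℝ) (x : ℝ) : (Fin.snoc v x : Fin (n + 2 + 1) → ℝ) 0 = v 0 :=
      Fin.snoc_castSucc (α := fun _ => ℝ) (i := 0) ..
    have s1 (v : Fin (n + 2) → ℝ) (x : ℝ) : (Fin.snoc v x : Fin (n + 2 + 1) → ℝ) 1 = v 1 :=
      Fin.snoc_castSucc (α := fun _ => ℝ) (i := 1) ..
    have sS (v : Fin (n + 2) → ℝ) (x : ℝ) :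
        ∑ i, (Fin.snoc v x : Fin (n + 2 + 1) → ℝ) i = (∑ i, v i) + x := by
      simp [Fin.sum_univ_castSucc]
    have hq := integral_quadratic hK hPK hmean
    set m₂ := ∫ x, x ^ 2 ∂P
    refine ⟨?_, ?_, ?_, ?_⟩ <;>
      rw [integral_pi_eq_integral_snoc (n := n + 2) (hint (by fun_prop))] <;>
      simp only [s0, s1, sS, pairSum_snoc]
    · simpa using h0
    · have (v : Fin (n + 2) → ℝ) : ∫ x, v 0 * v 1 * (∑ i, v i + x) ^ 2 ∂P =
          v 0 * v 1 * (∑ i, v i) ^ 2 + m₂ * (v 0 * v 1) := by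
        rw [mul_comm m₂, ← hq _ (2 * v 0 * v 1 * ∑ i, v i) _]
        congr with x; ring
      simp only [this]
      rw [integral_add (hint (by fun_prop)) (hint (by fun_prop)), integral_const_mul, hS, h0]
      ring
    · have (v : Fin (n + 2) → ℝ) : ∫ x, v 0 * v 1 * (pairSum v + x * ∑ i, v i) ∂P =
          v 0 * v 1 * pairSum v := by
        rw [← add_zero (v 0 * v 1 * pairSum v), ← zero_mul m₂, ← hq _ (v 0 * v 1 * ∑ i, v i) _]
        congr with x; ring
      simp only [this]
      exact h1
    · have (v : Fin (n + 2) → ℝ) : ∫ x, v 0 * v 1 * (pairSum v + x * ∑ i, v i) ^ 2 ∂P =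
          v 0 * v 1 * pairSum v ^ 2 + m₂ * (v 0 * v 1 * (∑ i, v i) ^ 2) := by
        rw [mul_comm m₂, ← hq _ (2 * v 0 * v 1 * pairSum v * ∑ i, v i) _]
        congr with x; ring
      simp only [this]
      rw [integral_add (hint (by fun_prop)) (hint (by fun_prop)), integral_const_mul, hS, h2]
      push_cast; ring

lemma tendsto_integral_mul_exp_second_order {X : Type*} [MeasurableSpace X] {μ : Measure X}
    {g θ : X → ℝ} {M : ℝ} (hM : ∀ᵐ x ∂μ, |θ x| ≤ M) (h0 : Integrable g μ)
    (h1 : Integrable (fun x => g x * θ x) μ) (h2 : Integrable (fun x => g x * θ x ^ 2) μ)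
    (hexp : ∀ s : ℝ, Integrable (fun x => g x * Real.exp (s * θ x)) μ) :
    Tendsto (fun s => (∫ x, g x * Real.exp (s * θ x) ∂μ - ∫ x, g x ∂μ - s * ∫ x, g x * θ x ∂μ -
      s ^ 2 / 2 * ∫ x, g x * θ x ^ 2 ∂μ) / s ^ 2) (nhdsWithin 0 (Set.Ioi 0)) (nhds 0) := by
  have hlim : Tendsto (fun s : ℝ => s * (|M| ^ 3 * ∫ x, |g x| ∂μ)) (nhdsWithin 0 (Set.Ioi 0))
      (nhds 0) := by
    refine Tendsto.mono_left ?_ nhdsWithin_le_nhds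
    exact Continuous.tendsto' (by fun_prop) _ _ (by simp)
  have hsmall : ∀ᶠ s : ℝ in nhdsWithin 0 (Set.Ioi 0), s * |M| < 1 := by
    refine Filter.Eventually.filter_mono nhdsWithin_le_nhds ?_
    exact (Continuous.tendsto' (f := fun s : ℝ => s * |M|) (by fun_prop) 0 0
      (by simp)).eventually_lt_const one_pos
  refine squeeze_zero_norm' ?_ hlim
  filter_upwards [hsmall, self_mem_nhdsWithin] with s hsM hs
  have hs : 0 < s := hs
  have hrem : ∫ x, g x * Real.exp (s * θ x) ∂μ - ∫ x, g x ∂μ - s * ∫ x, g x * θ x ∂μ -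
      s ^ 2 / 2 * ∫ x, g x * θ x ^ 2 ∂μ = ∫ x, (g x * Real.exp (s * θ x) - g x -
        s * (g x * θ x) - s ^ 2 / 2 * (g x * θ x ^ 2)) ∂μ := by
    have ha : Integrable (fun x => g x * Real.exp (s * θ x) - g x) μ := (hexp s).sub h0
    have hb : Integrable (fun x => g x * Real.exp (s * θ x) - g x - s * (g x * θ x)) μ :=
      ha.sub (h1.const_mul s)
    rw [integral_sub hb (h2.const_mul _), integral_sub ha (h1.const_mul s),
      integral_sub (hexp s) h0, integral_const_mul, integral_const_mul]
  have hbound : ‖∫ x, (g x * Real.exp (s * θ x) - g x - s * (g x * θ x) -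
      s ^ 2 / 2 * (g x * θ x ^ 2)) ∂μ‖ ≤ ∫ x, s ^ 3 * |M| ^ 3 * |g x| ∂μ := by
    refine norm_integral_le_of_norm_le (h0.abs.const_mul _) ?_
    filter_upwards [hM] with x hx
    have hx' : |s * θ x| ≤ s * |M| := by
      rw [abs_mul, abs_of_pos hs]
      exact mul_le_mul_of_nonneg_left (hx.trans (le_abs_self M)) hs.le
    have hexpb := Real.exp_bound (hx'.trans hsM.le) (n := 3) (by norm_num)
    have hsum : ∑ m ∈ Finset.range 3, (s * θ x) ^ m / (m.factorial : ℝ) =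
        1 + s * θ x + (s * θ x) ^ 2 / 2 := by
      simp [Finset.sum_range_succ]
    rw [hsum] at hexpb
    have hcube : |Real.exp (s * θ x) - (1 + s * θ x + (s * θ x) ^ 2 / 2)| ≤ (s * |M|) ^ 3 := by
      refine hexpb.trans ?_
      calc |s * θ x| ^ 3 * _ ≤ |s * θ x| ^ 3 * 1 := by
            gcongr; norm_num [Nat.factorial]
        _ ≤ (s * |M|) ^ 3 := by rw [mul_one]; gcongr
    calc ‖g x * Real.exp (s * θ x) - g x - s * (g x * θ x) - s ^ 2 / 2 * (g x * θ x ^ 2)‖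
        = |g x| * |Real.exp (s * θ x) - (1 + s * θ x + (s * θ x) ^ 2 / 2)| := by
          rw [Real.norm_eq_abs, ← abs_mul]; congr 1; ring
      _ ≤ |g x| * (s * |M|) ^ 3 := by gcongr
      _ = s ^ 3 * |M| ^ 3 * |g x| := by ring
  rw [hrem, norm_div, norm_pow, Real.norm_of_nonneg hs.le, div_le_iff₀ (by positivity)]
  refine hbound.trans_eq ?_
  rw [integral_const_mul]
  ring

/-- The mean of `v₀ v₁ exp(s e₂(v))` over `n + 2` independent samples `v` of `P`. -/
noncomputable def replicaMean (P : Measure ℝ) (n : ℕ) (s : ℝ) : ℝ :=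
  ∫ v, v 0 * v 1 * Real.exp (s * pairSum v) ∂(Measure.pi fun _ : Fin (n + 2) => P)

lemma tendsto_replicaMean {P : Measure ℝ} [IsProbabilityMeasure P] {K : Set ℝ}
    (hK : IsCompact K) (hPK : ∀ᵐ x ∂P, x ∈ K) (hmean : ∫ x, x ∂P = 0) (n : ℕ) :
    Tendsto (fun s => (replicaMean P n s - (∫ x, x ^ 2 ∂P) ^ 2 * s) / s ^ 2)
      (nhdsWithin 0 (Set.Ioi 0))
      (nhds ((∫ x, x ^ 3 ∂P) ^ 2 / 2 + n * (∫ x, x ^ 2 ∂P) ^ 3)) := by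
  have hint {f : (Fin (n + 2) → ℝ) → ℝ} (hf : Continuous f) :
      Integrable f (Measure.pi fun _ => P) := integrable_pi_of_continuous hK hPK hf
  have hθ : Continuous (pairSum (n := n + 2)) := continuous_pairSum
  obtain ⟨h0, -, h1, h2⟩ := integral_pi_moments hK hPK hmean n
  obtain ⟨M, hM⟩ := (isCompact_univ_pi fun _ : Fin (n + 2) => hK).exists_bound_of_continuousOn
    hθ.continuousOn
  have hlim := tendsto_integral_mul_exp_second_order (μ := Measure.pi fun _ : Fin (n + 2) => P)
    (g := fun v => v 0 * v 1) (θ := pairSum) (M := M)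
    ((ae_pi_mem_pi_univ hPK).mono fun v hv => hM v hv)
    (hint (by fun_prop)) (hint (by fun_prop)) (hint (by fun_prop)) fun s => hint (by fun_prop)
  have := hlim.add_const ((∫ x, x ^ 3 ∂P) ^ 2 / 2 + n * (∫ x, x ^ 2 ∂P) ^ 3)
  rw [zero_add] at this
  refine this.congr' ?_
  filter_upwards [self_mem_nhdsWithin] with s hs
  have hs : s ≠ 0 := (Set.mem_Ioi.1 hs).ne'
  rw [h0, h1, h2, ← replicaMean]
  field_simp
  ring

lemma integral_gaussian_exp (a S q : ℝ) :
    ∫ w, a * Real.exp (S * w - q) ∂(gaussianReal 0 1) = a * Real.exp (S ^ 2 / 2 - q) := by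
  have := congrFun (mgf_id_gaussianReal (μ := 0) (v := 1)) S
  simp only [mgf, id, NNReal.coe_one, zero_mul, zero_add, one_mul] at this
  simp only [Real.exp_sub]
  rw [integral_const_mul, integral_div, this]

/-- Joint integrability against a Gaussian of a kernel that is exponential-affine in the Gaussian
variable. -/
lemma integrable_prod_gaussian_exp {X : Type*} [TopologicalSpace X] [SecondCountableTopology X]
    [MeasurableSpace X] [BorelSpace X] {μ : Measure X} [IsFiniteMeasure μ]
    (hμ : ∀ f : X → ℝ, Continuous f → Integrable f μ) {g S q : X → ℝ} (hg : Continuous g)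
    (hS : Continuous S) (hq : Continuous q) :
    Integrable (fun p : X × ℝ => g p.1 * Real.exp (S p.1 * p.2 - q p.1))
      (μ.prod (gaussianReal 0 1)) := by
  have hsec (x : X) : Integrable (fun w => g x * Real.exp (S x * w - q x)) (gaussianReal 0 1) := by
    simp only [Real.exp_sub, ← mul_div_assoc]
    exact ((integrable_exp_mul_gaussianReal _).const_mul _).div_const _
  have hcont : Continuous fun p : X × ℝ => g p.1 * Real.exp (S p.1 * p.2 - q p.1) := by fun_prop
  rw [integrable_prod_iff hcont.aestronglyMeasurable]
  refine ⟨.of_forall hsec, ?_⟩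
  have hmgf (x : X) : ∫ w, ‖g x * Real.exp (S x * w - q x)‖ ∂(gaussianReal 0 1) =
      |g x| * Real.exp (S x ^ 2 / 2 - q x) := by
    simp only [norm_mul, Real.norm_eq_abs, Real.abs_exp, integral_gaussian_exp]
  simp only [hmgf]
  exact hμ _ (by fun_prop)

/-- Cameron–Martin formula for the standard Gaussian on the line. -/
lemma integral_gaussian_shift (h : ℝ → ℝ) (c : ℝ) :
    ∫ w, h (w + c) ∂(gaussianReal 0 1) =
      ∫ w, h w * Real.exp (c * w - c ^ 2 / 2) ∂(gaussianReal 0 1) := by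
  rw [integral_gaussianReal_eq_integral_smul one_ne_zero,
    integral_gaussianReal_eq_integral_smul one_ne_zero,
    ← integral_add_right_eq_self (fun w => gaussianPDFReal 0 1 w • (h w * _)) c]
  congr with w
  simp only [gaussianPDFReal, smul_eq_mul, NNReal.coe_one]
  rw [mul_comm (h (w + c)), ← mul_assoc, mul_assoc _ (Real.exp _) (Real.exp _), ← Real.exp_add]
  congr 3
  ring

/-- The numerator of `fIn`. -/
noncomputable def Nfun (P : Measure ℝ) (A B : ℝ) : ℝ :=
  ∫ x, x * Real.exp (B * x - A * x ^ 2 / 2) ∂P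

lemma fIn_eq_Nfun_div_Zfun (P : Measure ℝ) (A B : ℝ) : fIn P A B = Nfun P A B / Zfun P A B := rfl

lemma Nfun_sq_mul_Zfun_pow {P : Measure ℝ} [IsProbabilityMeasure P] (n : ℕ) (A B : ℝ) :
    Nfun P A B ^ 2 * Zfun P A B ^ n = ∫ v, v 0 * v 1 *
      Real.exp (B * ∑ i, v i - A * (∑ i, v i ^ 2) / 2)
        ∂(Measure.pi fun _ : Fin (n + 2) => P) := by
  have h := integral_fintype_prod_eq_prod (𝕜 := ℝ) (μ := fun _ : Fin (n + 2) => P)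
    (Fin.cons (fun x => x * Real.exp (B * x - A * x ^ 2 / 2))
      (Fin.cons (fun x => x * Real.exp (B * x - A * x ^ 2 / 2))
        (fun _ x => Real.exp (B * x - A * x ^ 2 / 2)) : Fin (n + 1) → ℝ → ℝ))
  simp only [Fin.prod_univ_succ, Fin.cons_zero, Fin.cons_succ, Finset.prod_const,
    Finset.card_univ, Fintype.card_fin] at h
  rw [Nfun, Zfun, pow_two, mul_assoc, ← h]
  congr with v
  have : Real.exp (B * ∑ i, v i - A * (∑ i, v i ^ 2) / 2) =
      ∏ i, Real.exp (B * v i - A * v i ^ 2 / 2) := by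
    rw [← Real.exp_sum, Finset.sum_sub_distrib, Finset.mul_sum, Finset.mul_sum, Finset.sum_div]
  rw [this, Fin.prod_univ_succ, Fin.prod_univ_succ]
  simp only [Fin.succ_zero_eq_one]
  ring

lemma integrable_Nfun_sq_mul_Zfun_pow {P : Measure ℝ} [IsProbabilityMeasure P] {K : Set ℝ}
    (hK : IsCompact K) (hPK : ∀ᵐ x ∂P, x ∈ K) (n : ℕ) (A σ : ℝ) :
    Integrable (fun w => Nfun P A (σ * w) ^ 2 * Zfun P A (σ * w) ^ n) (gaussianReal 0 1) := by
  have h := (integrable_prod_gaussian_exp (μ := Measure.pi fun _ : Fin (n + 2) => P)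
    (fun f hf => integrable_pi_of_continuous hK hPK hf) (g := fun v => v 0 * v 1)
    (S := fun v => σ * ∑ i, v i) (q := fun v => A * (∑ i, v i ^ 2) / 2) (by fun_prop)
    (by fun_prop) (by fun_prop)).integral_prod_right
  refine h.congr (.of_forall fun w => ?_)
  simp only [Nfun_sq_mul_Zfun_pow, mul_right_comm σ]

lemma integral_Nfun_sq_mul_Zfun_pow {P : Measure ℝ} [IsProbabilityMeasure P] {K : Set ℝ}
    (hK : IsCompact K) (hPK : ∀ᵐ x ∂P, x ∈ K) (n : ℕ) {y : ℝ} (hy : 0 ≤ y) :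
    ∫ w, Nfun P y (√y * w) ^ 2 * Zfun P y (√y * w) ^ n ∂(gaussianReal 0 1) =
      replicaMean P n y := by
  have h := integrable_prod_gaussian_exp (μ := Measure.pi fun _ : Fin (n + 2) => P)
    (fun f hf => integrable_pi_of_continuous hK hPK hf) (g := fun v => v 0 * v 1)
    (S := fun v => √y * ∑ i, v i) (q := fun v => y * (∑ i, v i ^ 2) / 2) (by fun_prop)
    (by fun_prop) (by fun_prop)
  have hcomm (v : Fin (n + 2) → ℝ) (w : ℝ) : √y * w * ∑ i, v i = √y * (∑ i, v i) * w := by ring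
  simp only [Nfun_sq_mul_Zfun_pow, hcomm]
  rw [← integral_integral_swap h, replicaMean]
  congr with v
  rw [integral_gaussian_exp, mul_pow, Real.sq_sqrt hy, pairSum]
  congr 2
  ring

lemma one_sub_le_Zfun {P : Measure ℝ} [IsProbabilityMeasure P] {K : Set ℝ}
    (hK : IsCompact K) (hPK : ∀ᵐ x ∂P, x ∈ K) (hmean : ∫ x, x ∂P = 0) (A B : ℝ) :
    1 - A / 2 * ∫ x, x ^ 2 ∂P ≤ Zfun P A B := by
  have hint {f : ℝ → ℝ} (hf : Continuous f) : Integrable f P :=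
    integrable_of_continuous_of_ae_mem_compact hK hPK hf
  have := integral_quadratic hK hPK hmean 1 B (-(A / 2))
  rw [show 1 - A / 2 * ∫ x, x ^ 2 ∂P = ∫ x, (1 + B * x + -(A / 2) * x ^ 2) ∂P by rw [this]; ring]
  refine integral_mono (hint (by fun_prop)) (hint (by fun_prop)) fun x => ?_
  have := Real.add_one_le_exp (B * x - A * x ^ 2 / 2)
  dsimp only
  linarith

lemma Zfun_pos {P : Measure ℝ} [IsProbabilityMeasure P] {K : Set ℝ}
    (hK : IsCompact K) (hPK : ∀ᵐ x ∂P, x ∈ K) (A B : ℝ) : 0 < Zfun P A B :=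
  integral_exp_pos (f := fun x => B * x - A * x ^ 2 / 2)
    (integrable_of_continuous_of_ae_mem_compact hK hPK (by fun_prop))

lemma abs_fIn_le {P : Measure ℝ} [IsProbabilityMeasure P] {K : Set ℝ} (hK : IsCompact K)
    (hPK : ∀ᵐ x ∂P, x ∈ K) {R : ℝ} (hR : ∀ x ∈ K, |x| ≤ R) (A B : ℝ) : |fIn P A B| ≤ R := by
  have hZ := Zfun_pos hK hPK A B
  rw [fIn, abs_div, abs_of_pos hZ, div_le_iff₀ hZ, Zfun, ← integral_const_mul,
    ← Real.norm_eq_abs]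
  refine norm_integral_le_of_norm_le
    (integrable_of_continuous_of_ae_mem_compact hK hPK (by fun_prop)) ?_
  filter_upwards [hPK] with x hx
  rw [norm_mul, Real.norm_eq_abs, Real.norm_eq_abs, Real.abs_exp]
  exact mul_le_mul_of_nonneg_right (hR x hx) (Real.exp_pos _).le

lemma measurable_Zfun {P : Measure ℝ} [IsProbabilityMeasure P] (A : ℝ) :
    Measurable (Zfun P A) :=
  (StronglyMeasurable.integral_prod_right (f := fun B x => Real.exp (B * x - A * x ^ 2 / 2))
    (Continuous.stronglyMeasurable (by fun_prop))).measurable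

lemma measurable_fIn {P : Measure ℝ} [IsProbabilityMeasure P] (A : ℝ) :
    Measurable (fIn P A) := by
  have hN : StronglyMeasurable fun B => ∫ x, x * Real.exp (B * x - A * x ^ 2 / 2) ∂P :=
    StronglyMeasurable.integral_prod_right
      (f := fun B x => x * Real.exp (B * x - A * x ^ 2 / 2))
      (Continuous.stronglyMeasurable (by fun_prop))
  exact hN.measurable.div (measurable_Zfun A)

/-- The Nishimori identity: the overlap is the second moment of the posterior mean, written under
the law in which the observation is pure noise. -/
lemma Fse_eq_integral_sq_div {P : Measure ℝ} [IsProbabilityMeasure P] {K : Set ℝ}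
    (hK : IsCompact K) (hPK : ∀ᵐ x ∂P, x ∈ K) {y : ℝ} (hy : 0 ≤ y) :
    Fse P y = ∫ w, Nfun P y (√y * w) ^ 2 / Zfun P y (√y * w) ∂(gaussianReal 0 1) := by
  obtain ⟨R, hR⟩ := hK.exists_bound_of_continuousOn (f := fun x : ℝ => x) (by fun_prop)
  have hshift (x : ℝ) : ∫ w, x * fIn P y (y * x + √y * w) ∂(gaussianReal 0 1) =
      ∫ w, fIn P y (√y * w) * (x * Real.exp (√y * x * w - y * x ^ 2 / 2))
        ∂(gaussianReal 0 1) := by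
    have h := integral_gaussian_shift (fun w => x * fIn P y (√y * w)) (√y * x)
    have harg (w : ℝ) : √y * (w + √y * x) = y * x + √y * w := by
      linear_combination x * Real.mul_self_sqrt hy
    simp only [harg, mul_pow, Real.sq_sqrt hy] at h
    rw [h]
    congr with w
    ring
  have hint : Integrable (fun p : ℝ × ℝ => fIn P y (√y * p.2) *
      (p.1 * Real.exp (√y * p.1 * p.2 - y * p.1 ^ 2 / 2))) (P.prod (gaussianReal 0 1)) := by
    refine Integrable.bdd_mul (c := R)
      (integrable_prod_gaussian_exp (g := fun x => x) (S := fun x => √y * x)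
        (q := fun x => y * x ^ 2 / 2)
        (fun f hf => integrable_of_continuous_of_ae_mem_compact hK hPK hf)
        (by fun_prop) (by fun_prop) (by fun_prop)) ?_ ?_
    · exact ((measurable_fIn y).comp (by fun_prop)).aestronglyMeasurable
    · exact .of_forall fun p => abs_fIn_le hK hPK hR _ _
  simp only [Fse, hshift]
  rw [integral_integral_swap hint]
  congr with w
  rw [integral_const_mul]
  simp only [mul_right_comm (√y)]
  rw [← Nfun, fIn_eq_Nfun_div_Zfun]
  ring

lemma Fse_bounds {P : Measure ℝ} [IsProbabilityMeasure P] {K : Set ℝ}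
    (hK : IsCompact K) (hPK : ∀ᵐ x ∂P, x ∈ K) (hmean : ∫ x, x ∂P = 0) {y : ℝ} (hy : 0 ≤ y)
    (hym : y * ∫ x, x ^ 2 ∂P ≤ 1) :
    2 * replicaMean P 0 y - replicaMean P 1 y ≤ Fse P y ∧
      Fse P y ≤ 2 * replicaMean P 0 y - replicaMean P 1 y +
        2 * (replicaMean P 0 y - 2 * replicaMean P 1 y + replicaMean P 2 y) := by
  have hi (n : ℕ) := integrable_Nfun_sq_mul_Zfun_pow hK hPK n y (√y)
  have hI (n : ℕ) := integral_Nfun_sq_mul_Zfun_pow hK hPK n hy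
  have hpos (w : ℝ) := Zfun_pos hK hPK y (√y * w)
  have hhalf (w : ℝ) : 1 / 2 ≤ Zfun P y (√y * w) := by
    have := one_sub_le_Zfun hK hPK hmean y (√y * w)
    linarith
  have hlow (w : ℝ) : 2 * (Nfun P y (√y * w) ^ 2 * Zfun P y (√y * w) ^ 0) -
      Nfun P y (√y * w) ^ 2 * Zfun P y (√y * w) ^ 1 ≤
        Nfun P y (√y * w) ^ 2 / Zfun P y (√y * w) := by
    rw [le_div_iff₀ (hpos w)]
    nlinarith [sq_nonneg (Nfun P y (√y * w) * (Zfun P y (√y * w) - 1))]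
  have hupp (w : ℝ) : Nfun P y (√y * w) ^ 2 / Zfun P y (√y * w) ≤
      2 * (Nfun P y (√y * w) ^ 2 * Zfun P y (√y * w) ^ 0) -
        Nfun P y (√y * w) ^ 2 * Zfun P y (√y * w) ^ 1 +
      2 * (Nfun P y (√y * w) ^ 2 * Zfun P y (√y * w) ^ 0 -
        2 * (Nfun P y (√y * w) ^ 2 * Zfun P y (√y * w) ^ 1) +
        Nfun P y (√y * w) ^ 2 * Zfun P y (√y * w) ^ 2) := by
    rw [div_le_iff₀ (hpos w)]
    nlinarith [mul_nonneg (sq_nonneg (Nfun P y (√y * w) * (Zfun P y (√y * w) - 1)))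
      (sub_nonneg.2 (hhalf w))]
  have hint : Integrable (fun w => Nfun P y (√y * w) ^ 2 / Zfun P y (√y * w))
      (gaussianReal 0 1) := by
    have hmeas : AEStronglyMeasurable (fun w => Nfun P y (√y * w) ^ 2 / Zfun P y (√y * w))
        (gaussianReal 0 1) := by
      have hf : Measurable fun w => fIn P y (√y * w) := (measurable_fIn y).comp (by fun_prop)
      have hZ : Measurable fun w => Zfun P y (√y * w) := (measurable_Zfun y).comp (by fun_prop)
      refine ((hf.pow_const 2).mul hZ).aestronglyMeasurable.congr (.of_forall fun w => ?_)
      have := (hpos w).ne'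
      simp only [Pi.mul_apply, fIn_eq_Nfun_div_Zfun]
      field_simp
    refine Integrable.mono' ((hi 0).const_mul 2) hmeas (.of_forall fun w => ?_)
    rw [Real.norm_of_nonneg (div_nonneg (sq_nonneg _) (hpos w).le), div_le_iff₀ (hpos w)]
    nlinarith [mul_nonneg (sq_nonneg (Nfun P y (√y * w))) (sub_nonneg.2 (hhalf w))]
  have h01 : Integrable (fun w => 2 * (Nfun P y (√y * w) ^ 2 * Zfun P y (√y * w) ^ 0) -
      Nfun P y (√y * w) ^ 2 * Zfun P y (√y * w) ^ 1) (gaussianReal 0 1) :=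
    ((hi 0).const_mul 2).sub (hi 1)
  have h01' : Integrable (fun w => Nfun P y (√y * w) ^ 2 * Zfun P y (√y * w) ^ 0 -
      2 * (Nfun P y (√y * w) ^ 2 * Zfun P y (√y * w) ^ 1)) (gaussianReal 0 1) :=
    (hi 0).sub ((hi 1).const_mul 2)
  have h012 : Integrable (fun w => 2 * (Nfun P y (√y * w) ^ 2 * Zfun P y (√y * w) ^ 0 -
      2 * (Nfun P y (√y * w) ^ 2 * Zfun P y (√y * w) ^ 1) +
      Nfun P y (√y * w) ^ 2 * Zfun P y (√y * w) ^ 2)) (gaussianReal 0 1) :=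
    (h01'.add (hi 2)).const_mul 2
  rw [Fse_eq_integral_sq_div hK hPK hy]
  constructor
  · refine le_of_eq_of_le ?_ (integral_mono h01 hint hlow)
    rw [integral_sub ((hi 0).const_mul 2) (hi 1), integral_const_mul, hI, hI]
  · refine (integral_mono hint (h01.add h012) hupp).trans_eq ?_
    rw [integral_add' h01 h012, integral_sub ((hi 0).const_mul 2) (hi 1), integral_const_mul,
      integral_const_mul, integral_add h01' (hi 2),
      integral_sub (hi 0) ((hi 1).const_mul 2), integral_const_mul, hI, hI, hI]

/-- **Second-order expansion of the rank-one Bayes-optimal state-evolution map around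
the uniform fixed point**: if the compactly supported prior `P` has zero mean, then
`F(y) = m₂² y − (m₂³ − m₃²/2) y² + o(y²)` as `y → 0⁺`, where `m₂, m₃` are the second
and third moments of `P`. -/
theorem state_evolution_second_order_expansion
    (P : Measure ℝ) [IsProbabilityMeasure P]
    (K : Set ℝ) (hK : IsCompact K) (hPK : P Kᶜ = 0)
    (hmean : ∫ x, x ∂P = 0) :
    Tendsto (fun y => (Fse P y - (∫ x, x ^ 2 ∂P) ^ 2 * y) / y ^ 2)
      (nhdsWithin 0 (Set.Ioi 0))
      (nhds (-((∫ x, x ^ 2 ∂P) ^ 3 - (∫ x, x ^ 3 ∂P) ^ 2 / 2))) := by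
  have hae : ∀ᵐ x ∂P, x ∈ K := hPK
  have h0 := tendsto_replicaMean hK hae hmean 0
  have h1 := tendsto_replicaMean hK hae hmean 1
  have h2 := tendsto_replicaMean hK hae hmean 2
  set m₂ := ∫ x, x ^ 2 ∂P
  set m₃ := ∫ x, x ^ 3 ∂P
  have hlow := (h0.const_mul 2).sub h1
  have hupp := hlow.add (((h0.sub (h1.const_mul 2)).add h2).const_mul 2)
  have hsmall : ∀ᶠ y : ℝ in nhdsWithin 0 (Set.Ioi 0), y * m₂ < 1 := by
    refine Filter.Eventually.filter_mono nhdsWithin_le_nhds ?_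
    exact (Continuous.tendsto' (f := fun y : ℝ => y * m₂) (by fun_prop) 0 0
      (by simp)).eventually_lt_const one_pos
  refine tendsto_of_tendsto_of_tendsto_of_le_of_le' (hlow.trans_eq ?_) (hupp.trans_eq ?_) ?_ ?_
  · congr 1; push_cast; ring
  · congr 1; push_cast; ring
  · filter_upwards [hsmall, self_mem_nhdsWithin] with y hym hy
    have hy : 0 < y := hy
    have := (Fse_bounds hK hae hmean hy.le hym.le).1
    rw [← mul_div_assoc, ← sub_div]
    refine div_le_div_of_nonneg_right ?_ (sq_nonneg y)
    linarith
  · filter_upwards [hsmall, self_mem_nhdsWithin] with y hym hy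
    have hy : 0 < y := hy
    have := (Fse_bounds hK hae hmean hy.le hym.le).2
    simp only [← mul_div_assoc, ← sub_div, ← add_div]
    refine div_le_div_of_nonneg_right ?_ (sq_nonneg y)
    linarith
end

section
/- Small-density limit of the Bernoulli state-evolution function: for every β > 0 with β ≠ 2, lim_{ρ→0⁺} f_ρ( −β·log ρ ) / ρ = 1 if β > 2 and = 0 if β < 2. -/
open MeasureTheory ProbabilityTheory Filter

/-- The Bernoulli state-evolution function
`f_ρ(x) = ρ · E_W[ ρ / (ρ + (1−ρ)·exp(−x/2 + W·√x)) ]`. -/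
noncomputable def fBer (ρ x : ℝ) : ℝ :=
  ρ * ∫ w, ρ / (ρ + (1 - ρ) * Real.exp (-x / 2 + w * Real.sqrt x)) ∂(gaussianReal 0 1)

/-- On the scale `x = -β log ρ`, the integrand of `fBer` is a logistic function of an exponent
that is quadratic in `√x`. -/
lemma bernoulli_integrand_eq {β ρ : ℝ} (hβ : 0 < β) (hρ : ρ ∈ Set.Ioo (0 : ℝ) 1) (w : ℝ) :
    ρ / (ρ + (1 - ρ) * Real.exp (-(-β * Real.log ρ) / 2 + w * √(-β * Real.log ρ))) =
      (1 + (1 - ρ) * Real.exp (√(-β * Real.log ρ) *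
        (√(-β * Real.log ρ) * (1 / β - 1 / 2) + w)))⁻¹ := by
  have hlog : Real.log ρ < 0 := Real.log_neg hρ.1 hρ.2
  have hsq : √(-β * Real.log ρ) * √(-β * Real.log ρ) = -β * Real.log ρ :=
    Real.mul_self_sqrt (by nlinarith)
  have hexp : -(-β * Real.log ρ) / 2 + w * √(-β * Real.log ρ) =
      Real.log ρ + √(-β * Real.log ρ) * (√(-β * Real.log ρ) * (1 / β - 1 / 2) + w) := by
    rw [mul_add, ← mul_assoc, hsq]
    field_simp
    ring
  rw [hexp, Real.exp_add, Real.exp_log hρ.1]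
  have h1 : 0 < 1 - ρ := sub_pos.2 hρ.2
  have h0 := hρ.1
  field_simp

lemma tendsto_sqrt_neg_mul_log {β : ℝ} (hβ : 0 < β) :
    Tendsto (fun ρ => √(-β * Real.log ρ)) (nhdsWithin 0 (Set.Ioo 0 1)) atTop := by
  have hlog : Tendsto Real.log (nhdsWithin 0 (Set.Ioo 0 1)) atBot :=
    Real.tendsto_log_nhdsGT_zero.mono_left (nhdsWithin_mono _ fun _ h => h.1)
  exact Real.tendsto_sqrt_atTop.comp (hlog.const_mul_atBot_of_neg (neg_lt_zero.2 hβ))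

/-- Dominated convergence for the posterior mean: a pointwise limit of the integrand that does not
depend on `w` is the limit of `fBer ρ (-β log ρ) / ρ`. -/
lemma tendsto_fBer_div {β c : ℝ} (hβ : 0 < β)
    (hlim : ∀ w : ℝ, Tendsto (fun ρ : ℝ => (1 + (1 - ρ) * Real.exp (√(-β * Real.log ρ) *
        (√(-β * Real.log ρ) * (1 / β - 1 / 2) + w)))⁻¹)
      (nhdsWithin 0 (Set.Ioo 0 1)) (nhds c)) :
    Tendsto (fun ρ => fBer ρ (-β * Real.log ρ) / ρ)
      (nhdsWithin 0 (Set.Ioo 0 1)) (nhds c) := by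
  have hmain : Tendsto (fun ρ : ℝ => ∫ w, (1 + (1 - ρ) * Real.exp (√(-β * Real.log ρ) *
        (√(-β * Real.log ρ) * (1 / β - 1 / 2) + w)))⁻¹ ∂(gaussianReal 0 1))
      (nhdsWithin 0 (Set.Ioo 0 1)) (nhds (∫ _, c ∂(gaussianReal 0 1))) := by
    refine tendsto_integral_filter_of_dominated_convergence (fun _ => 1) ?_ ?_
      (integrable_const _) (ae_of_all _ hlim)
    · exact Eventually.of_forall fun ρ => (by fun_prop : Measurable _).aestronglyMeasurable
    · filter_upwards [self_mem_nhdsWithin] with ρ hρ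
      refine ae_of_all _ fun w => ?_
      have hnn : 0 ≤ (1 - ρ) * Real.exp (√(-β * Real.log ρ) *
          (√(-β * Real.log ρ) * (1 / β - 1 / 2) + w)) :=
        mul_nonneg (sub_nonneg.2 hρ.2.le) (Real.exp_pos _).le
      rw [Real.norm_of_nonneg (by positivity)]
      exact inv_le_one_of_one_le₀ (by linarith)
  rw [integral_const, probReal_univ, one_smul] at hmain
  refine hmain.congr' ?_
  filter_upwards [self_mem_nhdsWithin] with ρ hρ
  rw [fBer, mul_div_cancel_left₀ _ hρ.1.ne']
  exact integral_congr_ae (ae_of_all _ fun w => (bernoulli_integrand_eq hβ hρ w).symm)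

/-- **Small-density limit of the Bernoulli state-evolution function**: for `β > 0`,
`lim_{ρ→0⁺} f_ρ(−β·log ρ)/ρ = 1` if `β > 2` and `= 0` if `β < 2`. -/
theorem bernoulli_small_density_limit (β : ℝ) (hβ : 0 < β) :
    (2 < β → Tendsto (fun ρ => fBer ρ (-β * Real.log ρ) / ρ)
        (nhdsWithin 0 (Set.Ioo 0 1)) (nhds 1)) ∧
    (β < 2 → Tendsto (fun ρ => fBer ρ (-β * Real.log ρ) / ρ)
        (nhdsWithin 0 (Set.Ioo 0 1)) (nhds 0)) := by
  have hs := tendsto_sqrt_neg_mul_log hβ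
  have hone : Tendsto (fun ρ : ℝ => 1 - ρ) (nhdsWithin 0 (Set.Ioo 0 1)) (nhds 1) := by
    have h : Tendsto (fun ρ : ℝ => 1 - ρ) (nhds 0) (nhds (1 - 0)) :=
      (continuous_const.sub continuous_id).tendsto 0
    rw [sub_zero] at h
    exact h.mono_left nhdsWithin_le_nhds
  constructor
  · intro h
    refine tendsto_fBer_div hβ fun w => ?_
    have hneg : 1 / β - 1 / 2 < 0 := sub_neg.2 (one_div_lt_one_div_of_lt two_pos h)
    have hexp := Real.tendsto_exp_atBot.comp
      (hs.atTop_mul_atBot₀ (tendsto_atBot_add_const_right _ w (hs.atTop_mul_const_of_neg hneg)))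
    simpa using ((hone.mul hexp).const_add 1).inv₀ (by norm_num)
  · intro h
    refine tendsto_fBer_div hβ fun w => ?_
    have hpos : 0 < 1 / β - 1 / 2 := sub_pos.2 (one_div_lt_one_div_of_lt hβ h)
    have hexp := Real.tendsto_exp_atTop.comp
      (hs.atTop_mul_atTop₀ (tendsto_atTop_add_const_right _ w (hs.atTop_mul_const hpos)))
    exact (tendsto_atTop_add_const_left _ 1
      (hone.pos_mul_atTop one_pos hexp)).inv_tendsto_atTop
end

section
/- Small-density limit of the Rademacher–Bernoulli state-evolution function: for every β > 0 with β ≠ 2, lim_{ρ→0⁺} f_ρ( −β·log ρ ) / ρ = 1 if β > 2 and = 0 if β < 2. -/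
open MeasureTheory ProbabilityTheory Filter

/-- The Rademacher–Bernoulli state-evolution function
`f_ρ(x) = ρ · E_W[ tanh(x + W·√x) · ρ / ((1−ρ)·exp(x/2)/cosh(x + W·√x) + ρ) ]`. -/
noncomputable def fRB (ρ x : ℝ) : ℝ :=
  ρ * ∫ w, Real.tanh (x + w * Real.sqrt x) * ρ /
      ((1 - ρ) * Real.exp (x / 2) / Real.cosh (x + w * Real.sqrt x) + ρ)
    ∂(gaussianReal 0 1)

theorem Real.tendsto_tanh_atTop : Tendsto Real.tanh atTop (nhds 1) := by
  have h : ∀ y : ℝ, Real.tanh y = 1 - Real.exp (-y) / Real.cosh y := fun y => by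
    have hc := (Real.cosh_pos y).ne'
    rw [Real.tanh_eq_sinh_div_cosh, ← Real.cosh_sub_sinh]
    field_simp
    ring
  have h0 : Tendsto (fun y : ℝ => Real.exp (-y) / Real.cosh y) atTop (nhds 0) := by
    refine squeeze_zero (fun y => ?_) (fun y => ?_) Real.tendsto_exp_neg_atTop_nhds_zero
    · have := Real.cosh_pos y
      positivity
    · exact div_le_self (Real.exp_pos _).le (Real.one_le_cosh y)
  simpa [← h] using h0.const_sub 1

theorem tendsto_mul_sq_add_mul_atTop {c : ℝ} (hc : 0 < c) (b : ℝ) :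
    Tendsto (fun s : ℝ => c * s ^ 2 + b * s) atTop atTop := by
  have h : Tendsto (fun s : ℝ => s * (c * s + b)) atTop atTop :=
    tendsto_id.atTop_mul_atTop₀
      (tendsto_atTop_add_const_right _ b (tendsto_id.const_mul_atTop hc))
  exact h.congr fun s => by ring

theorem tendsto_neg_mul_log_nhdsWithin_Ioo {β : ℝ} (hβ : 0 < β) :
    Tendsto (fun ρ => -β * Real.log ρ) (nhdsWithin 0 (Set.Ioo 0 1)) atTop := by
  have h : Tendsto Real.log (nhdsWithin 0 (Set.Ioo 0 1)) atBot :=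
    Real.tendsto_log_nhdsGT_zero.mono_left (nhdsWithin_mono _ fun _ hx => hx.1)
  exact h.const_mul_atBot_of_neg (by linarith)

theorem Real.cosh_le_exp {y : ℝ} (hy : 0 ≤ y) : Real.cosh y ≤ Real.exp y := by
  have : Real.exp (-y) ≤ Real.exp y := Real.exp_le_exp.2 (by linarith)
  rw [Real.cosh_eq]
  linarith

theorem Real.exp_le_two_mul_cosh (y : ℝ) : Real.exp y ≤ 2 * Real.cosh y := by
  have := Real.exp_pos (-y)
  rw [Real.cosh_eq]
  linarith

/-- The integrand of `fRB` is `tanh y / (1 + r)`, with `r` the ratio of the two terms of the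
denominator; the limit of `(1 + r)⁻¹` determines that of `fRB ρ x / ρ`. -/
theorem tendsto_fRB_div {β ℓ : ℝ} (hβ : 0 < β)
    (h : ∀ w : ℝ, Tendsto (fun ρ => (1 + (1 - ρ) * Real.exp (-β * Real.log ρ / 2) /
        Real.cosh (-β * Real.log ρ + w * Real.sqrt (-β * Real.log ρ)) / ρ)⁻¹)
      (nhdsWithin 0 (Set.Ioo 0 1)) (nhds ℓ)) :
    Tendsto (fun ρ => fRB ρ (-β * Real.log ρ) / ρ) (nhdsWithin 0 (Set.Ioo 0 1)) (nhds ℓ) := by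
  have hmem : ∀ᶠ ρ : ℝ in nhdsWithin 0 (Set.Ioo 0 1), ρ ∈ Set.Ioo (0 : ℝ) 1 :=
    self_mem_nhdsWithin
  have hx := tendsto_neg_mul_log_nhdsWithin_Ioo hβ
  have key : Tendsto (fun ρ => ∫ w,
      Real.tanh (-β * Real.log ρ + w * Real.sqrt (-β * Real.log ρ)) *
        (1 + (1 - ρ) * Real.exp (-β * Real.log ρ / 2) /
          Real.cosh (-β * Real.log ρ + w * Real.sqrt (-β * Real.log ρ)) / ρ)⁻¹
        ∂(gaussianReal 0 1)) (nhdsWithin 0 (Set.Ioo 0 1))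
      (nhds (∫ _, ℓ ∂(gaussianReal 0 1))) := by
    refine tendsto_integral_filter_of_dominated_convergence (fun _ => 1) ?_ ?_
      (integrable_const _) ?_
    · refine Eventually.of_forall fun ρ => Measurable.aestronglyMeasurable ?_
      simp only [Real.tanh_eq_sinh_div_cosh]
      fun_prop
    · filter_upwards [hmem] with ρ hρ
      refine Eventually.of_forall fun w => ?_
      set y := -β * Real.log ρ + w * Real.sqrt (-β * Real.log ρ)
      have hq : 0 ≤ (1 - ρ) * Real.exp (-β * Real.log ρ / 2) / Real.cosh y / ρ :=
        div_nonneg (div_nonneg (mul_nonneg (by linarith [hρ.2]) (Real.exp_pos _).le)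
          (Real.cosh_pos y).le) hρ.1.le
      rw [norm_mul, Real.norm_eq_abs, Real.norm_eq_abs,
        abs_of_nonneg (inv_nonneg.2 (add_nonneg zero_le_one hq))]
      exact mul_le_one₀ (Real.abs_tanh_lt_one y).le (inv_nonneg.2 (add_nonneg zero_le_one hq))
        (inv_le_one_of_one_le₀ (le_add_of_nonneg_right hq))
    · refine Eventually.of_forall fun w => ?_
      have hy : Tendsto (fun ρ => -β * Real.log ρ + w * Real.sqrt (-β * Real.log ρ))
          (nhdsWithin 0 (Set.Ioo 0 1)) atTop := by
        refine ((tendsto_mul_sq_add_mul_atTop one_pos w).comp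
          (Real.tendsto_sqrt_atTop.comp hx)).congr' ?_
        filter_upwards [hx.eventually_ge_atTop 0] with ρ hρ
        simp only [Function.comp_apply, one_mul, Real.sq_sqrt hρ]
      simpa using (Real.tendsto_tanh_atTop.comp hy).mul (h w)
  simp only [integral_const, probReal_univ, one_smul] at key
  refine key.congr' ?_
  filter_upwards [hmem] with ρ hρ
  have hρ0 := hρ.1.ne'
  rw [fRB, mul_div_cancel_left₀ _ hρ0]
  refine integral_congr_ae (Eventually.of_forall fun w => ?_)
  simp only
  rw [one_add_div hρ0, inv_div, add_comm ρ, ← mul_div_assoc]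

theorem exp_half_div_eq {β ρ : ℝ} (hβ : 0 < β) (hρ : ρ ∈ Set.Ioo (0 : ℝ) 1) (w : ℝ) :
    Real.exp (-β * Real.log ρ / 2) / ρ =
      Real.exp ((1 / β - 1 / 2) * Real.sqrt (-β * Real.log ρ) ^ 2 +
          -w * Real.sqrt (-β * Real.log ρ)) *
        Real.exp (-β * Real.log ρ + w * Real.sqrt (-β * Real.log ρ)) := by
  have hx : 0 ≤ -β * Real.log ρ := by nlinarith [Real.log_neg hρ.1 hρ.2]
  nth_rewrite 2 [← Real.exp_log hρ.1]
  rw [← Real.exp_sub, ← Real.exp_add, Real.sq_sqrt hx]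
  congr 1
  field_simp
  ring

/-- **Small-density limit of the Rademacher–Bernoulli state-evolution function**: for
`β > 0`, `lim_{ρ→0⁺} f_ρ(−β·log ρ)/ρ = 1` if `β > 2` and `= 0` if `β < 2`. -/
theorem rademacher_bernoulli_small_density_limit (β : ℝ) (hβ : 0 < β) :
    (2 < β → Tendsto (fun ρ => fRB ρ (-β * Real.log ρ) / ρ)
        (nhdsWithin 0 (Set.Ioo 0 1)) (nhds 1)) ∧
    (β < 2 → Tendsto (fun ρ => fRB ρ (-β * Real.log ρ) / ρ)
        (nhdsWithin 0 (Set.Ioo 0 1)) (nhds 0)) := by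
  have hmem : ∀ᶠ ρ : ℝ in nhdsWithin 0 (Set.Ioo 0 1), ρ ∈ Set.Ioo (0 : ℝ) 1 :=
    self_mem_nhdsWithin
  have hx := tendsto_neg_mul_log_nhdsWithin_Ioo hβ
  have hs := Real.tendsto_sqrt_atTop.comp hx
  refine ⟨fun h2 => tendsto_fRB_div hβ fun w => ?_, fun h2 => tendsto_fRB_div hβ fun w => ?_⟩
  · have hc : 0 < 1 / 2 - 1 / β := sub_pos.2 (one_div_lt_one_div_of_lt two_pos h2)
    have hlim := ((Real.tendsto_exp_neg_atTop_nhds_zero.comp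
      (tendsto_mul_sq_add_mul_atTop hc w)).comp hs).const_mul 2
    rw [mul_zero] at hlim
    have hq : Tendsto (fun ρ => (1 - ρ) * Real.exp (-β * Real.log ρ / 2) /
        Real.cosh (-β * Real.log ρ + w * Real.sqrt (-β * Real.log ρ)) / ρ)
        (nhdsWithin 0 (Set.Ioo 0 1)) (nhds 0) := by
      refine squeeze_zero' ?_ ?_ hlim
      · filter_upwards [hmem] with ρ hρ
        exact div_nonneg (div_nonneg (mul_nonneg (by linarith [hρ.2]) (Real.exp_pos _).le)
          (Real.cosh_pos _).le) hρ.1.le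
      · filter_upwards [hmem] with ρ hρ
        rw [div_right_comm, mul_div_assoc, exp_half_div_eq hβ hρ w, div_le_iff₀ (Real.cosh_pos _)]
        simp only [Function.comp_apply]
        have he : (1 / β - 1 / 2) * Real.sqrt (-β * Real.log ρ) ^ 2 +
            -w * Real.sqrt (-β * Real.log ρ) = -((1 / 2 - 1 / β) *
            Real.sqrt (-β * Real.log ρ) ^ 2 + w * Real.sqrt (-β * Real.log ρ)) := by ring
        rw [he]
        set y := -β * Real.log ρ + w * Real.sqrt (-β * Real.log ρ)
        set E := Real.exp (-((1 / 2 - 1 / β) *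
            Real.sqrt (-β * Real.log ρ) ^ 2 + w * Real.sqrt (-β * Real.log ρ)))
        have hE : 0 < E := Real.exp_pos _
        calc (1 - ρ) * (E * Real.exp y) ≤ 1 * (E * Real.exp y) := by
              gcongr
              linarith [hρ.1]
          _ ≤ 1 * (E * (2 * Real.cosh y)) := by
              gcongr
              exact Real.exp_le_two_mul_cosh y
          _ = 2 * E * Real.cosh y := by ring
    simpa using (hq.const_add 1).inv₀ (by norm_num)
  · have hc : 0 < 1 / β - 1 / 2 := sub_pos.2 (one_div_lt_one_div_of_lt hβ h2)
    have hlim := ((Real.tendsto_exp_atTop.comp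
      (tendsto_mul_sq_add_mul_atTop hc (-w))).comp hs).const_mul_atTop (one_half_pos (α := ℝ))
    have hy := (tendsto_mul_sq_add_mul_atTop one_pos w).comp hs
    have hhalf : ∀ᶠ ρ : ℝ in nhdsWithin 0 (Set.Ioo 0 1), ρ < 1 / 2 :=
      nhdsWithin_le_nhds (Iio_mem_nhds (by norm_num))
    refine tendsto_inv_atTop_zero.comp (tendsto_atTop_add_const_left _ 1
      (tendsto_atTop_mono' _ ?_ hlim))
    filter_upwards [hmem, hhalf, hx.eventually_ge_atTop 0, hy.eventually_ge_atTop 0]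
      with ρ hρ hρ2 hx0 hy0
    simp only [Function.comp_apply, one_mul, Real.sq_sqrt hx0] at hy0
    rw [div_right_comm, mul_div_assoc, exp_half_div_eq hβ hρ w, le_div_iff₀ (Real.cosh_pos _)]
    simp only [Function.comp_apply]
    rw [mul_assoc]
    gcongr
    · linarith
    · linarith
    · exact Real.cosh_le_exp hy0
end

section
/- Small-density limit of the Gauss–Bernoulli state-evolution function: for every β > 0, lim_{ρ→0⁺} f_ρ( −β·log ρ ) / ρ = (2/√(πβ))·exp(−1/β) + erfc(1/√β), where erfc(t) = (2/√π) ∫_t^∞ exp(−s²) ds. -/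
open MeasureTheory ProbabilityTheory Filter

/-- The Gauss–Bernoulli state-evolution function
`f_ρ(x) = ρ · (x/(1+x)) · E_W[ W² · ρ / ((1−ρ)·√(1+x)·exp(−x·W²/2) + ρ) ]`. -/
noncomputable def fGB (ρ x : ℝ) : ℝ :=
  ρ * (x / (1 + x)) *
    ∫ w, w ^ 2 * ρ /
        ((1 - ρ) * Real.sqrt (1 + x) * Real.exp (-x * w ^ 2 / 2) + ρ)
      ∂(gaussianReal 0 1)

/-- The complementary error function `erfc(t) = (2/√π) ∫_t^∞ exp(−s²) ds`. -/
noncomputable def erfc (t : ℝ) : ℝ :=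
  (2 / Real.sqrt Real.pi) * ∫ s in Set.Ioi t, Real.exp (-s ^ 2)

open Topology in
/-- Pointwise limit of the integrand, in the variable `t = -log ρ`, below the threshold. -/
theorem tendsto_integrand_of_lt {β w : ℝ} (hβ : 0 < β) (hw : β * w ^ 2 < 2) :
    Tendsto (fun t : ℝ => w ^ 2 * Real.exp (-t) / ((1 - Real.exp (-t)) * Real.sqrt (1 + β * t) *
      Real.exp (-(β * t) * w ^ 2 / 2) + Real.exp (-t))) atTop (𝓝 0) := by
  have hexp : Tendsto (fun t : ℝ => 2 * w ^ 2 * Real.exp (-((1 - β * w ^ 2 / 2) * t))) atTop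
      (𝓝 0) := by
    have h : Tendsto (fun t : ℝ => (1 - β * w ^ 2 / 2) * t) atTop atTop :=
      tendsto_id.const_mul_atTop (by linarith)
    simpa using (Real.tendsto_exp_neg_atTop_nhds_zero.comp h).const_mul (2 * w ^ 2)
  have hsmall : ∀ᶠ t : ℝ in atTop, Real.exp (-t) < 1 / 2 :=
    Real.tendsto_exp_neg_atTop_nhds_zero.eventually_lt_const (by norm_num)
  refine tendsto_of_tendsto_of_tendsto_of_le_of_le' tendsto_const_nhds hexp ?_ ?_
  · filter_upwards [hsmall] with t ht
    have h : 0 ≤ 1 - Real.exp (-t) := by linarith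
    positivity
  · filter_upwards [hsmall, eventually_ge_atTop 0] with t ht ht0
    have hs : 1 ≤ Real.sqrt (1 + β * t) := Real.one_le_sqrt.2 (by nlinarith [mul_nonneg hβ.le ht0])
    have hsplit : Real.exp (-t) =
        Real.exp (-((1 - β * w ^ 2 / 2) * t)) * Real.exp (-(β * t) * w ^ 2 / 2) := by
      rw [← Real.exp_add]; ring_nf
    have hden : 1 / 2 * Real.exp (-(β * t) * w ^ 2 / 2) ≤ (1 - Real.exp (-t)) *
        Real.sqrt (1 + β * t) * Real.exp (-(β * t) * w ^ 2 / 2) + Real.exp (-t) := by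
      have h : 1 / 2 ≤ (1 - Real.exp (-t)) * Real.sqrt (1 + β * t) := by nlinarith
      nlinarith [mul_le_mul_of_nonneg_right h (Real.exp_pos (-(β * t) * w ^ 2 / 2)).le,
        Real.exp_pos (-t)]
    calc _ ≤ w ^ 2 * Real.exp (-t) / (1 / 2 * Real.exp (-(β * t) * w ^ 2 / 2)) := by gcongr
      _ = _ := by
        nth_rewrite 1 [hsplit]
        field_simp

open Topology in
/-- Pointwise limit of the integrand, in the variable `t = -log ρ`, above the threshold. -/
theorem tendsto_integrand_of_gt {β w : ℝ} (hβ : 0 < β) (hw : 2 < β * w ^ 2) :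
    Tendsto (fun t : ℝ => w ^ 2 * Real.exp (-t) / ((1 - Real.exp (-t)) * Real.sqrt (1 + β * t) *
      Real.exp (-(β * t) * w ^ 2 / 2) + Real.exp (-t))) atTop (𝓝 (w ^ 2)) := by
  set c := β * w ^ 2 / 2 - 1 with hc
  have hc0 : 0 < c := by linarith
  have hbound : Tendsto (fun t : ℝ => (1 + β * t) * Real.exp (-(c * t))) atTop (𝓝 0) := by
    have h : Tendsto (fun t : ℝ => c * t) atTop atTop := tendsto_id.const_mul_atTop hc0
    have h0 := Real.tendsto_exp_neg_atTop_nhds_zero.comp h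
    have h1 := ((Real.tendsto_pow_mul_exp_neg_atTop_nhds_zero 1).comp h).const_mul (β / c)
    have h2 := h0.add h1
    simp only [mul_zero, add_zero] at h2
    refine h2.congr fun t => ?_
    simp only [Function.comp_apply, pow_one]
    field_simp
  have hratio : Tendsto (fun t : ℝ => (1 - Real.exp (-t)) * Real.sqrt (1 + β * t) *
      Real.exp (-(c * t))) atTop (𝓝 0) := by
    refine tendsto_of_tendsto_of_tendsto_of_le_of_le' tendsto_const_nhds hbound ?_ ?_
    · filter_upwards [eventually_ge_atTop 0] with t ht
      have h : 0 ≤ 1 - Real.exp (-t) := sub_nonneg.2 (Real.exp_le_one_iff.2 (by linarith))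
      positivity
    · filter_upwards [eventually_ge_atTop 0] with t ht
      have hβt : 0 ≤ β * t := mul_nonneg hβ.le ht
      have hs : Real.sqrt (1 + β * t) ≤ 1 + β * t :=
        Real.sqrt_le_iff.2 ⟨by linarith, by nlinarith⟩
      have hs0 := Real.sqrt_nonneg (1 + β * t)
      gcongr
      nlinarith [Real.exp_pos (-t)]
  have hlim : Tendsto (fun t : ℝ => w ^ 2 / ((1 - Real.exp (-t)) * Real.sqrt (1 + β * t) *
      Real.exp (-(c * t)) + 1)) atTop (𝓝 (w ^ 2 / (0 + 1))) :=
    tendsto_const_nhds.div (hratio.add_const 1) (by norm_num)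
  rw [zero_add, div_one] at hlim
  refine hlim.congr fun t => ?_
  have hsplit : Real.exp (-(β * t) * w ^ 2 / 2) = Real.exp (-(c * t)) * Real.exp (-t) := by
    rw [← Real.exp_add, hc]; ring_nf
  rw [hsplit, ← mul_assoc, ← add_one_mul, mul_div_mul_right _ _ (Real.exp_ne_zero _)]

theorem integrable_sq_gaussianReal : Integrable (fun w : ℝ => w ^ 2) (gaussianReal 0 1) :=
  (memLp_id_gaussianReal 2).integrable_sq

/-- Dominated convergence for the Gaussian expectation. -/
theorem tendsto_integral_integrand {β : ℝ} (hβ : 0 < β) :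
    Tendsto (fun t : ℝ => ∫ w, w ^ 2 * Real.exp (-t) / ((1 - Real.exp (-t)) *
      Real.sqrt (1 + β * t) * Real.exp (-(β * t) * w ^ 2 / 2) + Real.exp (-t)) ∂(gaussianReal 0 1))
      atTop (nhds (∫ w, {w : ℝ | 2 < β * w ^ 2}.indicator (fun w => w ^ 2) w
        ∂(gaussianReal 0 1))) := by
  refine tendsto_integral_filter_of_dominated_convergence (fun w => w ^ 2) ?_ ?_
    integrable_sq_gaussianReal ?_
  · exact .of_forall fun t => Measurable.aestronglyMeasurable (by fun_prop)
  · filter_upwards [eventually_ge_atTop 0] with t ht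
    refine .of_forall fun w => ?_
    have h : 0 ≤ 1 - Real.exp (-t) := sub_nonneg.2 (Real.exp_le_one_iff.2 (by linarith))
    rw [Real.norm_of_nonneg (by positivity)]
    refine div_le_of_le_mul₀ (by positivity) (by positivity) ?_
    gcongr
    exact le_add_of_nonneg_left (by positivity)
  · have : NullSingletonClass (gaussianReal 0 1) := nullSingletonClass_gaussianReal one_ne_zero
    have hfin : {w : ℝ | β * w ^ 2 = 2}.Finite := by
      refine (Set.toFinite {Real.sqrt (2 / β), -Real.sqrt (2 / β)}).subset fun w hw => ?_
      have : w ^ 2 = Real.sqrt (2 / β) ^ 2 := by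
        rw [Real.sq_sqrt (by positivity), eq_div_iff hβ.ne']
        linarith [show β * w ^ 2 = 2 from hw]
      simpa using sq_eq_sq_iff_eq_or_eq_neg.1 this
    have hae : ∀ᵐ w ∂(gaussianReal 0 1), β * w ^ 2 ≠ 2 := by
      simpa [ae_iff] using hfin.measure_zero (gaussianReal 0 1)
    filter_upwards [hae] with w hw
    rcases hw.lt_or_gt with h | h
    · rw [Set.indicator_of_notMem (by simpa using h.le)]
      exact tendsto_integrand_of_lt hβ h
    · rw [Set.indicator_of_mem (by simpa using h)]
      exact tendsto_integrand_of_gt hβ h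

/-- Integration by parts for the second moment of a Gaussian tail. -/
theorem integral_Ioi_sq_mul_exp_neg_sq_div_two (a : ℝ) :
    ∫ w in Set.Ioi a, w ^ 2 * Real.exp (-w ^ 2 / 2) =
      a * Real.exp (-a ^ 2 / 2) + ∫ w in Set.Ioi a, Real.exp (-w ^ 2 / 2) := by
  have hint : Integrable fun w : ℝ => Real.exp (-w ^ 2 / 2) := by
    refine (integrable_exp_neg_mul_sq (b := 1 / 2) (by norm_num)).congr (.of_forall fun w => ?_)
    ring_nf
  have hint2 : Integrable fun w : ℝ => w ^ 2 * Real.exp (-w ^ 2 / 2) := by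
    refine (integrable_rpow_mul_exp_neg_mul_sq (b := 1 / 2) (by norm_num)
      (s := 2) (by norm_num)).congr (.of_forall fun w => ?_)
    simp only [Real.rpow_two]
    ring_nf
  have hderiv : ∀ w : ℝ, HasDerivAt (fun w => -(w * Real.exp (-w ^ 2 / 2)))
      (w ^ 2 * Real.exp (-w ^ 2 / 2) - Real.exp (-w ^ 2 / 2)) w := fun w => by
    refine HasDerivAt.congr_deriv
      ((hasDerivAt_id w).mul (((hasDerivAt_pow 2 w).fun_neg.div_const 2).exp)).neg ?_
    simp only [id]
    push_cast
    ring
  have hlim : Tendsto (fun w : ℝ => -(w * Real.exp (-w ^ 2 / 2))) atTop (nhds 0) := by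
    have h := (rpow_mul_exp_neg_mul_sq_isLittleO_exp_neg (b := 1 / 2) (by norm_num)
      1).tendsto_zero_of_tendsto (Real.tendsto_exp_atBot.comp
        (tendsto_id.const_mul_atTop_of_neg (by norm_num : -(1 / 2 : ℝ) < 0)))
    rw [← neg_zero]
    refine h.neg.congr fun w => ?_
    simp only [Real.rpow_one]
    ring_nf
  have h := integral_Ioi_of_hasDerivAt_of_tendsto' (a := a) (fun w _ => hderiv w)
    (hint2.sub hint).integrableOn hlim
  rw [integral_sub hint2.integrableOn hint.integrableOn] at h
  linarith

theorem integral_Ioi_exp_neg_sq_div_two (b : ℝ) :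
    ∫ w in Set.Ioi (Real.sqrt 2 * b), Real.exp (-w ^ 2 / 2) =
      Real.sqrt 2 * ∫ s in Set.Ioi b, Real.exp (-s ^ 2) := by
  have h2 : 0 < Real.sqrt 2 := by positivity
  have h := integral_comp_mul_left_Ioi (fun w => Real.exp (-w ^ 2 / 2)) b h2
  rw [smul_eq_mul, eq_inv_mul_iff_mul_eq₀ h2.ne'] at h
  rw [← h]
  congr 2 with s
  rw [mul_pow, Real.sq_sqrt zero_le_two]
  ring_nf

/-- The truncated second moment of a standard Gaussian. -/
theorem integral_indicator_sq_gaussianReal {β : ℝ} (hβ : 0 < β) :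
    ∫ w, {w : ℝ | 2 < β * w ^ 2}.indicator (fun w => w ^ 2) w ∂(gaussianReal 0 1) =
      (2 / Real.sqrt (Real.pi * β)) * Real.exp (-1 / β) + erfc (1 / Real.sqrt β) := by
  have hsβ : 0 < Real.sqrt β := Real.sqrt_pos.2 hβ
  have hsβ2 : Real.sqrt β ^ 2 = β := Real.sq_sqrt hβ.le
  have h22 : Real.sqrt 2 ^ 2 = 2 := Real.sq_sqrt zero_le_two
  set a := Real.sqrt 2 * (1 / Real.sqrt β) with ha
  have ha0 : 0 < a := by positivity
  have ha2 : a ^ 2 = 2 / β := by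
    rw [ha, mul_pow, div_pow, hsβ2, h22]; ring
  have hmem : ∀ w : ℝ, 2 < β * w ^ 2 ↔ a < |w| := fun w => by
    rw [← sq_lt_sq₀ ha0.le (abs_nonneg w), sq_abs, ha2, div_lt_iff₀ hβ, mul_comm]
  rw [integral_gaussianReal_eq_integral_smul one_ne_zero]
  have hfun : ∀ w : ℝ, gaussianPDFReal 0 1 w •
      {w : ℝ | 2 < β * w ^ 2}.indicator (fun w => w ^ 2) w =
      (fun r => (Real.sqrt (2 * Real.pi))⁻¹ *
        (Set.Ioi a).indicator (fun r => r ^ 2 * Real.exp (-r ^ 2 / 2)) r) |w| := fun w => by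
    simp only [Set.indicator_apply, Set.mem_ofPred_eq, Set.mem_Ioi, hmem, sq_abs, gaussianPDFReal]
    split_ifs <;> simp
    ring
  simp_rw [hfun]
  rw [integral_comp_abs (f := fun r => (Real.sqrt (2 * Real.pi))⁻¹ *
        (Set.Ioi a).indicator (fun r => r ^ 2 * Real.exp (-r ^ 2 / 2)) r), integral_const_mul,
    setIntegral_indicator measurableSet_Ioi, Set.Ioi_inter_Ioi, max_eq_right ha0.le,
    integral_Ioi_sq_mul_exp_neg_sq_div_two, ha2, ha, integral_Ioi_exp_neg_sq_div_two, erfc,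
    Real.sqrt_mul zero_le_two, Real.sqrt_mul Real.pi_pos.le,
    show -(2 / β) / 2 = -1 / β by ring]
  have hπ : 0 < Real.sqrt Real.pi := Real.sqrt_pos.2 Real.pi_pos
  field_simp

/-- **Small-density limit of the Gauss–Bernoulli state-evolution function**: for every
`β > 0`, `lim_{ρ→0⁺} f_ρ(−β·log ρ)/ρ = (2/√(πβ))·exp(−1/β) + erfc(1/√β)`. -/
theorem gauss_bernoulli_small_density_limit (β : ℝ) (hβ : 0 < β) :
    Tendsto (fun ρ => fGB ρ (-β * Real.log ρ) / ρ)
      (nhdsWithin 0 (Set.Ioo 0 1))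
      (nhds ((2 / Real.sqrt (Real.pi * β)) * Real.exp (-1 / β)
        + erfc (1 / Real.sqrt β))) := by
  have hcongr : ∀ᶠ ρ in nhdsWithin (0 : ℝ) (Set.Ioo 0 1), (fun t : ℝ => β * t / (1 + β * t) *
      ∫ w, w ^ 2 * Real.exp (-t) / ((1 - Real.exp (-t)) * Real.sqrt (1 + β * t) *
        Real.exp (-(β * t) * w ^ 2 / 2) + Real.exp (-t)) ∂(gaussianReal 0 1)) (-Real.log ρ) =
      fGB ρ (-β * Real.log ρ) / ρ := by
    filter_upwards [self_mem_nhdsWithin] with ρ hρ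
    have hρ0 : ρ ≠ 0 := hρ.1.ne'
    simp only [fGB, neg_neg, Real.exp_log hρ.1, mul_neg, neg_mul]
    rw [eq_div_iff hρ0]
    ring
  have hlog : Tendsto (fun ρ => -Real.log ρ) (nhdsWithin 0 (Set.Ioo 0 1)) atTop :=
    tendsto_neg_atBot_atTop.comp
      (Real.tendsto_log_nhdsGT_zero.mono_left (nhdsWithin_mono _ Set.Ioo_subset_Ioi_self))
  have hfrac : Tendsto (fun t : ℝ => β * t / (1 + β * t)) atTop (nhds 1) := by
    have hden : Tendsto (fun t : ℝ => 1 + β * t) atTop atTop :=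
      tendsto_atTop_add_const_left _ _ (tendsto_id.const_mul_atTop hβ)
    have h := (tendsto_inv_atTop_zero.comp hden).const_sub 1
    rw [sub_zero] at h
    refine h.congr' ?_
    filter_upwards [eventually_ge_atTop 0] with t ht
    have : 1 + β * t ≠ 0 := by positivity
    simp only [Function.comp_apply]
    field_simp
    ring
  have h := hfrac.mul (tendsto_integral_integrand hβ)
  rw [one_mul, integral_indicator_sq_gaussianReal hβ] at h
  exact (h.comp hlog).congr' hcongr
end

section
/- Small-density limit of the two-balanced-groups state-evolution function: for every β > 0 with β ≠ 2, lim_{ρ→0⁺} f_ρ( −β·ρ(1−ρ)·log(ρ(1−ρ)) ) = 1 if β > 2 and = 0 if β < 2. -/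
open MeasureTheory ProbabilityTheory Filter

/-- The two-balanced-groups state-evolution function
`f_ρ(x) = E_W[ 2ρ(1−ρ)·sinh( x/(2ρ(1−ρ)) + W·√(x/(ρ(1−ρ))) )
              / ( 1 + 2ρ(1−ρ)·( cosh( x/(2ρ(1−ρ)) + W·√(x/(ρ(1−ρ))) ) − 1 ) ) ]`. -/
noncomputable def fBal (ρ x : ℝ) : ℝ :=
  ∫ w, 2 * ρ * (1 - ρ) *
      Real.sinh (x / (2 * ρ * (1 - ρ)) + w * Real.sqrt (x / (ρ * (1 - ρ)))) /
      (1 + 2 * ρ * (1 - ρ) *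
        (Real.cosh (x / (2 * ρ * (1 - ρ)) + w * Real.sqrt (x / (ρ * (1 - ρ)))) - 1))
    ∂(gaussianReal 0 1)

/-- The integrand of `fBal`, as a function of `p = ρ(1−ρ)` and of the argument `z` of the
hyperbolic functions. -/
noncomputable def balKernel (p z : ℝ) : ℝ :=
  2 * p * Real.sinh z / (1 + 2 * p * (Real.cosh z - 1))

lemma balKernel_eq_exp (p z : ℝ) :
    balKernel p z = (p * Real.exp z - p * Real.exp (-z)) /
      (1 - 2 * p + (p * Real.exp z + p * Real.exp (-z))) := by
  rw [balKernel, Real.sinh_eq, Real.cosh_eq]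
  congr 1 <;> ring

lemma balKernel_eq_one_sub {p z : ℝ} (hp : 0 < p) (hp' : p < 1 / 2) :
    balKernel p z = 1 - (1 - 2 * p + 2 * (p * Real.exp (-z))) /
      (1 - 2 * p + p * Real.exp (-z) + p * Real.exp z) := by
  have h1 : 0 < p * Real.exp z := by positivity
  have h2 : 0 < p * Real.exp (-z) := by positivity
  have h : 1 - 2 * p + p * Real.exp (-z) + p * Real.exp z ≠ 0 := by linarith
  rw [balKernel_eq_exp, eq_sub_iff_add_eq, ← add_assoc, add_right_comm, ← add_div,
    div_eq_one_iff_eq h]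
  ring

lemma abs_balKernel_le_one {p : ℝ} (hp : 0 < p) (hp' : p < 1 / 2) (z : ℝ) :
    |balKernel p z| ≤ 1 := by
  have h1 : 0 < p * Real.exp z := by positivity
  have h2 : 0 < p * Real.exp (-z) := by positivity
  have h : 0 < 1 - 2 * p + (p * Real.exp z + p * Real.exp (-z)) := by linarith
  rw [balKernel_eq_exp, abs_div, abs_of_pos h, div_le_one h, abs_le]
  constructor <;> linarith

lemma measurable_balKernel (p : ℝ) : Measurable (balKernel p) := by
  unfold balKernel
  fun_prop

lemma fBal_eq_integral_balKernel {ρ : ℝ} (hρ : ρ * (1 - ρ) ≠ 0) (β : ℝ) :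
    fBal ρ (-β * (ρ * (1 - ρ)) * Real.log (ρ * (1 - ρ))) =
      ∫ w, balKernel (ρ * (1 - ρ)) (β / 2 * -Real.log (ρ * (1 - ρ)) +
        w * Real.sqrt (β * -Real.log (ρ * (1 - ρ)))) ∂(gaussianReal 0 1) := by
  have h1 : -β * (ρ * (1 - ρ)) * Real.log (ρ * (1 - ρ)) / (2 * (ρ * (1 - ρ))) =
      β / 2 * -Real.log (ρ * (1 - ρ)) := by
    rw [div_eq_iff (mul_ne_zero two_ne_zero hρ)]
    ring
  have h2 : -β * (ρ * (1 - ρ)) * Real.log (ρ * (1 - ρ)) / (ρ * (1 - ρ)) =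
      β * -Real.log (ρ * (1 - ρ)) := by
    rw [div_eq_iff hρ]
    ring
  simp only [fBal, h1, h2, balKernel, mul_assoc 2 ρ]

lemma tendsto_linear_add_sqrt_atTop {c : ℝ} (hc : 0 < c) (b w : ℝ) :
    Tendsto (fun L : ℝ => c * L + w * Real.sqrt (b * L)) atTop atTop := by
  have h : Tendsto (fun L : ℝ => Real.sqrt L * (c * Real.sqrt L + w * Real.sqrt b))
      atTop atTop :=
    Real.tendsto_sqrt_atTop.atTop_mul_atTop₀
      (tendsto_atTop_add_const_right _ _ (Real.tendsto_sqrt_atTop.const_mul_atTop hc))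
  refine h.congr' ?_
  filter_upwards [eventually_ge_atTop 0] with L hL
  rw [Real.sqrt_mul' b hL]
  linear_combination c * Real.mul_self_sqrt hL

lemma tendsto_integral_balKernel {z : ℝ → ℝ → ℝ} (hz : ∀ p, Measurable (z p)) {l : ℝ}
    (h : ∀ w, Tendsto (fun p => balKernel p (z p w)) (nhdsWithin 0 (Set.Ioi 0)) (nhds l)) :
    Tendsto (fun p => ∫ w, balKernel p (z p w) ∂(gaussianReal 0 1))
      (nhdsWithin 0 (Set.Ioi 0)) (nhds l) := by
  have key := tendsto_integral_filter_of_dominated_convergence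
    (μ := gaussianReal 0 1) (F := fun p w => balKernel p (z p w)) (f := fun _ => l)
    (l := nhdsWithin 0 (Set.Ioi 0)) (fun _ => 1)
    (Eventually.of_forall fun p =>
      ((measurable_balKernel p).comp (hz p)).aestronglyMeasurable)
    (by
      filter_upwards [Ioo_mem_nhdsGT (show (0 : ℝ) < 1 / 2 by norm_num)] with p hp
      exact Eventually.of_forall fun w => abs_balKernel_le_one hp.1 hp.2 _)
    (integrable_const 1) (Eventually.of_forall h)
  simpa using key

section Pointwise

variable {z : ℝ → ℝ}

lemma tendsto_mul_exp_neg_of_tendsto_atTop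
    (hz : Tendsto z (nhdsWithin 0 (Set.Ioi 0)) atTop) :
    Tendsto (fun p => p * Real.exp (-z p)) (nhdsWithin 0 (Set.Ioi 0)) (nhds 0) := by
  have h : Tendsto (fun p : ℝ => p) (nhdsWithin 0 (Set.Ioi 0)) (nhds 0) :=
    tendsto_nhdsWithin_of_tendsto_nhds tendsto_id
  simpa using h.mul (Real.tendsto_exp_neg_atTop_nhds_zero.comp hz)

lemma exp_add_log_eventuallyEq (z : ℝ → ℝ) :
    (fun p => Real.exp (z p + Real.log p)) =ᶠ[nhdsWithin 0 (Set.Ioi 0)]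
      fun p => p * Real.exp (z p) := by
  filter_upwards [self_mem_nhdsWithin] with p hp
  rw [Real.exp_add, Real.exp_log hp, mul_comm]

lemma tendsto_one_sub_two_mul :
    Tendsto (fun p : ℝ => 1 - 2 * p) (nhdsWithin 0 (Set.Ioi 0)) (nhds 1) := by
  have h : Continuous fun p : ℝ => 1 - 2 * p := by fun_prop
  simpa using (h.tendsto 0).mono_left nhdsWithin_le_nhds

lemma tendsto_balKernel_one (hz : Tendsto z (nhdsWithin 0 (Set.Ioi 0)) atTop)
    (hz' : Tendsto (fun p => z p + Real.log p) (nhdsWithin 0 (Set.Ioi 0)) atTop) :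
    Tendsto (fun p => balKernel p (z p)) (nhdsWithin 0 (Set.Ioi 0)) (nhds 1) := by
  have hA := (Real.tendsto_exp_atTop.comp hz').congr' (exp_add_log_eventuallyEq z)
  have hB := tendsto_mul_exp_neg_of_tendsto_atTop hz
  have h := ((tendsto_one_sub_two_mul.add (hB.const_mul 2)).div_atTop
    ((tendsto_one_sub_two_mul.add hB).add_atTop hA)).const_sub 1
  rw [sub_zero] at h
  refine h.congr' ?_
  filter_upwards [Ioo_mem_nhdsGT (show (0 : ℝ) < 1 / 2 by norm_num)] with p hp
  exact (balKernel_eq_one_sub hp.1 hp.2).symm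

lemma tendsto_balKernel_zero (hz : Tendsto z (nhdsWithin 0 (Set.Ioi 0)) atTop)
    (hz' : Tendsto (fun p => z p + Real.log p) (nhdsWithin 0 (Set.Ioi 0)) atBot) :
    Tendsto (fun p => balKernel p (z p)) (nhdsWithin 0 (Set.Ioi 0)) (nhds 0) := by
  have hA := (Real.tendsto_exp_atBot.comp hz').congr' (exp_add_log_eventuallyEq z)
  have hB := tendsto_mul_exp_neg_of_tendsto_atTop hz
  have h := (hA.sub hB).div (tendsto_one_sub_two_mul.add (hA.add hB)) (by norm_num)
  simp only [sub_zero, zero_div] at h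
  exact h.congr fun p => (balKernel_eq_exp p (z p)).symm

end Pointwise

lemma tendsto_mul_one_sub_nhdsGT_zero :
    Tendsto (fun ρ : ℝ => ρ * (1 - ρ)) (nhdsWithin 0 (Set.Ioo 0 1))
      (nhdsWithin 0 (Set.Ioi 0)) := by
  refine tendsto_nhdsWithin_iff.2 ⟨?_, ?_⟩
  · have h : Continuous fun ρ : ℝ => ρ * (1 - ρ) := by fun_prop
    simpa using (h.tendsto 0).mono_left nhdsWithin_le_nhds
  · filter_upwards [self_mem_nhdsWithin] with ρ hρ
    exact mul_pos hρ.1 (sub_pos.2 hρ.2)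

lemma tendsto_fBal_of_tendsto_balKernel {β l : ℝ}
    (h : ∀ w, Tendsto (fun p => balKernel p
        (β / 2 * -Real.log p + w * Real.sqrt (β * -Real.log p)))
      (nhdsWithin 0 (Set.Ioi 0)) (nhds l)) :
    Tendsto (fun ρ => fBal ρ (-β * (ρ * (1 - ρ)) * Real.log (ρ * (1 - ρ))))
      (nhdsWithin 0 (Set.Ioo 0 1)) (nhds l) := by
  have key := (tendsto_integral_balKernel
    (z := fun p w => β / 2 * -Real.log p + w * Real.sqrt (β * -Real.log p))
    (fun p => by fun_prop) h).comp tendsto_mul_one_sub_nhdsGT_zero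
  refine key.congr' ?_
  filter_upwards [self_mem_nhdsWithin] with ρ hρ
  exact (fBal_eq_integral_balKernel (mul_pos hρ.1 (sub_pos.2 hρ.2)).ne' β).symm

/-- **Small-density limit of the two-balanced-groups state-evolution function**: for
`β > 0`, `lim_{ρ→0⁺} f_ρ(−β·ρ(1−ρ)·log(ρ(1−ρ))) = 1` if `β > 2` and `= 0` if `β < 2`. -/
theorem two_balanced_groups_small_density_limit (β : ℝ) (hβ : 0 < β) :
    (2 < β → Tendsto
        (fun ρ => fBal ρ (-β * (ρ * (1 - ρ)) * Real.log (ρ * (1 - ρ))))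
        (nhdsWithin 0 (Set.Ioo 0 1)) (nhds 1)) ∧
    (β < 2 → Tendsto
        (fun ρ => fBal ρ (-β * (ρ * (1 - ρ)) * Real.log (ρ * (1 - ρ))))
        (nhdsWithin 0 (Set.Ioo 0 1)) (nhds 0)) := by
  have hL : Tendsto (fun p => -Real.log p) (nhdsWithin 0 (Set.Ioi 0)) atTop :=
    tendsto_neg_atBot_atTop.comp Real.tendsto_log_nhdsGT_zero
  have hz (w : ℝ) := (tendsto_linear_add_sqrt_atTop (half_pos hβ) β w).comp hL
  refine ⟨fun h => tendsto_fBal_of_tendsto_balKernel fun w =>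
      tendsto_balKernel_one (hz w) ?_,
    fun h => tendsto_fBal_of_tendsto_balKernel fun w =>
      tendsto_balKernel_zero (hz w) ?_⟩
  · have hc : 0 < β / 2 - 1 := by linarith
    refine ((tendsto_linear_add_sqrt_atTop hc β w).comp hL).congr fun p => ?_
    simp only [Function.comp_apply]
    ring
  · have hc : 0 < 1 - β / 2 := by linarith
    refine (tendsto_neg_atTop_atBot.comp
      ((tendsto_linear_add_sqrt_atTop hc β (-w)).comp hL)).congr fun p => ?_
    simp only [Function.comp_apply]
    ring
end

section
/- Gaussian integration-by-parts identity for the Gauss–Bernoulli state-evolution function: let P = ρ·N(0,1) + (1−ρ)·δ₀ be the Gauss–Bernoulli prior with ρ ∈ (0,1). Then for every x > 0, E over x₀ ~ P and W of [ x₀ · f_in( x, x·x₀ + √x·W ) ] = ρ · (x/(1+x)) · E_W[ W² · ρ / ( (1−ρ)·√(1+x)·exp(−x·W²/2) + ρ ) ]. -/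
open MeasureTheory ProbabilityTheory

/-- The Gauss–Bernoulli prior `P = ρ·N(0,1) + (1−ρ)·δ₀`. -/
noncomputable def gaussBernoulli (ρ : ℝ) : Measure ℝ :=
  ENNReal.ofReal ρ • gaussianReal 0 1 + ENNReal.ofReal (1 - ρ) • Measure.dirac 0

/-- Integration against the Gauss–Bernoulli prior. -/
lemma integral_gaussBernoulli {ρ : ℝ} (hρ : ρ ∈ Set.Icc (0 : ℝ) 1) {f : ℝ → ℝ}
    (hf : Integrable f (gaussianReal 0 1)) :
    ∫ t, f t ∂(gaussBernoulli ρ) = ρ * ∫ t, f t ∂(gaussianReal 0 1) + (1 - ρ) * f 0 := by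
  have hd : Integrable f (Measure.dirac 0) := integrable_dirac (by simp)
  rw [gaussBernoulli, integral_add_measure (hf.smul_measure ENNReal.ofReal_ne_top)
    (hd.smul_measure ENNReal.ofReal_ne_top), integral_smul_measure, integral_smul_measure,
    integral_dirac, ENNReal.toReal_ofReal hρ.1, ENNReal.toReal_ofReal (by linarith [hρ.2]),
    smul_eq_mul, smul_eq_mul]

/-- Completing the square: an exponential-quadratic tilt of the standard Gaussian is a multiple
of the Gaussian of mean `B / (1 + A)` and variance `1 / (1 + A)`. -/
lemma integral_mul_exp_quadratic_gaussianReal {A : ℝ} (hA : -1 < A) (B : ℝ) (f : ℝ → ℝ) :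
    ∫ t, f t * Real.exp (B * t - A * t ^ 2 / 2) ∂(gaussianReal 0 1) =
      Real.exp (B ^ 2 / (2 * (1 + A))) / √(1 + A) *
        ∫ t, f t ∂(gaussianReal (B / (1 + A)) (Real.toNNReal (1 / (1 + A)))) := by
  have hA' : 0 < 1 + A := by linarith
  have hv : Real.toNNReal (1 / (1 + A)) ≠ 0 := by
    simpa using hA'
  rw [integral_gaussianReal_eq_integral_smul one_ne_zero,
    integral_gaussianReal_eq_integral_smul hv, ← integral_const_mul]
  refine integral_congr_ae (.of_forall fun t ↦ ?_)
  simp only [gaussianPDFReal, smul_eq_mul, NNReal.coe_one,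
    Real.coe_toNNReal _ (one_div_pos.mpr hA').le]
  have hsqrt : √(2 * Real.pi * (1 / (1 + A))) = √(2 * Real.pi) / √(1 + A) := by
    rw [mul_one_div, Real.sqrt_div (by positivity)]
  have hexp : Real.exp (B ^ 2 / (2 * (1 + A))) *
      Real.exp (-(t - B / (1 + A)) ^ 2 / (2 * (1 / (1 + A)))) =
      Real.exp (-(t - 0) ^ 2 / (2 * 1)) * Real.exp (B * t - A * t ^ 2 / 2) := by
    rw [← Real.exp_add, ← Real.exp_add]
    congr 1
    field_simp
    ring
  have h1 : √(1 + A) ≠ 0 := (Real.sqrt_pos.mpr hA').ne'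
  have h2 : √(2 * Real.pi) ≠ 0 := (Real.sqrt_pos.mpr (by positivity)).ne'
  rw [hsqrt]
  calc _ = (√(2 * Real.pi))⁻¹ * f t * (Real.exp (-(t - 0) ^ 2 / (2 * 1)) *
        Real.exp (B * t - A * t ^ 2 / 2)) := by rw [mul_one (2 * Real.pi)]; ring
    _ = _ := by rw [← hexp]; field_simp

lemma integrable_mul_exp_quadratic {A : ℝ} (hA : 0 < A) (B : ℝ) {μ : Measure ℝ} {f : ℝ → ℝ}
    (hf : Integrable f μ) :
    Integrable (fun t ↦ f t * Real.exp (B * t - A * t ^ 2 / 2)) μ := by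
  refine hf.mul_bdd (c := Real.exp (B ^ 2 / (2 * A))) (by fun_prop) (.of_forall fun t ↦ ?_)
  rw [Real.norm_of_nonneg (Real.exp_pos _).le, Real.exp_le_exp, le_div_iff₀ (by positivity)]
  nlinarith [sq_nonneg (A * t - B)]

/-- Closed form of the Gauss–Bernoulli denoiser. -/
lemma fIn_gaussBernoulli {ρ : ℝ} (hρ : ρ ∈ Set.Ioo (0 : ℝ) 1) {A : ℝ} (hA : 0 < A) (B : ℝ) :
    fIn (gaussBernoulli ρ) A B = B / (1 + A) *
      (ρ / ((1 - ρ) * √(1 + A) * Real.exp (-(B ^ 2 / (2 * (1 + A)))) + ρ)) := by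
  have hρ' := Set.Ioo_subset_Icc_self hρ
  have hid : Integrable (fun t : ℝ ↦ t) (gaussianReal 0 1) :=
    (memLp_id_gaussianReal 1).integrable le_rfl
  have hZ := integral_mul_exp_quadratic_gaussianReal (by linarith : -1 < A) B (fun _ ↦ 1)
  have hZi := integrable_mul_exp_quadratic hA B (integrable_const (μ := gaussianReal 0 1) (1 : ℝ))
  simp only [one_mul, integral_const, probReal_univ, smul_eq_mul, mul_one] at hZ hZi
  rw [fIn, Zfun, integral_gaussBernoulli hρ' hZi,
    integral_gaussBernoulli hρ' (integrable_mul_exp_quadratic hA B hid), hZ,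
    integral_mul_exp_quadratic_gaussianReal (by linarith : -1 < A) B (fun t ↦ t),
    integral_id_gaussianReal, Real.exp_neg]
  have h1 : 0 < √(1 + A) := Real.sqrt_pos.mpr (by linarith)
  have h2 : 0 < Real.exp (B ^ 2 / (2 * (1 + A))) := Real.exp_pos _
  have h3 : 0 < ρ := hρ.1
  have h4 : 0 < 1 - ρ := by linarith [hρ.2]
  have h5 : 0 < 1 + A := by linarith
  generalize Real.exp (B ^ 2 / (2 * (1 + A))) = E at *
  generalize √(1 + A) = s at *
  simp only [mul_zero, add_zero, ne_eq, OfNat.ofNat_ne_zero, not_false_eq_true,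
    zero_pow, zero_div, sub_zero, Real.exp_zero, mul_one]
  field_simp
  ring

/-- The standard Gaussian measure on the plane is invariant under rotation. -/
lemma gaussianReal_prod_map_rotation (θ : ℝ) :
    ((gaussianReal 0 1).prod (gaussianReal 0 1)).map
      (ContinuousLinearMap.rotation θ : ℝ × ℝ →L[ℝ] ℝ × ℝ) =
      (gaussianReal 0 1).prod (gaussianReal 0 1) :=
  IsGaussian.map_rotation_eq_self_of_forall_strongDual_eq_zero
    (fun L ↦ by rw [integral_continuousLinearMap_gaussianReal, map_zero]) θ

/-- Integrating `x · h(sin θ · x + cos θ · y)` against two independent standard Gaussians: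
only the projection of `x` on the argument of `h` contributes. -/
lemma integrable_and_integral_fst_mul_comp_rotation {h : ℝ → ℝ} (θ : ℝ)
    (hh : Integrable h (gaussianReal 0 1))
    (hvh : Integrable (fun v ↦ v * h v) (gaussianReal 0 1)) :
    Integrable (fun p : ℝ × ℝ ↦ p.1 * h (Real.sin θ * p.1 + Real.cos θ * p.2))
        ((gaussianReal 0 1).prod (gaussianReal 0 1)) ∧
      ∫ p : ℝ × ℝ, p.1 * h (Real.sin θ * p.1 + Real.cos θ * p.2)
          ∂((gaussianReal 0 1).prod (gaussianReal 0 1)) =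
        Real.sin θ * ∫ v, v * h v ∂(gaussianReal 0 1) := by
  have hid : Integrable (fun t : ℝ ↦ t) (gaussianReal 0 1) :=
    (memLp_id_gaussianReal 1).integrable le_rfl
  have hi₁ := (hvh.comp_snd (gaussianReal 0 1)).const_mul (Real.sin θ)
  have hi₂ := (hid.mul_prod hh).const_mul (Real.cos θ)
  have hi : Integrable
      (fun q : ℝ × ℝ ↦ Real.sin θ * (q.2 * h q.2) + Real.cos θ * (q.1 * h q.2))
      ((gaussianReal 0 1).prod (gaussianReal 0 1)) := hi₁.add hi₂
  have hcomp : (fun p : ℝ × ℝ ↦ p.1 * h (Real.sin θ * p.1 + Real.cos θ * p.2)) =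
      (fun q : ℝ × ℝ ↦ Real.sin θ * (q.2 * h q.2) + Real.cos θ * (q.1 * h q.2)) ∘
        (ContinuousLinearMap.rotation (-θ) : ℝ × ℝ →L[ℝ] ℝ × ℝ) := by
    ext p
    simp only [Function.comp_apply, ContinuousLinearMap.rotation_apply, Real.cos_neg,
      Real.sin_neg, neg_neg, smul_eq_mul]
    linear_combination (-p.1 * h (Real.sin θ * p.1 + Real.cos θ * p.2)) *
      Real.sin_sq_add_cos_sq θ
  have hmeas : Measurable (ContinuousLinearMap.rotation (-θ) : ℝ × ℝ →L[ℝ] ℝ × ℝ) :=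
    (ContinuousLinearMap.continuous _).measurable
  rw [← gaussianReal_prod_map_rotation (-θ)] at hi
  refine ⟨hcomp ▸ hi.comp_measurable hmeas, ?_⟩
  rw [hcomp]
  refine (integral_map hmeas.aemeasurable hi.aestronglyMeasurable).symm.trans ?_
  rw [gaussianReal_prod_map_rotation]
  refine (integral_add hi₁ hi₂).trans ?_
  rw [integral_const_mul, integral_const_mul, integral_prod_mul (fun t ↦ t) h,
    integral_id_gaussianReal, integral_fun_snd (fun v ↦ v * h v)]
  simp

/-- **Gaussian integration-by-parts identity for the Gauss–Bernoulli state-evolution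
function**: for `ρ ∈ (0,1)` and `x > 0`, with `P` the Gauss–Bernoulli prior,
`E_{x₀ ∼ P, W}[ x₀ · f_in(x, x·x₀ + √x·W) ]
  = ρ · (x/(1+x)) · E_W[ W² ρ / ((1−ρ)·√(1+x)·exp(−x·W²/2) + ρ) ]`. -/
theorem gauss_bernoulli_integration_by_parts
    (ρ : ℝ) (hρ : ρ ∈ Set.Ioo (0 : ℝ) 1) (x : ℝ) (hx : 0 < x) :
    (∫ x₀, ∫ w, x₀ * fIn (gaussBernoulli ρ) x (x * x₀ + Real.sqrt x * w)
        ∂(gaussianReal 0 1) ∂(gaussBernoulli ρ))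
      = ρ * (x / (1 + x)) *
        ∫ w, w ^ 2 * ρ /
            ((1 - ρ) * Real.sqrt (1 + x) * Real.exp (-x * w ^ 2 / 2) + ρ)
          ∂(gaussianReal 0 1) := by
  set g : ℝ → ℝ := fun w ↦ ρ / ((1 - ρ) * √(1 + x) * Real.exp (-x * w ^ 2 / 2) + ρ) with hg
  have hρ0 := hρ.1
  have hρ1 : 0 < 1 - ρ := by linarith [hρ.2]
  have h1x : 0 < 1 + x := by linarith
  have hs : 0 < √x := Real.sqrt_pos.mpr hx
  have hr : 0 < √(1 + x) := Real.sqrt_pos.mpr h1x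
  have hs2 : √x ^ 2 = x := Real.sq_sqrt hx.le
  have hr2 : √(1 + x) ^ 2 = 1 + x := Real.sq_sqrt h1x.le
  have hden (w : ℝ) : 0 < (1 - ρ) * √(1 + x) * Real.exp (-x * w ^ 2 / 2) := by positivity
  have hgm : Measurable g := by fun_prop
  have hgb (w : ℝ) : ‖g w‖ ≤ 1 := by
    have := hden w
    rw [hg, Real.norm_of_nonneg (by positivity), div_le_one (by positivity)]
    linarith
  set h : ℝ → ℝ := fun v ↦ √x / √(1 + x) * (v * g v) with hh
  have hid : Integrable (fun t : ℝ ↦ t) (gaussianReal 0 1) :=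
    (memLp_id_gaussianReal 1).integrable le_rfl
  have hsq : Integrable (fun t : ℝ ↦ t ^ 2) (gaussianReal 0 1) :=
    (memLp_id_gaussianReal 2).integrable_sq
  have hhi : Integrable h (gaussianReal 0 1) :=
    (hid.mul_bdd hgm.aestronglyMeasurable (.of_forall hgb)).const_mul _
  have hvh : Integrable (fun v ↦ v * h v) (gaussianReal 0 1) := by
    refine ((hsq.mul_bdd hgm.aestronglyMeasurable (.of_forall hgb)).const_mul
      (√x / √(1 + x))).congr (.of_forall fun v ↦ ?_)
    simp only [hh]
    ring
  have hsin : Real.sin (Real.arctan √x) = √x / √(1 + x) := by rw [Real.sin_arctan, hs2]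
  have hcos : Real.cos (Real.arctan √x) = 1 / √(1 + x) := by rw [Real.cos_arctan, hs2]
  have hfIn (a w : ℝ) : fIn (gaussBernoulli ρ) x (x * a + √x * w) =
      h (Real.sin (Real.arctan √x) * a + Real.cos (Real.arctan √x) * w) := by
    rw [fIn_gaussBernoulli hρ hx, hsin, hcos]
    simp only [hh, hg]
    have harg : -((x * a + √x * w) ^ 2 / (2 * (1 + x))) =
        -x * (√x / √(1 + x) * a + 1 / √(1 + x) * w) ^ 2 / 2 := by
      have hxa : x * a + √x * w = √x * √(1 + x) * (√x / √(1 + x) * a + 1 / √(1 + x) * w) := by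
        field_simp
        linear_combination (-a) * hs2
      rw [hxa, mul_pow, mul_pow, hs2, hr2]
      field_simp
    rw [harg, ← mul_assoc (√x / √(1 + x))]
    congr 1
    field_simp
    rw [hr2]
    linear_combination (-a * (1 + x)) * hs2
  obtain ⟨hprod, heq⟩ := integrable_and_integral_fst_mul_comp_rotation (Real.arctan √x) hhi hvh
  simp_rw [hfIn]
  rw [integral_gaussBernoulli (Set.Ioo_subset_Icc_self hρ) hprod.integral_prod_left,
    ← integral_prod _ hprod, heq, hsin]
  simp only [zero_mul, integral_zero, mul_zero, add_zero]
  have hquad : ∫ v, v * h v ∂(gaussianReal 0 1) = √x / √(1 + x) *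
      ∫ w, w ^ 2 * ρ / ((1 - ρ) * √(1 + x) * Real.exp (-x * w ^ 2 / 2) + ρ)
        ∂(gaussianReal 0 1) := by
    rw [← integral_const_mul]
    refine integral_congr_ae (.of_forall fun v ↦ ?_)
    simp only [hh, hg]
    ring
  rw [hquad, ← mul_assoc (√x / √(1 + x)), div_mul_div_comm, ← sq, ← sq, hs2, hr2, mul_assoc]
end

section
/- Derivative of the rank-one Bayes-optimal replica free energy: let P be a compactly supported probability measure on ℝ and Δ > 0. Define f^{SE}(y) = E over x₀ ~ P and W of [ x₀ · f_in( y, y·x₀ + √y·W ) ] for y ≥ 0, and define φ(m) = E over x₀ ~ P and W of [ log Z( m/Δ, (m/Δ)·x₀ + √(m/Δ)·W ) ] − m²/(4Δ) for m ≥ 0. Then φ is differentiable on (0, ∞) and φ'(m) = ( f^{SE}(m/Δ) − m ) / (2Δ) for every m > 0. -/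
open MeasureTheory ProbabilityTheory

/-- `f^{SE}(y) = E_{x₀ ∼ P, W}[ x₀ · f_in(y, y·x₀ + √y·W) ]`. -/
noncomputable def fSE (P : Measure ℝ) (y : ℝ) : ℝ :=
  ∫ x₀, ∫ w, x₀ * fIn P y (y * x₀ + Real.sqrt y * w) ∂(gaussianReal 0 1) ∂P

/-- The rank-one Bayes-optimal replica free energy
`φ(m) = E_{x₀, W}[ log Z(m/Δ, (m/Δ)x₀ + √(m/Δ)·W) ] − m²/(4Δ)`. -/
noncomputable def replicaPhi (P : Measure ℝ) (Δ m : ℝ) : ℝ :=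
  (∫ x₀, ∫ w, Real.log (Zfun P (m / Δ) ((m / Δ) * x₀ + Real.sqrt (m / Δ) * w))
      ∂(gaussianReal 0 1) ∂P) - m ^ 2 / (4 * Δ)

open Real Filter Topology

/-! ### Gaussian integration by parts and translation -/

lemma integrable_gaussianReal_iff {f : ℝ → ℝ} :
    Integrable f (gaussianReal 0 1) ↔ Integrable fun x ↦ gaussianPDFReal 0 1 x * f x := by
  rw [gaussianReal_of_var_ne_zero 0 one_ne_zero,
    integrable_withDensity_iff_integrable_smul' (measurable_gaussianPDF 0 1)
      (ae_of_all _ fun _ ↦ gaussianPDF_lt_top)]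
  simp only [toReal_gaussianPDF, smul_eq_mul]

lemma hasDerivAt_gaussianPDFReal_zero_one (x : ℝ) :
    HasDerivAt (gaussianPDFReal 0 1) (-x * gaussianPDFReal 0 1 x) x := by
  have h : HasDerivAt (fun x : ℝ ↦ -(x - 0) ^ 2 / (2 * ((1 : NNReal) : ℝ))) (-x) x := by
    convert! ((((hasDerivAt_id x).sub_const 0).pow 2).neg.div_const (2 * ((1 : NNReal) : ℝ)))
      using 1
    simp
    ring
  rw [gaussianPDFReal_def]
  convert! h.exp.const_mul (√(2 * π * ((1 : NNReal) : ℝ)))⁻¹ using 1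
  ring

/-- Gaussian integration by parts (Stein's lemma). -/
lemma integral_id_mul_gaussianReal {f f' : ℝ → ℝ} (hderiv : ∀ x, HasDerivAt f (f' x) x)
    (hf : Integrable f (gaussianReal 0 1)) (hf' : Integrable f' (gaussianReal 0 1))
    (hxf : Integrable (fun x ↦ x * f x) (gaussianReal 0 1)) :
    ∫ x, x * f x ∂gaussianReal 0 1 = ∫ x, f' x ∂gaussianReal 0 1 := by
  rw [integrable_gaussianReal_iff] at hf hf' hxf
  have h := integral_eq_zero_of_hasDerivAt_of_integrable
    (f := fun x ↦ gaussianPDFReal 0 1 x * f x)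
    (f' := fun x ↦ gaussianPDFReal 0 1 x * f' x - gaussianPDFReal 0 1 x * (x * f x))
    (fun x ↦ ((hasDerivAt_gaussianPDFReal_zero_one x).mul (hderiv x)).congr_deriv (by ring))
    (hf'.sub hxf) hf
  rw [integral_sub hf' hxf, sub_eq_zero] at h
  simp only [integral_gaussianReal_eq_integral_smul one_ne_zero, smul_eq_mul, h]

/-- Cameron–Martin formula for the standard Gaussian on the line. -/
lemma integral_comp_const_add_gaussianReal (h : ℝ → ℝ) (a : ℝ) :
    ∫ w, h (a + w) ∂gaussianReal 0 1 = ∫ w, h w * exp (a * w - a ^ 2 / 2) ∂gaussianReal 0 1 := by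
  simp only [integral_gaussianReal_eq_integral_smul one_ne_zero, smul_eq_mul]
  rw [← integral_add_left_eq_self
    (fun w ↦ gaussianPDFReal 0 1 w * (h w * exp (a * w - a ^ 2 / 2))) a]
  congr 1 with w
  have : exp (-w ^ 2 / 2) = exp (-(a + w) ^ 2 / 2) * exp (a * (a + w) - a ^ 2 / 2) := by
    rw [← exp_add]
    ring_nf
  simp only [gaussianPDFReal, NNReal.coe_one, sub_zero, mul_one, this]
  ring

/-! ### Locally uniform exponential growth -/

/-- The functions `f s`, `s ∈ I`, are bounded by a common exponential `C * exp (c * |w|)`. -/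
def ExpGrowth (I : Set ℝ) (f : ℝ → ℝ → ℝ) : Prop :=
  ∃ C c : ℝ, 0 ≤ C ∧ ∀ s ∈ I, ∀ w, |f s w| ≤ C * exp (c * |w|)

namespace ExpGrowth

variable {I : Set ℝ} {f g : ℝ → ℝ → ℝ}

lemma mul (hf : ExpGrowth I f) (hg : ExpGrowth I g) :
    ExpGrowth I fun s w ↦ f s w * g s w := by
  obtain ⟨C, c, hC, hf⟩ := hf
  obtain ⟨D, d, hD, hg⟩ := hg
  refine ⟨C * D, c + d, by positivity, fun s hs w ↦ ?_⟩
  rw [abs_mul, add_mul, exp_add]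
  calc |f s w| * |g s w| ≤ (C * exp (c * |w|)) * (D * exp (d * |w|)) :=
        mul_le_mul (hf s hs w) (hg s hs w) (abs_nonneg _) (by positivity)
    _ = _ := by ring

lemma add (hf : ExpGrowth I f) (hg : ExpGrowth I g) :
    ExpGrowth I fun s w ↦ f s w + g s w := by
  obtain ⟨C, c, hC, hf⟩ := hf
  obtain ⟨D, d, hD, hg⟩ := hg
  refine ⟨C + D, max c d, by positivity, fun s hs w ↦ ?_⟩
  calc |f s w + g s w| ≤ |f s w| + |g s w| := abs_add_le _ _
    _ ≤ C * exp (c * |w|) + D * exp (d * |w|) := add_le_add (hf s hs w) (hg s hs w)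
    _ ≤ C * exp (max c d * |w|) + D * exp (max c d * |w|) := by
        gcongr
        · exact le_max_left c d
        · exact le_max_right c d
    _ = _ := by ring

lemma const (a : ℝ) : ExpGrowth I fun _ _ ↦ a :=
  ⟨|a|, 0, abs_nonneg a, fun _ _ _ ↦ by simp⟩

lemma id_right : ExpGrowth I fun _ w ↦ w :=
  ⟨1, 1, zero_le_one, fun _ _ w ↦ by
    rw [one_mul, one_mul]
    linarith [add_one_le_exp |w|]⟩

lemma id_left {S : ℝ} (hI : ∀ s ∈ I, |s| ≤ S) : ExpGrowth I fun s _ ↦ s :=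
  ⟨|S|, 0, abs_nonneg S, fun s hs _ ↦ by simpa using (hI s hs).trans (le_abs_self S)⟩

lemma sub (hf : ExpGrowth I f) (hg : ExpGrowth I g) :
    ExpGrowth I fun s w ↦ f s w - g s w := by
  simpa [sub_eq_add_neg] using hf.add ((const (-1)).mul hg)

end ExpGrowth

lemma integrable_exp_mul_abs_gaussianReal (c : ℝ) :
    Integrable (fun w ↦ exp (c * |w|)) (gaussianReal 0 1) :=
  integrable_exp_mul_abs (X := fun w ↦ w) (integrable_exp_mul_gaussianReal c)
    (integrable_exp_mul_gaussianReal (-c))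

lemma ExpGrowth.integrable {I : Set ℝ} {f : ℝ → ℝ → ℝ} (hf : ExpGrowth I f) {s : ℝ} (hs : s ∈ I)
    (hcont : Continuous (f s)) : Integrable (f s) (gaussianReal 0 1) := by
  obtain ⟨C, c, -, hf⟩ := hf
  exact ((integrable_exp_mul_abs_gaussianReal c).const_mul C).mono' hcont.aestronglyMeasurable
    (ae_of_all _ fun w ↦ hf s hs w)

/-! ### Moments of the tilted measure -/

/-- The unnormalised `k`-th moment `∫ xᵏ exp(s w x - s² x² / 2) dP(x)`. -/
noncomputable def tiltedMoment (P : Measure ℝ) (k : ℕ) (s w : ℝ) : ℝ :=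
  ∫ x, x ^ k * exp (s * w * x - s ^ 2 * x ^ 2 / 2) ∂P

lemma Zfun_sq (P : Measure ℝ) (s w : ℝ) : Zfun P (s ^ 2) (s * w) = tiltedMoment P 0 s w := by
  simp [Zfun, tiltedMoment]

lemma fIn_sq (P : Measure ℝ) (s w : ℝ) :
    fIn P (s ^ 2) (s * w) = tiltedMoment P 1 s w / tiltedMoment P 0 s w := by
  simp [fIn, Zfun_sq, tiltedMoment]

lemma hasDerivAt_integral_of_continuous_uncurry {P : Measure ℝ} [IsFiniteMeasure P] {R : ℝ}
    (hR : ∀ᵐ x ∂P, |x| ≤ R) {F F' : ℝ → ℝ → ℝ} (hF : ∀ u, Continuous (F u))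
    (hF' : Continuous (Function.uncurry F'))
    (hderiv : ∀ u x, HasDerivAt (F · x) (F' u x) u) (u : ℝ) :
    HasDerivAt (fun u ↦ ∫ x, F u x ∂P) (∫ x, F' u x ∂P) u := by
  have hIcc : ∀ᵐ x ∂P, x ∈ Set.Icc (-R) R := hR.mono fun x hx ↦ abs_le.1 hx
  obtain ⟨C, hC⟩ := ((isCompact_closedBall u 1).prod
    (isCompact_Icc (a := -R) (b := R))).exists_bound_of_continuousOn hF'.continuousOn
  obtain ⟨D, hD⟩ := (isCompact_Icc (a := -R) (b := R)).exists_bound_of_continuousOn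
    (hF u).continuousOn
  refine (hasDerivAt_integral_of_dominated_loc_of_deriv_le (bound := fun _ ↦ C)
    (Metric.closedBall_mem_nhds u one_pos)
    (Eventually.of_forall fun v ↦ (hF v).aestronglyMeasurable) ?_
    (hF'.comp (Continuous.prodMk_right u)).aestronglyMeasurable ?_ (integrable_const C)
    (ae_of_all _ fun x v _ ↦ hderiv v x)).2
  · exact (integrable_const D).mono' (hF u).aestronglyMeasurable
      (hIcc.mono fun x hx ↦ hD x hx)
  · exact hIcc.mono fun x hx v hv ↦ hC (v, x) ⟨hv, hx⟩

lemma abs_tilt_le {R S s w x : ℝ} (hs : |s| ≤ S) (hx : |x| ≤ R) :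
    |s * w * x - s ^ 2 * x ^ 2 / 2| ≤ S * R * |w| + S ^ 2 * R ^ 2 / 2 := by
  have hsx : |s| * |x| ≤ S * R :=
    mul_le_mul hs hx (abs_nonneg x) ((abs_nonneg s).trans hs)
  have h1 : |s * w * x| ≤ S * R * |w| := by
    rw [abs_mul, abs_mul, mul_right_comm]
    exact mul_le_mul_of_nonneg_right hsx (abs_nonneg w)
  have h2 : |s ^ 2 * x ^ 2 / 2| ≤ S ^ 2 * R ^ 2 / 2 := by
    rw [abs_of_nonneg (by positivity), ← mul_pow, ← mul_pow, ← sq_abs (s * x), abs_mul]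
    gcongr
  exact (abs_sub _ _).trans (add_le_add h1 h2)

section tiltedMoment

variable {P : Measure ℝ} {R S : ℝ} {I : Set ℝ}

lemma hasDerivAt_tiltedMoment_right [IsFiniteMeasure P] (hR : ∀ᵐ x ∂P, |x| ≤ R) (k : ℕ) (s w : ℝ) :
    HasDerivAt (tiltedMoment P k s) (s * tiltedMoment P (k + 1) s w) w := by
  have h := hasDerivAt_integral_of_continuous_uncurry hR
    (F := fun w x ↦ x ^ k * exp (s * w * x - s ^ 2 * x ^ 2 / 2))
    (F' := fun w x ↦ s * (x ^ (k + 1) * exp (s * w * x - s ^ 2 * x ^ 2 / 2)))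
    (fun w ↦ by fun_prop) (by unfold Function.uncurry; fun_prop) (fun w x ↦ ?_) w
  · rwa [integral_const_mul] at h
  · have h1 : HasDerivAt (fun w ↦ s * w * x - s ^ 2 * x ^ 2 / 2) (s * x) w := by
      convert! ((((hasDerivAt_id w).const_mul s).mul_const x).sub_const _) using 1
      simp
    exact (h1.exp.const_mul (x ^ k)).congr_deriv (by ring)

lemma continuous_tiltedMoment [IsFiniteMeasure P] (hR : ∀ᵐ x ∂P, |x| ≤ R) (k : ℕ) (s : ℝ) :
    Continuous (tiltedMoment P k s) :=
  continuous_iff_continuousAt.2 fun w ↦ (hasDerivAt_tiltedMoment_right hR k s w).continuousAt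

lemma integrable_pow_mul_exp_tilt [IsFiniteMeasure P] (hR : ∀ᵐ x ∂P, |x| ≤ R) (k : ℕ) (s w : ℝ) :
    Integrable (fun x ↦ x ^ k * exp (s * w * x - s ^ 2 * x ^ 2 / 2)) P := by
  refine (integrable_const (R ^ k * exp (|s| * R * |w| + |s| ^ 2 * R ^ 2 / 2))).mono'
    (by fun_prop) (hR.mono fun x hx ↦ ?_)
  rw [norm_mul, norm_pow, norm_eq_abs, norm_eq_abs, abs_exp]
  exact mul_le_mul (pow_le_pow_left₀ (abs_nonneg x) hx k)
    (exp_le_exp.2 ((le_abs_self _).trans (abs_tilt_le le_rfl hx))) (exp_nonneg _)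
    (pow_nonneg ((abs_nonneg x).trans hx) k)

lemma hasDerivAt_tiltedMoment_zero_left [IsFiniteMeasure P] (hR : ∀ᵐ x ∂P, |x| ≤ R) (s w : ℝ) :
    HasDerivAt (fun s ↦ tiltedMoment P 0 s w)
      (w * tiltedMoment P 1 s w - s * tiltedMoment P 2 s w) s := by
  have h := hasDerivAt_integral_of_continuous_uncurry hR
    (F := fun s x ↦ x ^ 0 * exp (s * w * x - s ^ 2 * x ^ 2 / 2))
    (F' := fun s x ↦ w * (x ^ 1 * exp (s * w * x - s ^ 2 * x ^ 2 / 2)) -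
      s * (x ^ 2 * exp (s * w * x - s ^ 2 * x ^ 2 / 2)))
    (fun s ↦ by fun_prop) (by unfold Function.uncurry; fun_prop) (fun s x ↦ ?_) s
  · rwa [integral_sub ((integrable_pow_mul_exp_tilt hR 1 s w).const_mul w)
      ((integrable_pow_mul_exp_tilt hR 2 s w).const_mul s), integral_const_mul,
      integral_const_mul] at h
  · have h1 : HasDerivAt (fun s ↦ s * w * x - s ^ 2 * x ^ 2 / 2) (w * x - s * x ^ 2) s := by
      convert! (((hasDerivAt_id s).mul_const w).mul_const x).sub
        ((((hasDerivAt_id s).pow 2).mul_const (x ^ 2)).div_const 2) using 1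
      simp
      ring
    exact (h1.exp.const_mul (x ^ 0)).congr_deriv (by ring)

variable [IsProbabilityMeasure P]

lemma abs_tiltedMoment_le (hR : ∀ᵐ x ∂P, |x| ≤ R) (k : ℕ) {s : ℝ} (hs : |s| ≤ S) (w : ℝ) :
    |tiltedMoment P k s w| ≤ R ^ k * exp (S * R * |w| + S ^ 2 * R ^ 2 / 2) := by
  have h := norm_integral_le_of_norm_le_const (μ := P)
    (f := fun x ↦ x ^ k * exp (s * w * x - s ^ 2 * x ^ 2 / 2))
    (C := R ^ k * exp (S * R * |w| + S ^ 2 * R ^ 2 / 2)) (hR.mono fun x hx ↦ ?_)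
  · simpa [tiltedMoment] using h
  · rw [norm_mul, norm_pow, norm_eq_abs, norm_eq_abs, abs_exp]
    exact mul_le_mul (pow_le_pow_left₀ (abs_nonneg x) hx k)
      (exp_le_exp.2 ((le_abs_self _).trans (abs_tilt_le hs hx))) (exp_nonneg _)
      (pow_nonneg ((abs_nonneg x).trans hx) k)

lemma exp_neg_le_tiltedMoment_zero (hR : ∀ᵐ x ∂P, |x| ≤ R) {s : ℝ} (hs : |s| ≤ S) (w : ℝ) :
    exp (-(S * R * |w| + S ^ 2 * R ^ 2 / 2)) ≤ tiltedMoment P 0 s w := by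
  have h := integral_mono_ae (μ := P)
    (integrable_const (exp (-(S * R * |w| + S ^ 2 * R ^ 2 / 2))))
    (integrable_pow_mul_exp_tilt hR 0 s w) (hR.mono fun x hx ↦ ?_)
  · simpa [tiltedMoment] using h
  · simpa using neg_le_of_abs_le (abs_tilt_le hs hx)

lemma tiltedMoment_zero_pos (hR : ∀ᵐ x ∂P, |x| ≤ R) (s w : ℝ) : 0 < tiltedMoment P 0 s w :=
  (exp_pos _).trans_le (exp_neg_le_tiltedMoment_zero hR le_rfl w)

lemma expGrowth_tiltedMoment (hR : ∀ᵐ x ∂P, |x| ≤ R) (hR₀ : 0 ≤ R) (hI : ∀ s ∈ I, |s| ≤ S)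
    (k : ℕ) : ExpGrowth I (tiltedMoment P k) := by
  refine ⟨R ^ k * exp (S ^ 2 * R ^ 2 / 2), S * R, by positivity, fun s hs w ↦ ?_⟩
  refine (abs_tiltedMoment_le hR k (hI s hs) w).trans_eq ?_
  rw [exp_add]
  ring

lemma expGrowth_inv_tiltedMoment_zero (hR : ∀ᵐ x ∂P, |x| ≤ R) (hI : ∀ s ∈ I, |s| ≤ S) :
    ExpGrowth I fun s w ↦ (tiltedMoment P 0 s w)⁻¹ := by
  refine ⟨exp (S ^ 2 * R ^ 2 / 2), S * R, (exp_pos _).le, fun s hs w ↦ ?_⟩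
  rw [abs_of_pos (inv_pos.2 (tiltedMoment_zero_pos hR s w)), ← exp_add, add_comm]
  refine inv_le_of_inv_le₀ (exp_pos _) ?_
  rw [← exp_neg]
  exact exp_neg_le_tiltedMoment_zero hR (hI s hs) w

lemma expGrowth_log_tiltedMoment_zero (hR : ∀ᵐ x ∂P, |x| ≤ R) (hI : ∀ s ∈ I, |s| ≤ S) :
    ExpGrowth I fun s w ↦ log (tiltedMoment P 0 s w) := by
  refine ⟨exp (S ^ 2 * R ^ 2 / 2), S * R, (exp_pos _).le, fun s hs w ↦ ?_⟩
  rw [← exp_add, add_comm]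
  have hpos := tiltedMoment_zero_pos hR s w
  have hupper := (le_abs_self _).trans (abs_tiltedMoment_le hR 0 (hI s hs) w)
  rw [pow_zero, one_mul] at hupper
  have hlower := exp_neg_le_tiltedMoment_zero hR (hI s hs) w
  have h : |log (tiltedMoment P 0 s w)| ≤ S * R * |w| + S ^ 2 * R ^ 2 / 2 :=
    abs_le.2 ⟨(le_log_iff_exp_le hpos).2 hlower, (log_le_iff_le_exp hpos).2 hupper⟩
  linarith [add_one_le_exp (S * R * |w| + S ^ 2 * R ^ 2 / 2)]

lemma continuous_log_tiltedMoment_zero (hR : ∀ᵐ x ∂P, |x| ≤ R) (s : ℝ) :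
    Continuous fun w ↦ log (tiltedMoment P 0 s w) :=
  (continuous_tiltedMoment hR 0 s).log fun w ↦ (tiltedMoment_zero_pos hR s w).ne'

/-- Integrating the observation `s x₀ + W` against a test function amounts to weighting the
standard Gaussian by the tilted moments of the prior. -/
lemma integral_pow_mul_comp_add (hR : ∀ᵐ x ∂P, |x| ≤ R) (k : ℕ) {s : ℝ} {h : ℝ → ℝ}
    (hcont : Continuous h) (hgrowth : ExpGrowth {s} fun _ ↦ h) :
    ∫ x, ∫ w, x ^ k * h (s * x + w) ∂gaussianReal 0 1 ∂P =
      ∫ w, tiltedMoment P k s w * h w ∂gaussianReal 0 1 := by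
  have hint : Integrable (Function.uncurry fun x w ↦
      x ^ k * exp (s * w * x - s ^ 2 * x ^ 2 / 2) * h w) (P.prod (gaussianReal 0 1)) := by
    obtain ⟨C, c, hC, hh⟩ := hgrowth
    have hdom : Integrable (fun w ↦ R ^ k * exp (|s| ^ 2 * R ^ 2 / 2) * C *
        exp ((|s| * R + c) * |w|)) (gaussianReal 0 1) :=
      (integrable_exp_mul_abs_gaussianReal _).const_mul _
    refine (hdom.comp_snd P).mono' (by unfold Function.uncurry; fun_prop) ?_
    filter_upwards [Measure.quasiMeasurePreserving_fst.ae hR] with ⟨x, w⟩ hx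
    simp only [Function.uncurry_apply_pair, norm_mul, norm_pow, norm_eq_abs, abs_exp] at hx ⊢
    calc |x| ^ k * exp (s * w * x - s ^ 2 * x ^ 2 / 2) * |h w|
        ≤ R ^ k * exp (|s| * R * |w| + |s| ^ 2 * R ^ 2 / 2) * (C * exp (c * |w|)) := by
          have h₀ : 0 ≤ R := (abs_nonneg x).trans hx
          gcongr
          · exact (le_abs_self _).trans (abs_tilt_le le_rfl hx)
          · exact hh s rfl w
      _ = _ := by
          rw [exp_add, add_mul, exp_add]
          ring
  calc ∫ x, ∫ w, x ^ k * h (s * x + w) ∂gaussianReal 0 1 ∂P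
      = ∫ x, ∫ w, x ^ k * exp (s * w * x - s ^ 2 * x ^ 2 / 2) * h w ∂gaussianReal 0 1 ∂P := by
        congr 1 with x
        rw [integral_const_mul, integral_comp_const_add_gaussianReal, ← integral_const_mul]
        congr 1 with w
        ring_nf
    _ = ∫ w, ∫ x, x ^ k * exp (s * w * x - s ^ 2 * x ^ 2 / 2) * h w ∂P ∂gaussianReal 0 1 :=
        integral_integral_swap hint
    _ = _ := by simp only [integral_mul_const, tiltedMoment]

lemma hasDerivAt_integral_tiltedMoment_mul_log (hR : ∀ᵐ x ∂P, |x| ≤ R) (hR₀ : 0 ≤ R) (s : ℝ) :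
    HasDerivAt
      (fun s ↦ ∫ w, tiltedMoment P 0 s w * log (tiltedMoment P 0 s w) ∂gaussianReal 0 1)
      (s * ∫ w, tiltedMoment P 1 s w * (tiltedMoment P 1 s w / tiltedMoment P 0 s w)
        ∂gaussianReal 0 1) s := by
  have hI : ∀ r ∈ Metric.closedBall s 1, |r| ≤ |s| + 1 := fun r hr ↦ by
    have h1 : |r - s| ≤ 1 := hr
    have h2 := abs_sub_abs_le_abs_sub r s
    linarith
  have hs : s ∈ Metric.closedBall s 1 := Metric.mem_closedBall_self zero_le_one
  have hM := expGrowth_tiltedMoment hR hR₀ hI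
  have hlog := expGrowth_log_tiltedMoment_zero hR hI
  have hinv := expGrowth_inv_tiltedMoment_zero hR hI
  have hs' := ExpGrowth.id_left hI
  have cM := continuous_tiltedMoment hR
  have clog := continuous_log_tiltedMoment_zero hR
  have cinv : Continuous fun w ↦ (tiltedMoment P 0 s w)⁻¹ :=
    (cM 0 s).inv₀ fun w ↦ (tiltedMoment_zero_pos hR s w).ne'
  have hlog1 := (ExpGrowth.const 1).add hlog
  have hderiv : ExpGrowth (Metric.closedBall s 1) fun s w ↦
      (1 + log (tiltedMoment P 0 s w)) * (w * tiltedMoment P 1 s w - s * tiltedMoment P 2 s w) :=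
    hlog1.mul ((ExpGrowth.id_right.mul (hM 1)).sub (hs'.mul (hM 2)))
  have key : HasDerivAt
      (fun s ↦ ∫ w, tiltedMoment P 0 s w * log (tiltedMoment P 0 s w) ∂gaussianReal 0 1)
      (∫ w, (1 + log (tiltedMoment P 0 s w)) *
        (w * tiltedMoment P 1 s w - s * tiltedMoment P 2 s w) ∂gaussianReal 0 1) s := by
    obtain ⟨C, c, -, hC⟩ := id hderiv
    refine (hasDerivAt_integral_of_dominated_loc_of_deriv_le
      (F' := fun s w ↦ (1 + log (tiltedMoment P 0 s w)) *
        (w * tiltedMoment P 1 s w - s * tiltedMoment P 2 s w))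
      (Metric.closedBall_mem_nhds s one_pos)
      (Eventually.of_forall fun r ↦ ((cM 0 r).mul (clog r)).aestronglyMeasurable)
      (((hM 0).mul hlog).integrable hs ((cM 0 s).mul (clog s)))
      (by have := cM 1 s; have := cM 2 s; have := clog s; fun_prop)
      (ae_of_all _ fun w r hr ↦ hC r hr w)
      ((integrable_exp_mul_abs_gaussianReal c).const_mul C)
      (ae_of_all _ fun w r _ ↦ ?_)).2
    have hpos := tiltedMoment_zero_pos hR r w
    have h0 := hasDerivAt_tiltedMoment_zero_left hR r w
    refine (h0.mul (h0.log hpos.ne')).congr_deriv ?_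
    field_simp
    ring
  have ibp := integral_id_mul_gaussianReal
    (f := fun w ↦ (1 + log (tiltedMoment P 0 s w)) * tiltedMoment P 1 s w)
    (f' := fun w ↦ s * (tiltedMoment P 1 s w * (tiltedMoment P 1 s w *
        (tiltedMoment P 0 s w)⁻¹)) +
      (1 + log (tiltedMoment P 0 s w)) * (s * tiltedMoment P 2 s w))
    (fun w ↦ by
      have h0 := (hasDerivAt_tiltedMoment_right hR 0 s w).log (tiltedMoment_zero_pos hR s w).ne'
      refine ((h0.const_add 1).mul (hasDerivAt_tiltedMoment_right hR 1 s w)).congr_deriv ?_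
      ring)
    ((hlog1.mul (hM 1)).integrable hs (by have := cM 1 s; have := clog s; fun_prop))
    (((hs'.mul ((hM 1).mul ((hM 1).mul hinv))).add (hlog1.mul (hs'.mul (hM 2)))).integrable hs
      (by have := cM 1 s; have := cM 2 s; have := clog s; fun_prop))
    ((ExpGrowth.id_right.mul (hlog1.mul (hM 1))).integrable hs
      (by have := cM 1 s; have := clog s; fun_prop))
  have i1 := (ExpGrowth.id_right.mul (hlog1.mul (hM 1))).integrable hs
      (by have := cM 1 s; have := clog s; fun_prop)
  have i2 := (hlog1.mul (hs'.mul (hM 2))).integrable hs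
      (by have := cM 2 s; have := clog s; fun_prop)
  have i3 := (hs'.mul ((hM 1).mul ((hM 1).mul hinv))).integrable hs
      (by have := cM 1 s; fun_prop)
  refine key.congr_deriv ?_
  rw [integral_add i3 i2] at ibp
  calc ∫ w, (1 + log (tiltedMoment P 0 s w)) *
        (w * tiltedMoment P 1 s w - s * tiltedMoment P 2 s w) ∂gaussianReal 0 1
      = ∫ w, (w * ((1 + log (tiltedMoment P 0 s w)) * tiltedMoment P 1 s w) -
          (1 + log (tiltedMoment P 0 s w)) * (s * tiltedMoment P 2 s w)) ∂gaussianReal 0 1 := by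
        congr 1 with w
        ring
    _ = _ := by
        rw [integral_sub i1 i2, ibp, add_sub_cancel_right, integral_const_mul]
        simp only [div_eq_mul_inv]

lemma fSE_sq (hR : ∀ᵐ x ∂P, |x| ≤ R) (hR₀ : 0 ≤ R) {s : ℝ} (hs : 0 ≤ s) :
    fSE P (s ^ 2) = ∫ w, tiltedMoment P 1 s w * (tiltedMoment P 1 s w / tiltedMoment P 0 s w)
      ∂gaussianReal 0 1 := by
  have hI : ∀ r ∈ ({s} : Set ℝ), |r| ≤ |s| := by simp
  obtain ⟨C, c, hC, hh⟩ := (expGrowth_tiltedMoment hR hR₀ hI 1).mul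
    (expGrowth_inv_tiltedMoment_zero hR hI)
  rw [← integral_pow_mul_comp_add hR 1 (h := fun w ↦ tiltedMoment P 1 s w / tiltedMoment P 0 s w)
    ((continuous_tiltedMoment hR 1 s).div₀ (continuous_tiltedMoment hR 0 s)
      fun w ↦ (tiltedMoment_zero_pos hR s w).ne')
    ⟨C, c, hC, fun _ _ w ↦ by simpa only [div_eq_mul_inv] using hh s rfl w⟩]
  have harg (x w : ℝ) : s ^ 2 * x + s * w = s * (s * x + w) := by ring
  simp only [fSE, sqrt_sq hs, pow_one, ← fIn_sq, harg]

lemma integral_log_Zfun_sq (hR : ∀ᵐ x ∂P, |x| ≤ R) {s : ℝ} (hs : 0 ≤ s) :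
    ∫ x₀, ∫ w, log (Zfun P (s ^ 2) (s ^ 2 * x₀ + √(s ^ 2) * w)) ∂gaussianReal 0 1 ∂P =
      ∫ w, tiltedMoment P 0 s w * log (tiltedMoment P 0 s w) ∂gaussianReal 0 1 := by
  obtain ⟨C, c, hC, hh⟩ := expGrowth_log_tiltedMoment_zero hR (I := {s}) (S := |s|) (by simp)
  rw [← integral_pow_mul_comp_add hR 0 (continuous_log_tiltedMoment_zero hR s)
    ⟨C, c, hC, fun _ _ w ↦ hh s rfl w⟩]
  have harg (x w : ℝ) : s ^ 2 * x + s * w = s * (s * x + w) := by ring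
  simp only [sqrt_sq hs, pow_zero, one_mul, ← Zfun_sq, harg]

end tiltedMoment

/-- **Derivative of the rank-one Bayes-optimal replica free energy**: for a compactly
supported prior `P` and `Δ > 0`, `φ` is differentiable on `(0, ∞)` with
`φ'(m) = (f^{SE}(m/Δ) − m)/(2Δ)`. -/
theorem replica_free_energy_derivative
    (P : Measure ℝ) [IsProbabilityMeasure P]
    (K : Set ℝ) (hK : IsCompact K) (hPK : P Kᶜ = 0)
    (Δ : ℝ) (hΔ : 0 < Δ) :
    ∀ m : ℝ, 0 < m →
      HasDerivAt (replicaPhi P Δ) ((fSE P (m / Δ) - m) / (2 * Δ)) m := by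
  intro m hm
  obtain ⟨R₀, hR₀⟩ := hK.isBounded.exists_norm_le
  have hR : ∀ᵐ x ∂P, |x| ≤ |R₀| := by
    filter_upwards [compl_mem_ae_iff.2 hPK] with x hx
    exact (hR₀ x (by simpa using hx)).trans (le_abs_self R₀)
  have hmΔ : 0 < m / Δ := div_pos hm hΔ
  have hsqrt : HasDerivAt (fun m ↦ √(m / Δ)) (1 / Δ / (2 * √(m / Δ))) m :=
    ((hasDerivAt_id m).div_const Δ).sqrt hmΔ.ne'
  have hH := (hasDerivAt_integral_tiltedMoment_mul_log hR (abs_nonneg R₀) √(m / Δ)).comp m hsqrt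
  have hphi := hH.sub (((hasDerivAt_id m).pow 2).div_const (4 * Δ))
  rw [← fSE_sq hR (abs_nonneg R₀) (sqrt_nonneg _), sq_sqrt hmΔ.le] at hphi
  refine (hphi.congr_of_eventuallyEq ?_).congr_deriv ?_
  · filter_upwards [lt_mem_nhds hm] with r hr
    have h := integral_log_Zfun_sq hR (sqrt_nonneg (r / Δ))
    rw [sq_sqrt (div_pos hr hΔ).le] at h
    simp only [replicaPhi, h]
    rfl
  · have hs : √(m / Δ) ≠ 0 := (sqrt_pos.2 hmΔ).ne'
    simp only [id]
    field_simp
    norm_num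
    ring
end

section
/- Large-rank limit of the symmetric community-detection state-evolution function: for every β > 0 with β ≠ 2, lim_{r→∞} M_r( β·r·log r ) = 1 if β > 2 and = 0 if β < 2. -/
open MeasureTheory ProbabilityTheory Filter

/-- The symmetric community-detection state-evolution function
`M_r(x) = (1/(r−1)) · ( r · E[ e^{x/r + U₁√(x/r)} / ( e^{x/r + U₁√(x/r)}
+ Σ_{i=2}^r e^{U_i√(x/r)} ) ] − 1 )`, where `U₁, …, U_r` are i.i.d. standard Gaussians
(the first coordinate is `p.1`, the remaining `r − 1` coordinates are `p.2`). -/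
noncomputable def Mr (r : ℕ) (x : ℝ) : ℝ :=
  (1 / ((r : ℝ) - 1)) *
    ((r : ℝ) *
      (∫ p : ℝ × (Fin (r - 1) → ℝ),
        Real.exp (x / r + p.1 * Real.sqrt (x / r)) /
          (Real.exp (x / r + p.1 * Real.sqrt (x / r)) +
            ∑ i, Real.exp (p.2 i * Real.sqrt (x / r)))
        ∂((gaussianReal 0 1).prod (Measure.pi fun _ : Fin (r - 1) => gaussianReal 0 1)))
      - 1)

/-- The mean softmax weight of a planted coordinate with signal `s ^ 2` and noise level `s`
among `n` independent pure-noise coordinates. -/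
noncomputable def softmaxMean (n : ℕ) (s : ℝ) : ℝ :=
  ∫ p : ℝ × (Fin n → ℝ),
    Real.exp (s ^ 2 + p.1 * s) / (Real.exp (s ^ 2 + p.1 * s) + ∑ i, Real.exp (p.2 i * s))
    ∂((gaussianReal 0 1).prod (Measure.pi fun _ : Fin n => gaussianReal 0 1))

lemma exp_div_exp_add_le {a b α S : ℝ} (hα₀ : 0 ≤ α) (hα₁ : α ≤ 1) (hS : Real.exp b ≤ S) :
    Real.exp a / (Real.exp a + S) ≤ Real.exp (α * (a - b)) := by
  have hS₀ : 0 < S := (Real.exp_pos b).trans_le hS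
  rcases le_total b a with h | h
  · calc Real.exp a / (Real.exp a + S) ≤ 1 :=
          div_le_one_of_le₀ (by linarith) (by positivity)
      _ ≤ _ := Real.one_le_exp (mul_nonneg hα₀ (by linarith))
  · calc Real.exp a / (Real.exp a + S) ≤ Real.exp a / Real.exp b := by
          gcongr
          linarith [Real.exp_pos a]
      _ = Real.exp (a - b) := (Real.exp_sub a b).symm
      _ ≤ _ := Real.exp_le_exp.2 (by nlinarith)

lemma one_sub_le_exp_div_exp_add {a b α S : ℝ} (hα₀ : 0 ≤ α) (hS : 0 ≤ S) :
    1 - S * Real.exp (-b) - Real.exp (α * (b - a)) ≤ Real.exp a / (Real.exp a + S) := by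
  have ha := Real.exp_pos a
  rcases le_total b a with h | h
  · have h₁ : Real.exp a / (Real.exp a + S) = 1 - S / (Real.exp a + S) := by
      field_simp
      ring
    have h₂ : S / (Real.exp a + S) ≤ S * Real.exp (-b) := by
      rw [Real.exp_neg, ← div_eq_mul_inv]
      gcongr
      linarith [Real.exp_le_exp.2 h]
    linarith [Real.exp_pos (α * (b - a))]
  · have h₁ : 1 ≤ Real.exp (α * (b - a)) := Real.one_le_exp (mul_nonneg hα₀ (by linarith))
    have h₂ : 0 ≤ S * Real.exp (-b) := by positivity
    have h₃ : 0 ≤ Real.exp a / (Real.exp a + S) := by positivity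
    linarith

lemma integral_exp_mul_add_gaussianReal (t c : ℝ) :
    ∫ x, Real.exp (t * x + c) ∂(gaussianReal 0 1) = Real.exp (t ^ 2 / 2 + c) := by
  simp_rw [Real.exp_add, integral_mul_const]
  congr 1
  have h := congrFun (mgf_fun_id_gaussianReal (μ := 0) (v := 1)) t
  simpa [mgf] using h

lemma integrable_exp_mul_add_gaussianReal (t c : ℝ) :
    Integrable (fun x => Real.exp (t * x + c)) (gaussianReal 0 1) := by
  simp_rw [Real.exp_add]
  exact (integrable_exp_mul_gaussianReal t).mul_const _

lemma gaussianReal_Ioi_ge {t : ℝ} (ht : 0 ≤ t) :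
    (√(2 * Real.pi))⁻¹ * Real.exp (-(t + 1) ^ 2 / 2) ≤
      (gaussianReal 0 1).real (Set.Ioi t) := by
  have hsub : (gaussianReal 0 1).real (Set.Ioc t (t + 1)) ≤
      (gaussianReal 0 1).real (Set.Ioi t) :=
    measureReal_mono Set.Ioc_subset_Ioi_self
  refine le_trans ?_ hsub
  rw [measureReal_def, gaussianReal_apply_eq_integral _ one_ne_zero,
    ENNReal.toReal_ofReal (integral_nonneg fun _ => gaussianPDFReal_nonneg _ _ _)]
  have h := setIntegral_mono_on (μ := volume) (s := Set.Ioc t (t + 1))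
    (f := fun _ => (√(2 * Real.pi))⁻¹ * Real.exp (-(t + 1) ^ 2 / 2))
    (g := gaussianPDFReal 0 1) (integrableOn_const (by simp)) (integrable_gaussianPDFReal _ _).integrableOn
    measurableSet_Ioc (fun x hx => by
      simp only [gaussianPDFReal_def, NNReal.coe_one, mul_one, sub_zero]
      gcongr
      · linarith [hx.1]
      · exact hx.2)
  simpa using h

lemma integrable_softmax (n : ℕ) (s : ℝ) :
    Integrable (fun p : ℝ × (Fin n → ℝ) => Real.exp (s ^ 2 + p.1 * s) /
      (Real.exp (s ^ 2 + p.1 * s) + ∑ i, Real.exp (p.2 i * s)))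
      ((gaussianReal 0 1).prod (Measure.pi fun _ : Fin n => gaussianReal 0 1)) := by
  refine Integrable.of_bound (Measurable.aestronglyMeasurable (by fun_prop)) 1 (ae_of_all _ fun p => ?_)
  have hS : 0 ≤ ∑ i, Real.exp (p.2 i * s) := by positivity
  rw [Real.norm_of_nonneg (by positivity)]
  exact div_le_one_of_le₀ (by linarith) (by positivity)

lemma softmaxMean_le_one (n : ℕ) (s : ℝ) : softmaxMean n s ≤ 1 := by
  have h := integral_mono (integrable_softmax n s) (integrable_const (1 : ℝ)) fun p => by
    have hS : 0 ≤ ∑ i, Real.exp (p.2 i * s) := by positivity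
    exact div_le_one_of_le₀ (by linarith) (by positivity)
  simpa [softmaxMean] using h

lemma softmaxMean_nonneg (n : ℕ) (s : ℝ) : 0 ≤ softmaxMean n s :=
  integral_nonneg fun _ => by positivity

lemma measureReal_pi_forall_le (n : ℕ) (t : ℝ) :
    (Measure.pi fun _ : Fin n => gaussianReal 0 1).real (Set.univ.pi fun _ => Set.Iic t) =
      (1 - (gaussianReal 0 1).real (Set.Ioi t)) ^ n := by
  rw [measureReal_def, Measure.pi_pi, ← probReal_compl_eq_one_sub measurableSet_Ioi]
  simp [measureReal_def]

lemma softmaxMean_le {n : ℕ} {s δ : ℝ} (hs : 0 ≤ s) (hδ₀ : 0 ≤ δ) (hδ₁ : δ ≤ 1) :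
    softmaxMean n s ≤ Real.exp (-(δ ^ 2 * s ^ 2 / 2)) +
      Real.exp (-(n * ((√(2 * Real.pi))⁻¹ * Real.exp (-((1 + δ) * s + 1) ^ 2 / 2)))) := by
  set t := (1 + δ) * s with ht_def
  have ht : 0 ≤ t := by positivity
  set B : Set (Fin n → ℝ) := Set.univ.pi fun _ => Set.Iic t
  have hB : MeasurableSet B := MeasurableSet.univ_pi fun _ => measurableSet_Iic
  have hint₁ : Integrable (fun p : ℝ × (Fin n → ℝ) =>
      Real.exp (δ * s * p.1 + -(δ ^ 2 * s ^ 2)))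
      ((gaussianReal 0 1).prod (Measure.pi fun _ : Fin n => gaussianReal 0 1)) :=
    (integrable_exp_mul_add_gaussianReal _ _).comp_fst _
  have hint₂ : Integrable (fun p : ℝ × (Fin n → ℝ) => B.indicator (1 : (Fin n → ℝ) → ℝ) p.2)
      ((gaussianReal 0 1).prod (Measure.pi fun _ : Fin n => gaussianReal 0 1)) :=
    Integrable.comp_snd ((integrable_const (1 : ℝ)).indicator hB) _
  have hmono : softmaxMean n s ≤ ∫ p : ℝ × (Fin n → ℝ),
      (Real.exp (δ * s * p.1 + -(δ ^ 2 * s ^ 2)) + B.indicator (1 : (Fin n → ℝ) → ℝ) p.2)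
      ∂((gaussianReal 0 1).prod (Measure.pi fun _ : Fin n => gaussianReal 0 1)) := by
    refine integral_mono (integrable_softmax n s) (hint₁.add hint₂) fun p => ?_
    by_cases hp : p.2 ∈ B
    · have hS : 0 ≤ ∑ i, Real.exp (p.2 i * s) := by positivity
      have h₁ : Real.exp (s ^ 2 + p.1 * s) /
          (Real.exp (s ^ 2 + p.1 * s) + ∑ i, Real.exp (p.2 i * s)) ≤ 1 :=
        div_le_one_of_le₀ (by linarith) (by positivity)
      simp only [Set.indicator_of_mem hp, Pi.one_apply]
      linarith [Real.exp_pos (δ * s * p.1 + -(δ ^ 2 * s ^ 2))]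
    · obtain ⟨i, hi⟩ : ∃ i, t < p.2 i := by
        simpa only [B, Set.mem_univ_pi, Set.mem_Iic, not_forall, not_le] using hp
      have hS : Real.exp (t * s) ≤ ∑ i, Real.exp (p.2 i * s) :=
        (Real.exp_le_exp.2 (by gcongr)).trans
          (Finset.single_le_sum (f := fun i => Real.exp (p.2 i * s))
            (fun _ _ => (Real.exp_pos _).le) (Finset.mem_univ i))
      simp only [Set.indicator_of_notMem hp, add_zero]
      refine (exp_div_exp_add_le hδ₀ hδ₁ hS).trans_eq ?_
      congr 1
      rw [ht_def]
      ring
  refine hmono.trans ?_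
  rw [integral_add hint₁ hint₂,
    integral_fun_fst (fun x => Real.exp (δ * s * x + -(δ ^ 2 * s ^ 2))),
    integral_fun_snd (B.indicator (1 : (Fin n → ℝ) → ℝ)), integral_exp_mul_add_gaussianReal,
    integral_indicator_one hB, measureReal_pi_forall_le]
  simp only [probReal_univ, one_smul]
  gcongr ?_ + ?_
  · exact Real.exp_le_exp.2 (by nlinarith)
  · rw [← mul_neg, Real.exp_nat_mul]
    refine pow_le_pow_left₀ (sub_nonneg.2 measureReal_le_one) ?_ n
    exact (Real.one_sub_le_exp_neg _).trans
      (Real.exp_le_exp.2 (neg_le_neg (gaussianReal_Ioi_ge ht)))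

lemma le_softmaxMean {n : ℕ} {s δ : ℝ} (hδ₀ : 0 ≤ δ) :
    1 - n * Real.exp (-((1 / 2 - δ) * s ^ 2)) - Real.exp (-(δ ^ 2 * s ^ 2 / 2)) ≤
      softmaxMean n s := by
  set b := (1 - δ) * s ^ 2 with hb
  have hexp (i : Fin n) : Integrable (fun u : Fin n → ℝ => Real.exp (s * u i + -b))
      (Measure.pi fun _ : Fin n => gaussianReal 0 1) :=
    integrable_comp_eval (μ := fun _ : Fin n => gaussianReal 0 1) (i := i)
      (integrable_exp_mul_add_gaussianReal s (-b))
  have hint₁ : Integrable (fun p : ℝ × (Fin n → ℝ) => ∑ i, Real.exp (s * p.2 i + -b))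
      ((gaussianReal 0 1).prod (Measure.pi fun _ : Fin n => gaussianReal 0 1)) :=
    Integrable.comp_snd (integrable_finsetSum _ fun i _ => hexp i) _
  have hint₀ : Integrable (fun p : ℝ × (Fin n → ℝ) => 1 - ∑ i, Real.exp (s * p.2 i + -b))
      ((gaussianReal 0 1).prod (Measure.pi fun _ : Fin n => gaussianReal 0 1)) :=
    (integrable_const _).sub hint₁
  have hint₂ : Integrable (fun p : ℝ × (Fin n → ℝ) =>
      Real.exp (-(δ * s) * p.1 + -(δ ^ 2 * s ^ 2)))
      ((gaussianReal 0 1).prod (Measure.pi fun _ : Fin n => gaussianReal 0 1)) :=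
    (integrable_exp_mul_add_gaussianReal _ _).comp_fst _
  have hmono : ∫ p : ℝ × (Fin n → ℝ),
      (1 - ∑ i, Real.exp (s * p.2 i + -b) - Real.exp (-(δ * s) * p.1 + -(δ ^ 2 * s ^ 2)))
      ∂((gaussianReal 0 1).prod (Measure.pi fun _ : Fin n => gaussianReal 0 1)) ≤
      softmaxMean n s := by
    refine integral_mono (hint₀.sub hint₂)
      (integrable_softmax n s) fun p => ?_
    refine le_trans (le_of_eq ?_) (one_sub_le_exp_div_exp_add (b := b) hδ₀ (by positivity))
    rw [Finset.sum_mul]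
    congr 2
    · simp_rw [← Real.exp_add, mul_comm s]
    · rw [hb]
      ring
  refine le_trans (le_of_eq ?_) hmono
  rw [integral_sub hint₀ hint₂,
    integral_sub (integrable_const _) hint₁,
    integral_fun_fst (fun x => Real.exp (-(δ * s) * x + -(δ ^ 2 * s ^ 2))),
    integral_fun_snd (fun u : Fin n → ℝ => ∑ i, Real.exp (s * u i + -b)),
    integral_exp_mul_add_gaussianReal, integral_finsetSum _ fun i _ => hexp i]
  have hcoord (i : Fin n) : ∫ u : Fin n → ℝ, Real.exp (s * u i + -b)
      ∂(Measure.pi fun _ : Fin n => gaussianReal 0 1) = Real.exp (s ^ 2 / 2 + -b) := by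
    rw [← integral_exp_mul_add_gaussianReal]
    exact integral_comp_eval (μ := fun _ : Fin n => gaussianReal 0 1) (i := i)
      (integrable_exp_mul_add_gaussianReal s (-b)).aestronglyMeasurable
  simp only [hcoord, integral_const, probReal_univ, one_smul, Finset.sum_const,
    Finset.card_univ, Fintype.card_fin, nsmul_eq_mul]
  congr 3
  · rw [hb]
    congr 1
    ring
  · ring

lemma tendsto_sqrt_mul_log_atTop {β : ℝ} (hβ : 0 < β) :
    Tendsto (fun r : ℕ => √(β * Real.log r)) atTop atTop :=
  Real.tendsto_sqrt_atTop.comp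
    ((Real.tendsto_log_atTop.comp tendsto_natCast_atTop_atTop).const_mul_atTop hβ)

lemma tendsto_exp_neg_mul_sq {c : ℝ} (hc : 0 < c) :
    Tendsto (fun s : ℝ => Real.exp (-(c * s ^ 2))) atTop (nhds 0) :=
  Real.tendsto_exp_neg_atTop_nhds_zero.comp ((tendsto_pow_atTop two_ne_zero).const_mul_atTop hc)

lemma natCast_eq_exp_sqrt_sq_div {β : ℝ} (hβ : 0 < β) {r : ℕ} (hr : 1 ≤ r) :
    (r : ℝ) = Real.exp (√(β * Real.log r) ^ 2 / β) := by
  have hr' : (1 : ℝ) ≤ r := by exact_mod_cast hr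
  rw [Real.sq_sqrt (mul_nonneg hβ.le (Real.log_nonneg hr')), mul_div_cancel_left₀ _ hβ.ne',
    Real.exp_log (by linarith)]

lemma tendsto_softmaxMean_one {β : ℝ} (hβ : 2 < β) :
    Tendsto (fun r : ℕ => softmaxMean (r - 1) √(β * Real.log r)) atTop (nhds 1) := by
  have hβ₀ : 0 < β := by linarith
  have hinv : 1 / β < 1 / 2 := one_div_lt_one_div_of_lt two_pos hβ
  obtain ⟨δ, hδ₀, hδ⟩ : ∃ δ, 0 < δ ∧ δ < 1 / 2 - 1 / β := exists_between (by linarith)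
  have hs := tendsto_sqrt_mul_log_atTop hβ₀
  have h₁ := (tendsto_exp_neg_mul_sq (c := 1 / 2 - δ - 1 / β) (by linarith)).comp hs
  have h₂ := (tendsto_exp_neg_mul_sq (c := δ ^ 2 / 2) (by positivity)).comp hs
  have hlower := (h₁.const_sub 1).sub h₂
  simp only [sub_zero] at hlower
  refine tendsto_of_tendsto_of_tendsto_of_le_of_le' hlower tendsto_const_nhds ?_
    (Eventually.of_forall fun r => softmaxMean_le_one _ _)
  filter_upwards [eventually_ge_atTop 1] with r hr
  refine le_trans ?_ (le_softmaxMean hδ₀.le)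
  simp only [Function.comp_apply]
  have hcast : ((r - 1 : ℕ) : ℝ) ≤ Real.exp (√(β * Real.log r) ^ 2 / β) := by
    rw [← natCast_eq_exp_sqrt_sq_div hβ₀ hr]
    exact_mod_cast Nat.sub_le r 1
  have hprod := mul_le_mul_of_nonneg_right hcast
    (Real.exp_pos (-((1 / 2 - δ) * √(β * Real.log r) ^ 2))).le
  rw [← Real.exp_add] at hprod
  gcongr 1 - ?_ - Real.exp ?_
  · refine hprod.trans_eq ?_
    congr 1
    ring
  · exact le_of_eq (by ring)

lemma tendsto_softmaxMean_zero {β : ℝ} (hβ₀ : 0 < β) (hβ : β < 2) :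
    Tendsto (fun r : ℕ => softmaxMean (r - 1) √(β * Real.log r)) atTop (nhds 0) := by
  obtain ⟨δ, hδ₀, hδ₁, hδ⟩ : ∃ δ : ℝ, 0 < δ ∧ δ ≤ 1 ∧ (1 + δ) ^ 2 / 2 < 1 / β := by
    have hinv : 1 / 2 < 1 / β := one_div_lt_one_div_of_lt hβ₀ hβ
    refine ⟨min 1 ((1 / β - 1 / 2) / 2), lt_min one_pos (by linarith), min_le_left _ _, ?_⟩
    have h₀ : 0 < min 1 ((1 / β - 1 / 2) / 2) := lt_min one_pos (by linarith)
    have h₁ := min_le_left 1 ((1 / β - 1 / 2) / 2)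
    have h₂ := min_le_right 1 ((1 / β - 1 / 2) / 2)
    nlinarith
  have hs := tendsto_sqrt_mul_log_atTop hβ₀
  set η := 1 / β - (1 + δ) ^ 2 / 2 with hη
  have hη₀ : 0 < η := by linarith
  have hrate : Tendsto (fun s : ℝ => (√(2 * Real.pi))⁻¹ / 2 *
      Real.exp (s * (η * s - (1 + δ)) - 1 / 2)) atTop atTop := by
    refine Tendsto.const_mul_atTop (by positivity) (Real.tendsto_exp_atTop.comp ?_)
    exact tendsto_atTop_add_const_right _ _ (tendsto_id.atTop_mul_atTop₀
      (tendsto_atTop_add_const_right _ _ (tendsto_id.const_mul_atTop hη₀)))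
  have h₁ := (tendsto_exp_neg_mul_sq (c := δ ^ 2 / 2) (by positivity)).comp hs
  have h₂ := (Real.tendsto_exp_neg_atTop_nhds_zero.comp hrate).comp hs
  have hupper := h₁.add h₂
  simp only [add_zero] at hupper
  refine tendsto_of_tendsto_of_tendsto_of_le_of_le' tendsto_const_nhds hupper
    (Eventually.of_forall fun r => softmaxMean_nonneg _ _) ?_
  filter_upwards [eventually_ge_atTop 2] with r hr
  refine (softmaxMean_le (Real.sqrt_nonneg _) hδ₀.le hδ₁).trans ?_
  simp only [Function.comp_apply]
  set s := √(β * Real.log r)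
  have hcast : Real.exp (s ^ 2 / β) / 2 ≤ ((r - 1 : ℕ) : ℝ) := by
    rw [← natCast_eq_exp_sqrt_sq_div hβ₀ (by lia), Nat.cast_sub (by lia), Nat.cast_one]
    have hr' : (2 : ℝ) ≤ r := by exact_mod_cast hr
    linarith
  gcongr Real.exp ?_ + Real.exp (-?_)
  · exact le_of_eq (by ring)
  · refine le_trans (le_of_eq ?_) (mul_le_mul_of_nonneg_right hcast (by positivity))
    have hexp : s * (η * s - (1 + δ)) - 1 / 2 =
        s ^ 2 / β + -((1 + δ) * s + 1) ^ 2 / 2 := by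
      rw [hη]
      ring
    rw [hexp, Real.exp_add]
    ring

lemma Mr_eq_softmaxMean {r : ℕ} {x : ℝ} (hx : 0 ≤ x / r) :
    Mr r x = (1 / ((r : ℝ) - 1)) * ((r : ℝ) * softmaxMean (r - 1) √(x / r) - 1) := by
  simp only [Mr, softmaxMean, Real.sq_sqrt hx]

lemma tendsto_Mr_of_tendsto_softmaxMean {β l : ℝ} (hβ : 0 < β)
    (h : Tendsto (fun r : ℕ => softmaxMean (r - 1) √(β * Real.log r)) atTop (nhds l)) :
    Tendsto (fun r : ℕ => Mr r (β * r * Real.log r)) atTop (nhds l) := by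
  have hinv : Tendsto (fun r : ℕ => ((r : ℝ) - 1)⁻¹) atTop (nhds 0) :=
    tendsto_inv_atTop_zero.comp
      (tendsto_atTop_add_const_right _ _ tendsto_natCast_atTop_atTop)
  have hlim : Tendsto (fun r : ℕ => softmaxMean (r - 1) √(β * Real.log r) +
      ((r : ℝ) - 1)⁻¹ * (softmaxMean (r - 1) √(β * Real.log r) - 1)) atTop (nhds l) := by
    simpa using h.add (hinv.mul (h.sub_const 1))
  refine hlim.congr' ?_
  filter_upwards [eventually_ge_atTop 2] with r hr
  have hr' : (2 : ℝ) ≤ r := by exact_mod_cast hr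
  have hdiv : β * r * Real.log r / r = β * Real.log r := by
    field_simp
  have hlog : 0 ≤ Real.log r := Real.log_nonneg (by linarith)
  rw [Mr_eq_softmaxMean (by rw [hdiv]; positivity), hdiv]
  have hne : (r : ℝ) - 1 ≠ 0 := (by linarith : (0 : ℝ) < r - 1).ne'
  field_simp
  ring

/-- **Large-rank limit of the symmetric community-detection state-evolution
function**: for `β > 0`, `lim_{r→∞} M_r(β·r·log r) = 1` if `β > 2` and `= 0`
if `β < 2`. -/
theorem community_detection_large_rank_limit (β : ℝ) (hβ : 0 < β) :
    (2 < β → Tendsto (fun r : ℕ => Mr r (β * r * Real.log r)) atTop (nhds 1)) ∧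
    (β < 2 → Tendsto (fun r : ℕ => Mr r (β * r * Real.log r)) atTop (nhds 0)) :=
  ⟨fun h => tendsto_Mr_of_tendsto_softmaxMean hβ (tendsto_softmaxMean_one h),
    fun h => tendsto_Mr_of_tendsto_softmaxMean hβ (tendsto_softmaxMean_zero hβ h)⟩
end

section
/- Large-rank asymptotics of the dynamical spinodal for symmetric community detection: define Δ_Dyn(r) = sup_{x > 0} M_r(x)/x. Then lim_{r→∞} 2·r·log(r)·Δ_Dyn(r) = 1; equivalently, Δ_Dyn(r) = (1 + o(1)) / (2·r·log r) as r → ∞. -/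
open MeasureTheory ProbabilityTheory Filter

/-- The dynamical spinodal `Δ_Dyn(r) = sup_{x > 0} M_r(x)/x`. -/
noncomputable def DeltaDyn (r : ℕ) : ℝ :=
  sSup ((fun x => Mr r x / x) '' Set.Ioi (0 : ℝ))

/-- The law of the independent standard Gaussians `(U₁, (U₂, …, U_{n+1}))`. -/
noncomputable def noiseMeasure (n : ℕ) : Measure (ℝ × (Fin n → ℝ)) :=
  (gaussianReal 0 1).prod (Measure.pi fun _ : Fin n => gaussianReal 0 1)

/-- The posterior weight of the true community at signal strength `s = √(x/r)`. -/
noncomputable def trueWeight {n : ℕ} (s : ℝ) (p : ℝ × (Fin n → ℝ)) : ℝ :=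
  Real.exp (s ^ 2 + p.1 * s) / (Real.exp (s ^ 2 + p.1 * s) + ∑ i, Real.exp (p.2 i * s))

/-- The expected posterior weight of the true community. -/
noncomputable def meanWeight (n : ℕ) (s : ℝ) : ℝ := ∫ p, trueWeight s p ∂noiseMeasure n

instance (n : ℕ) : IsProbabilityMeasure (noiseMeasure n) := by
  unfold noiseMeasure; infer_instance

lemma integrable_exp_affine_gaussianReal (c t : ℝ) :
    Integrable (fun u => Real.exp (c + t * u)) (gaussianReal 0 1) := by
  simp only [Real.exp_add]
  exact (integrable_exp_mul_gaussianReal t).const_mul _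

lemma integral_exp_affine_gaussianReal (c t : ℝ) :
    ∫ u, Real.exp (c + t * u) ∂gaussianReal 0 1 = Real.exp (c + t ^ 2 / 2) := by
  have h := congrFun (mgf_fun_id_gaussianReal (μ := 0) (v := 1)) t
  simp only [mgf, NNReal.coe_one, zero_mul, zero_add, one_mul] at h
  simp only [Real.exp_add, integral_const_mul, h]

lemma trueWeight_nonneg {n : ℕ} (s : ℝ) (p : ℝ × (Fin n → ℝ)) : 0 ≤ trueWeight s p := by
  unfold trueWeight; positivity

lemma trueWeight_le_one {n : ℕ} (s : ℝ) (p : ℝ × (Fin n → ℝ)) : trueWeight s p ≤ 1 := by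
  unfold trueWeight
  refine div_le_one_of_le₀ (le_add_of_nonneg_right ?_) ?_ <;> positivity

lemma integrable_trueWeight (n : ℕ) (s : ℝ) :
    Integrable (fun p => trueWeight s p) (noiseMeasure n) := by
  refine Integrable.of_bound (C := 1) ?_ (ae_of_all _ fun p => ?_)
  · apply Measurable.aestronglyMeasurable
    unfold trueWeight
    fun_prop
  · rw [Real.norm_of_nonneg (trueWeight_nonneg s p)]
    exact trueWeight_le_one s p

lemma meanWeight_le_one (n : ℕ) (s : ℝ) : meanWeight n s ≤ 1 := by
  have := integral_mono (integrable_trueWeight n s) (integrable_const (1 : ℝ))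
    (fun p => trueWeight_le_one s p)
  simpa [meanWeight] using this

/-- Small-signal bound: by convexity of `exp`, the normalisation is at least `n + 1` times the
geometric mean of its terms. -/
lemma succ_mul_meanWeight_le (n : ℕ) (s : ℝ) :
    ((n : ℝ) + 1) * meanWeight n s ≤ Real.exp (3 / 2 * s ^ 2) := by
  set k : ℝ := (n : ℝ) + 1 with hk
  have hk0 : 0 < k := by positivity
  have hpt : ∀ p : ℝ × (Fin n → ℝ), k * trueWeight s p ≤
      Real.exp (s ^ 2 * (n / k) + (s * (n / k)) * p.1) *
        ∏ i, Real.exp (0 + (-(s / k)) * p.2 i) := by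
    intro p
    set c : ℝ := (s ^ 2 + p.1 * s + ∑ i, p.2 i * s) / k with hc
    have hexp : Real.exp (s ^ 2 * (n / k) + (s * (n / k)) * p.1) *
        ∏ i, Real.exp (0 + (-(s / k)) * p.2 i) =
        Real.exp (s ^ 2 + p.1 * s) / Real.exp c := by
      rw [← Real.exp_sum, ← Real.exp_add, ← Real.exp_sub]
      congr 1
      have hn : (n : ℝ) = k - 1 := by rw [hk]; ring
      rw [hc, hn]
      simp only [zero_add, ← Finset.mul_sum, ← Finset.sum_mul]
      field_simp
      ring
    have htan : ∀ z : ℝ, Real.exp c * (1 + (z - c)) ≤ Real.exp z := by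
      intro z
      have h1 := Real.add_one_le_exp (z - c)
      calc Real.exp c * (1 + (z - c)) ≤ Real.exp c * Real.exp (z - c) := by gcongr; linarith
        _ = Real.exp z := by rw [← Real.exp_add]; congr 1; ring
    have hsum : k * Real.exp c ≤
        Real.exp (s ^ 2 + p.1 * s) + ∑ i, Real.exp (p.2 i * s) := by
      have h2 : ∑ i : Fin n, Real.exp c * (1 + (p.2 i * s - c)) ≤ ∑ i, Real.exp (p.2 i * s) :=
        Finset.sum_le_sum fun i _ => htan _
      rw [← Finset.mul_sum, Finset.sum_add_distrib, Finset.sum_sub_distrib] at h2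
      simp only [Finset.sum_const, Finset.card_univ, Fintype.card_fin, nsmul_eq_mul, mul_one] at h2
      have h3 := htan (s ^ 2 + p.1 * s)
      have h4 : c * k = s ^ 2 + p.1 * s + ∑ i, p.2 i * s := by rw [hc]; field_simp
      have h5 : Real.exp c * (1 + (s ^ 2 + p.1 * s - c)) +
          Real.exp c * (n + (∑ i, p.2 i * s - n * c)) = k * Real.exp c := by
        have : ∑ i, p.2 i * s = c * k - (s ^ 2 + p.1 * s) := by linarith
        rw [this, hk]; ring
      linarith
    rw [hexp, trueWeight, mul_div_assoc', div_le_div_iff₀ (by positivity) (Real.exp_pos _)]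
    nlinarith [Real.exp_pos (s ^ 2 + p.1 * s)]
  have hi1 := integrable_exp_affine_gaussianReal (s ^ 2 * (n / k)) (s * (n / k))
  have hi2 : Integrable (fun v : Fin n → ℝ => ∏ i, Real.exp (0 + (-(s / k)) * v i))
      (Measure.pi fun _ => gaussianReal 0 1) :=
    Integrable.fintype_prod fun _ => integrable_exp_affine_gaussianReal 0 (-(s / k))
  have hmono := integral_mono ((integrable_trueWeight n s).const_mul k) (hi1.mul_prod hi2) hpt
  rw [integral_const_mul, noiseMeasure, integral_prod_mul (fun u => Real.exp (s ^ 2 * (n / k) + (s * (n / k)) * u))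
    (fun v : Fin n → ℝ => ∏ i, Real.exp (0 + (-(s / k)) * v i)),
    integral_fintype_prod_eq_pow (fun u => Real.exp (0 + (-(s / k)) * u)),
    integral_exp_affine_gaussianReal, integral_exp_affine_gaussianReal, ← Real.exp_nat_mul,
    ← Real.exp_add] at hmono
  refine hmono.trans (Real.exp_le_exp.2 ?_)
  have : s ^ 2 * (n / k) + (s * (n / k)) ^ 2 / 2 +
      (Fintype.card (Fin n) : ℕ) * (0 + (-(s / k)) ^ 2 / 2) = 3 / 2 * s ^ 2 * (n / k) := by
    have hn : (n : ℝ) = k - 1 := by rw [hk]; ring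
    rw [Fintype.card_fin, hn]
    field_simp
    ring
  rw [this]
  refine mul_le_of_le_one_right (by positivity) ((div_le_one hk0).2 ?_)
  linarith

lemma exp_neg_exp_le {θ : ℝ} (hθ0 : 0 ≤ θ) (hθ1 : θ ≤ 1) (w : ℝ) :
    Real.exp (-Real.exp w) ≤ 1 - Real.exp w + Real.exp ((1 + θ) * w) := by
  rcases le_total w 0 with hw | hw
  · have h1 : Real.exp w ≤ 1 := Real.exp_le_one_iff.2 hw
    have h2 := Real.abs_exp_sub_one_sub_id_le (x := -Real.exp w)
      (by rw [abs_neg, abs_of_pos (Real.exp_pos w)]; exact h1)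
    have h3 := (abs_le.1 h2).2
    have h4 : (-Real.exp w) ^ 2 ≤ Real.exp ((1 + θ) * w) := by
      rw [neg_sq, ← Real.exp_nat_mul]
      refine Real.exp_le_exp.2 ?_
      push_cast
      nlinarith
    linarith
  · have h1 : Real.exp (-Real.exp w) ≤ 1 := Real.exp_le_one_iff.2 (by simp [Real.exp_nonneg])
    have h2 : Real.exp w ≤ Real.exp ((1 + θ) * w) := Real.exp_le_exp.2 (by nlinarith)
    linarith

/-- Below the threshold the mean weight is small: `exp l` is a level which the competing
partition function typically exceeds and the true term typically does not reach. -/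
lemma meanWeight_le (n : ℕ) (s l : ℝ) {θ : ℝ} (hθ0 : 0 ≤ θ) (hθ1 : θ ≤ 1) :
    meanWeight n s ≤ Real.exp (θ * (s ^ 2 * (1 + θ / 2) - l)) +
      Real.exp (1 - n * (Real.exp (s ^ 2 / 2 - l) *
        (1 - Real.exp (θ * (s ^ 2 * (1 + θ / 2) - l))))) := by
  set η := Real.exp (θ * (s ^ 2 * (1 + θ / 2) - l)) with hη
  have hpt : ∀ p : ℝ × (Fin n → ℝ), trueWeight s p ≤
      Real.exp (θ * (s ^ 2 - l) + (θ * s) * p.1) +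
        Real.exp 1 * ∏ i, Real.exp (-Real.exp (-l + s * p.2 i)) := by
    intro p
    have hprod : Real.exp 1 * ∏ i, Real.exp (-Real.exp (-l + s * p.2 i)) =
        Real.exp (1 - (∑ i, Real.exp (p.2 i * s)) / Real.exp l) := by
      rw [← Real.exp_sum, ← Real.exp_add]
      congr 1
      rw [Finset.sum_neg_distrib, sub_eq_add_neg, Finset.sum_div]
      congr 2
      refine Finset.sum_congr rfl fun i _ => ?_
      rw [← Real.exp_sub]
      congr 1; ring
    rw [hprod]
    set S := ∑ i, Real.exp (p.2 i * s) with hS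
    have hS0 : 0 ≤ S := by positivity
    have hle : trueWeight s p ≤ 1 := trueWeight_le_one s p
    have e1 := Real.exp_pos (θ * (s ^ 2 - l) + (θ * s) * p.1)
    have e2 := Real.exp_pos (1 - S / Real.exp l)
    by_cases h1 : S ≤ Real.exp l
    · have : 1 ≤ Real.exp (1 - S / Real.exp l) :=
        Real.one_le_exp (sub_nonneg.2 ((div_le_one (Real.exp_pos l)).2 h1))
      linarith
    · push Not at h1
      have hz : θ * (s ^ 2 - l) + (θ * s) * p.1 = θ * (s ^ 2 + p.1 * s - l) := by ring
      rw [hz] at e1 ⊢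
      set z := s ^ 2 + p.1 * s with hzdef
      rcases le_total l z with h2 | h2
      · have : 1 ≤ Real.exp (θ * (z - l)) := Real.one_le_exp (mul_nonneg hθ0 (by linarith))
        linarith
      · have h3 : trueWeight s p ≤ Real.exp (z - l) := by
          rw [Real.exp_sub, trueWeight]
          refine div_le_div_of_nonneg_left (Real.exp_nonneg _) (Real.exp_pos l) ?_
          have := Real.exp_pos z
          linarith
        have h4 : Real.exp (z - l) ≤ Real.exp (θ * (z - l)) := Real.exp_le_exp.2 (by nlinarith)
        linarith
  have hi1 : Integrable (fun p : ℝ × (Fin n → ℝ) => Real.exp (θ * (s ^ 2 - l) + (θ * s) * p.1))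
      (noiseMeasure n) := (integrable_exp_affine_gaussianReal _ _).comp_fst _
  have hi3 : Integrable (fun u => Real.exp (-Real.exp (-l + s * u))) (gaussianReal 0 1) := by
    refine Integrable.of_bound (C := 1) (by fun_prop) (ae_of_all _ fun u => ?_)
    rw [Real.norm_of_nonneg (Real.exp_nonneg _)]
    exact Real.exp_le_one_iff.2 (by simp [Real.exp_nonneg])
  have hi2 : Integrable (fun p : ℝ × (Fin n → ℝ) =>
      ∏ i, Real.exp (-Real.exp (-l + s * p.2 i))) (noiseMeasure n) :=
    (Integrable.fintype_prod (f := fun (_ : Fin n) u => Real.exp (-Real.exp (-l + s * u)))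
      fun _ => hi3).comp_snd _
  have hmono := integral_mono (integrable_trueWeight n s) (hi1.add (hi2.const_mul (Real.exp 1))) hpt
  have hfst : ∫ p : ℝ × (Fin n → ℝ), Real.exp (θ * (s ^ 2 - l) + (θ * s) * p.1) ∂noiseMeasure n
      = η := by
    rw [noiseMeasure, integral_fun_fst (fun u => Real.exp (θ * (s ^ 2 - l) + (θ * s) * u)),
      integral_exp_affine_gaussianReal, hη]
    simp only [probReal_univ, one_smul]
    congr 1; ring
  have hone : ∫ u, Real.exp (-Real.exp (-l + s * u)) ∂gaussianReal 0 1 ≤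
      Real.exp (-(Real.exp (s ^ 2 / 2 - l) * (1 - η))) := by
    have hj1 := integrable_exp_affine_gaussianReal (-l) s
    have hj2 := integrable_exp_affine_gaussianReal ((1 + θ) * (-l)) ((1 + θ) * s)
    have h := integral_mono hi3 (((integrable_const (1 : ℝ)).sub hj1).add hj2) (fun u => by
      have := exp_neg_exp_le hθ0 hθ1 (-l + s * u)
      rw [mul_add, ← mul_assoc (1 + θ) s u] at this
      exact this)
    refine h.trans (le_trans (le_of_eq ?_) (Real.one_sub_le_exp_neg _))
    rw [integral_add' ((integrable_const (1 : ℝ)).sub hj1) hj2,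
      integral_sub' (integrable_const (1 : ℝ)) hj1, integral_exp_affine_gaussianReal,
      integral_exp_affine_gaussianReal, hη, mul_sub, ← Real.exp_add]
    simp only [integral_const, probReal_univ, one_smul, mul_one]
    ring_nf
  have hsnd : ∫ p : ℝ × (Fin n → ℝ), ∏ i, Real.exp (-Real.exp (-l + s * p.2 i)) ∂noiseMeasure n
      ≤ Real.exp (-(n * (Real.exp (s ^ 2 / 2 - l) * (1 - η)))) := by
    rw [noiseMeasure, integral_fun_snd (fun v : Fin n → ℝ =>
      ∏ i, Real.exp (-Real.exp (-l + s * v i))),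
      integral_fintype_prod_eq_pow (fun u => Real.exp (-Real.exp (-l + s * u)))]
    simp only [probReal_univ, one_smul, Fintype.card_fin]
    refine (pow_le_pow_left₀ (integral_nonneg fun u => Real.exp_nonneg _) hone n).trans
      (le_of_eq ?_)
    rw [← Real.exp_nat_mul]
    congr 1; ring
  calc meanWeight n s ≤ _ := hmono
    _ = η + Real.exp 1 *
        ∫ p : ℝ × (Fin n → ℝ), ∏ i, Real.exp (-Real.exp (-l + s * p.2 i)) ∂noiseMeasure n := by
      rw [integral_add' hi1 (hi2.const_mul _), hfst, integral_const_mul]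
    _ ≤ η + Real.exp 1 * Real.exp (-(n * (Real.exp (s ^ 2 / 2 - l) * (1 - η)))) := by gcongr
    _ = _ := by rw [← Real.exp_add, ← sub_eq_add_neg]

/-- Above the threshold the mean weight is close to one: `exp l` is a level which the true term
typically exceeds and which dominates the competing partition function. -/
lemma le_meanWeight (n : ℕ) (s l : ℝ) {θ : ℝ} (hθ : 0 ≤ θ) :
    1 - n * Real.exp (s ^ 2 / 2 - l) - Real.exp (θ * (l - s ^ 2 * (1 - θ / 2))) ≤
      meanWeight n s := by
  have hpt : ∀ p : ℝ × (Fin n → ℝ), 1 - (∑ i, Real.exp (-l + s * p.2 i) +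
      Real.exp (θ * (l - s ^ 2) + (-(θ * s)) * p.1)) ≤ trueWeight s p := by
    intro p
    have hsum : ∑ i, Real.exp (-l + s * p.2 i) =
        (∑ i, Real.exp (p.2 i * s)) / Real.exp l := by
      rw [Finset.sum_div]
      refine Finset.sum_congr rfl fun i _ => ?_
      rw [← Real.exp_sub]
      congr 1; ring
    have hz : θ * (l - s ^ 2) + (-(θ * s)) * p.1 = θ * (l - (s ^ 2 + p.1 * s)) := by ring
    rw [hsum, hz]
    have hS0 : 0 ≤ ∑ i, Real.exp (p.2 i * s) := by positivity
    have hw := trueWeight_nonneg s p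
    unfold trueWeight at hw ⊢
    set S := ∑ i, Real.exp (p.2 i * s) with hS
    set z := s ^ 2 + p.1 * s with hzdef
    have e1 := Real.exp_pos (θ * (l - z))
    have e2 := Real.exp_pos z
    rcases le_total l z with h | h
    · have h1 : 1 - Real.exp z / (Real.exp z + S) = S / (Real.exp z + S) := by
        field_simp; ring
      have h2 : S / (Real.exp z + S) ≤ S / Real.exp l := by
        refine div_le_div_of_nonneg_left hS0 (Real.exp_pos l) ?_
        have := Real.exp_le_exp.2 h
        linarith
      linarith
    · have h1 : 1 ≤ Real.exp (θ * (l - z)) := Real.one_le_exp (mul_nonneg hθ (by linarith))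
      have h2 : 0 ≤ S / Real.exp l := by positivity
      linarith
  have hi1 : Integrable (fun p : ℝ × (Fin n → ℝ) =>
      Real.exp (θ * (l - s ^ 2) + (-(θ * s)) * p.1)) (noiseMeasure n) :=
    (integrable_exp_affine_gaussianReal _ _).comp_fst _
  have hi2 : ∀ i : Fin n, Integrable (fun v : Fin n → ℝ => Real.exp (-l + s * v i))
      (Measure.pi fun _ => gaussianReal 0 1) := fun i =>
    integrable_comp_eval (μ := fun _ : Fin n => gaussianReal 0 1)
      (integrable_exp_affine_gaussianReal (-l) s)
  have hi3 : Integrable (fun p : ℝ × (Fin n → ℝ) => ∑ i, Real.exp (-l + s * p.2 i))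
      (noiseMeasure n) := (integrable_finsetSum _ fun i _ => hi2 i).comp_snd _
  have hmono := integral_mono ((integrable_const (1 : ℝ)).sub (hi3.add hi1))
    (integrable_trueWeight n s) hpt
  refine le_trans (le_of_eq ?_) hmono
  rw [integral_sub' (integrable_const _) (hi3.add hi1), integral_add' hi3 hi1, noiseMeasure,
    integral_fun_fst (fun u => Real.exp (θ * (l - s ^ 2) + (-(θ * s)) * u)),
    integral_fun_snd (fun v : Fin n → ℝ => ∑ i, Real.exp (-l + s * v i)),
    integral_finsetSum _ (fun i _ => hi2 i)]
  have hev : ∀ i : Fin n, ∫ v : Fin n → ℝ, Real.exp (-l + s * v i)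
      ∂(Measure.pi fun _ => gaussianReal 0 1) = Real.exp (-l + s ^ 2 / 2) := fun i => by
    rw [← integral_exp_affine_gaussianReal]
    exact integral_comp_eval (μ := fun _ : Fin n => gaussianReal 0 1) (i := i)
      (f := fun u => Real.exp (-l + s * u)) (by fun_prop)
  simp only [hev, integral_exp_affine_gaussianReal, integral_const, probReal_univ, one_smul,
    Finset.sum_const, Finset.card_univ, Fintype.card_fin, nsmul_eq_mul]
  ring_nf

lemma exp_neg_three_le : Real.exp (-3) ≤ 1 / 16 := by
  have h := Real.exp_one_gt_d9
  have h3 : Real.exp 3 = Real.exp 1 ^ 3 := by rw [← Real.exp_nat_mul]; norm_num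
  have : (2.7 : ℝ) ^ 3 ≤ Real.exp 3 := by
    rw [h3]
    exact pow_le_pow_left₀ (by norm_num) (by linarith) 3
  rw [Real.exp_neg, one_div]
  exact inv_anti₀ (by norm_num) (by norm_num at this; linarith)

lemma tendsto_log_nat_succ_atTop : Tendsto (fun n : ℕ => Real.log ((n : ℝ) + 1)) atTop atTop :=
  Real.tendsto_log_atTop.comp (tendsto_atTop_add_const_right _ _ tendsto_natCast_atTop_atTop)

lemma three_mul_mul_exp_le {y : ℝ} (hy : 128 ≤ y) :
    3 * y * Real.exp (3 * y / 4) ≤ Real.exp y - 1 := by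
  have h1 := Real.quadratic_le_exp_of_nonneg (x := y / 4) (by linarith)
  have h2 : 4 * y ≤ Real.exp (y / 4) := by nlinarith
  have h3 : Real.exp y = Real.exp (y / 4) * Real.exp (3 * y / 4) := by
    rw [← Real.exp_add]; congr 1; ring
  have h4 : 1 ≤ Real.exp (3 * y / 4) := Real.one_le_exp (by linarith)
  rw [h3]
  nlinarith [mul_le_mul_of_nonneg_right h2 (Real.exp_nonneg (3 * y / 4))]

lemma overlap_le_meanWeight {n : ℕ} (hn : 0 < n) (s : ℝ) :
    (((n : ℝ) + 1) * meanWeight n s - 1) / n ≤ meanWeight n s := by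
  have hn' : (0 : ℝ) < n := by exact_mod_cast hn
  rw [div_le_iff₀ hn']
  linarith [meanWeight_le_one n s]

lemma eventually_overlap_le {ε : ℝ} (hε0 : 0 < ε) (hε : ε ≤ 1 / 2) :
    ∀ᶠ n : ℕ in atTop, ∀ s : ℝ,
      (((n : ℝ) + 1) * meanWeight n s - 1) / n * (2 * Real.log ((n : ℝ) + 1)) ≤
        (1 + 2 * ε) * s ^ 2 := by
  filter_upwards [tendsto_log_nat_succ_atTop.eventually_ge_atTop 128,
    tendsto_log_nat_succ_atTop.eventually_ge_atTop ((3 / ε + Real.log 2 + Real.log 10) / ε ^ 2),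
    eventually_gt_atTop 0] with n h128 hlarge hn s
  have hn1 : (1 : ℝ) ≤ n := by exact_mod_cast hn
  have hn0 : (0 : ℝ) < n := by linarith
  have hle := overlap_le_meanWeight hn s
  set ℓ := Real.log ((n : ℝ) + 1) with hℓ
  set G := (((n : ℝ) + 1) * meanWeight n s - 1) / n with hG
  have hs : 0 ≤ s ^ 2 := sq_nonneg s
  rcases le_or_gt (2 * (1 - ε) * ℓ) (s ^ 2) with h1 | h1
  · have hG1 : G ≤ 1 := hle.trans (meanWeight_le_one n s)
    calc G * (2 * ℓ) ≤ 1 * (2 * ℓ) := by gcongr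
      _ ≤ (1 + 2 * ε) * (2 * (1 - ε) * ℓ) := by
        nlinarith [mul_nonneg (mul_nonneg hε0.le (by linarith : 0 ≤ 1 - 2 * ε))
          (by linarith : 0 ≤ ℓ)]
      _ ≤ (1 + 2 * ε) * s ^ 2 := by gcongr
  rcases le_or_gt (s ^ 2) (ℓ / 2) with h2 | h2
  · have hP := succ_mul_meanWeight_le n s
    set y := 3 / 2 * s ^ 2 with hy
    have hy1 : Real.exp y - 1 ≤ y * Real.exp y := by
      have h := Real.add_one_le_exp (-y)
      have h' : Real.exp (-y) * Real.exp y = 1 := by rw [← Real.exp_add]; simp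
      nlinarith [Real.exp_pos y]
    have hy2 : Real.exp y ≤ Real.exp (3 * ℓ / 4) := Real.exp_le_exp.2 (by rw [hy]; linarith)
    have h3 := three_mul_mul_exp_le h128
    have hexpℓ : Real.exp ℓ = (n : ℝ) + 1 := Real.exp_log (by linarith)
    rw [hexpℓ] at h3
    have hy0 : 0 ≤ y := by positivity
    have hGn : G * n ≤ y * Real.exp (3 * ℓ / 4) := by
      rw [hG, div_mul_cancel₀ _ hn0.ne']
      nlinarith
    have hmul : G * (2 * ℓ) * n ≤ s ^ 2 * n := by
      calc G * (2 * ℓ) * n = (G * n) * (2 * ℓ) := by ring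
        _ ≤ (y * Real.exp (3 * ℓ / 4)) * (2 * ℓ) := by gcongr
        _ = s ^ 2 * (3 * ℓ * Real.exp (3 * ℓ / 4)) := by rw [hy]; ring
        _ ≤ s ^ 2 * n := by gcongr; linarith
    have := le_of_mul_le_mul_right hmul hn0
    nlinarith
  · have hlog : ℓ - Real.log 2 ≤ Real.log n := by
      rw [hℓ, ← Real.log_div (by linarith) (by norm_num)]
      exact Real.log_le_log (by linarith) (by linarith)
    have hP := meanWeight_le n s (s ^ 2 / 2 + Real.log n - Real.log 10) hε0.le (by linarith)
    have hcoef : (n : ℝ) * Real.exp (s ^ 2 / 2 - (s ^ 2 / 2 + Real.log n - Real.log 10)) = 10 := by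
      rw [show s ^ 2 / 2 - (s ^ 2 / 2 + Real.log n - Real.log 10) = Real.log 10 - Real.log n by ring,
        Real.exp_sub, Real.exp_log (by norm_num), Real.exp_log hn0]
      field_simp
    rw [← mul_assoc, hcoef] at hP
    set η := Real.exp (ε * (s ^ 2 * (1 + ε / 2) - (s ^ 2 / 2 + Real.log n - Real.log 10)))
    have hη : η ≤ 1 / 16 := by
      refine le_trans (Real.exp_le_exp.2 ?_) exp_neg_three_le
      rw [div_le_iff₀ (by positivity)] at hlarge
      have h4 : s ^ 2 * (1 + ε) / 2 ≤ (1 - ε ^ 2) * ℓ := by nlinarith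
      have h5 : s ^ 2 * (1 + ε / 2) - (s ^ 2 / 2 + Real.log n - Real.log 10) ≤ -(3 / ε) := by
        linarith
      calc _ ≤ ε * (-(3 / ε)) := by gcongr
        _ = -3 := by field_simp
    have h6 : Real.exp (1 - 10 * (1 - η)) ≤ 1 / 16 :=
      le_trans (Real.exp_le_exp.2 (by linarith)) exp_neg_three_le
    have h7 : G ≤ 1 / 8 := by linarith
    calc G * (2 * ℓ) ≤ 1 / 8 * (2 * ℓ) := by gcongr
      _ ≤ (1 + 2 * ε) * s ^ 2 := by nlinarith

lemma eventually_exists_le_overlap {ε : ℝ} (hε0 : 0 < ε) (hε : ε ≤ 1 / 2) :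
    ∀ᶠ n : ℕ in atTop, ∃ s : ℝ, 0 < s ∧ (1 - 2 * ε) * s ^ 2 ≤
      (((n : ℝ) + 1) * meanWeight n s - 1) / n * (2 * Real.log ((n : ℝ) + 1)) := by
  filter_upwards [tendsto_log_nat_succ_atTop.eventually_ge_atTop 1,
    tendsto_log_nat_succ_atTop.eventually_ge_atTop
      ((Real.log (4 / ε) / (ε / 2) + Real.log (4 / ε)) / (ε / 4)),
    eventually_gt_atTop 0] with n h1 hlarge hn
  have hn1 : (1 : ℝ) ≤ n := by exact_mod_cast hn
  have hn0 : (0 : ℝ) < n := by linarith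
  set ℓ := Real.log ((n : ℝ) + 1) with hℓ
  have hpos : 0 < 2 * (1 + ε) * ℓ := by positivity
  refine ⟨√(2 * (1 + ε) * ℓ), Real.sqrt_pos.2 hpos, ?_⟩
  set s := √(2 * (1 + ε) * ℓ) with hs
  have hs2 : s ^ 2 = 2 * (1 + ε) * ℓ := Real.sq_sqrt hpos.le
  have hP := le_meanWeight n s (s ^ 2 / 2 + Real.log n + Real.log (4 / ε))
    (by positivity : 0 ≤ ε / 2)
  have hcoef : (n : ℝ) * Real.exp (s ^ 2 / 2 - (s ^ 2 / 2 + Real.log n + Real.log (4 / ε))) =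
      ε / 4 := by
    rw [show s ^ 2 / 2 - (s ^ 2 / 2 + Real.log n + Real.log (4 / ε)) =
        -(Real.log n + Real.log (4 / ε)) by ring, Real.exp_neg, Real.exp_add,
      Real.exp_log hn0, Real.exp_log (by positivity)]
    field_simp
  have htail : Real.exp (ε / 2 * (s ^ 2 / 2 + Real.log n + Real.log (4 / ε) -
      s ^ 2 * (1 - ε / 2 / 2))) ≤ ε / 4 := by
    have hlog : Real.log n ≤ ℓ := Real.log_le_log hn0 (by linarith)
    rw [div_le_iff₀ (by positivity)] at hlarge
    have h2 : s ^ 2 / 2 + Real.log n + Real.log (4 / ε) - s ^ 2 * (1 - ε / 2 / 2) ≤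
        -(Real.log (4 / ε) / (ε / 2)) := by
      rw [hs2]
      nlinarith [mul_nonneg (mul_nonneg hε0.le (by linarith : 0 ≤ 1 - 2 * ε))
        (by linarith : 0 ≤ ℓ)]
    calc _ ≤ Real.exp (ε / 2 * (-(Real.log (4 / ε) / (ε / 2)))) := by gcongr
      _ = Real.exp (-Real.log (4 / ε)) := by congr 1; field_simp
      _ = ε / 4 := by rw [Real.exp_neg, Real.exp_log (by positivity), inv_div]
  have hP' : 1 - ε / 2 ≤ meanWeight n s := by linarith
  have hG : 1 - ε ≤ (((n : ℝ) + 1) * meanWeight n s - 1) / n := by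
    rw [le_div_iff₀ hn0]
    nlinarith
  calc (1 - 2 * ε) * s ^ 2 ≤ (1 - ε) * (2 * ℓ) := by
        rw [hs2]
        nlinarith [mul_nonneg (sq_nonneg ε) (by linarith : 0 ≤ ℓ)]
    _ ≤ _ := by gcongr

lemma Mr_succ (n : ℕ) {x : ℝ} (hx : 0 ≤ x) :
    Mr (n + 1) x = (((n : ℝ) + 1) * meanWeight n √(x / ((n : ℝ) + 1)) - 1) / n := by
  have hsq : √(x / ((n : ℝ) + 1)) ^ 2 = x / ((n : ℝ) + 1) := Real.sq_sqrt (by positivity)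
  simp only [Mr, meanWeight, trueWeight, noiseMeasure, Nat.cast_add, Nat.cast_one,
    add_sub_cancel_right, hsq]
  exact one_div_mul_eq_div _ _

/-- **Large-rank asymptotics of the dynamical spinodal for symmetric community
detection**: `Δ_Dyn(r) = (1 + o(1)) / (2·r·log r)` as `r → ∞`, i.e.
`lim_{r→∞} 2·r·log(r)·Δ_Dyn(r) = 1`. -/
theorem dynamical_spinodal_large_rank_asymptotics :
    Tendsto (fun r : ℕ => 2 * (r : ℝ) * Real.log r * DeltaDyn r) atTop (nhds 1) := by
  rw [← tendsto_add_atTop_iff_nat 1]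
  simp only [Nat.cast_add, Nat.cast_one]
  have hbdd : ∀ ε : ℝ, 0 < ε → ε ≤ 1 / 2 → ∀ᶠ n : ℕ in atTop, ∀ x > 0,
      Mr (n + 1) x / x ≤ (1 + 2 * ε) / (2 * ((n : ℝ) + 1) * Real.log ((n : ℝ) + 1)) := by
    intro ε hε0 hε
    filter_upwards [eventually_overlap_le hε0 hε,
      tendsto_log_nat_succ_atTop.eventually_gt_atTop 0] with n h hlog x hx
    have hk : (0 : ℝ) < (n : ℝ) + 1 := by positivity
    have h1 := h √(x / ((n : ℝ) + 1))
    rw [← Mr_succ n hx.le, Real.sq_sqrt (by positivity)] at h1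
    rw [div_le_div_iff₀ hx (by positivity)]
    calc _ = (Mr (n + 1) x * (2 * Real.log ((n : ℝ) + 1))) * ((n : ℝ) + 1) := by ring
      _ ≤ ((1 + 2 * ε) * (x / ((n : ℝ) + 1))) * ((n : ℝ) + 1) := by gcongr
      _ = (1 + 2 * ε) * x := by field_simp
  refine tendsto_order.2 ⟨fun a ha => ?_, fun b hb => ?_⟩
  · set ε := min ((1 - a) / 4) (1 / 2)
    have hε0 : 0 < ε := lt_min (by linarith) (by norm_num)
    have hε : ε ≤ 1 / 2 := min_le_right _ _
    have hεa : ε ≤ (1 - a) / 4 := min_le_left _ _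
    filter_upwards [eventually_exists_le_overlap hε0 hε, hbdd ε hε0 hε,
      tendsto_log_nat_succ_atTop.eventually_gt_atTop 0] with n ⟨s, hs, h⟩ hb hlog
    have hk : (0 : ℝ) < (n : ℝ) + 1 := by positivity
    have hx : 0 < s ^ 2 * ((n : ℝ) + 1) := by positivity
    have hle : Mr (n + 1) (s ^ 2 * ((n : ℝ) + 1)) / (s ^ 2 * ((n : ℝ) + 1)) ≤
        DeltaDyn (n + 1) :=
      le_csSup ⟨_, Set.forall_mem_image.2 fun x hx => hb x hx⟩ (Set.mem_image_of_mem _ hx)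
    rw [Mr_succ n hx.le, mul_div_cancel_right₀ _ hk.ne', Real.sqrt_sq hs.le,
      div_le_iff₀ hx] at hle
    have h2 : (1 - 2 * ε) * s ^ 2 ≤
        (2 * ((n : ℝ) + 1) * Real.log ((n : ℝ) + 1) * DeltaDyn (n + 1)) * s ^ 2 :=
      h.trans ((mul_le_mul_of_nonneg_right hle (by positivity)).trans (le_of_eq (by ring)))
    have h3 := le_of_mul_le_mul_right h2 (by positivity)
    linarith
  · set ε := min ((b - 1) / 4) (1 / 2)
    have hε0 : 0 < ε := lt_min (by linarith) (by norm_num)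
    have hε : ε ≤ 1 / 2 := min_le_right _ _
    have hεb : ε ≤ (b - 1) / 4 := min_le_left _ _
    filter_upwards [hbdd ε hε0 hε,
      tendsto_log_nat_succ_atTop.eventually_gt_atTop 0] with n hb hlog
    have hsup : DeltaDyn (n + 1) ≤
        (1 + 2 * ε) / (2 * ((n : ℝ) + 1) * Real.log ((n : ℝ) + 1)) :=
      csSup_le (Set.nonempty_Ioi.image _) (Set.forall_mem_image.2 fun x hx => hb x hx)
    rw [le_div_iff₀ (by positivity)] at hsup
    linarith
end
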